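/- Let K = p1 ∩ p2 ∩ p3 ∩ p4, where p1, p2, p3, p4 are four distinct linear primes of height 2 in R. If either K = I^un or K = L, then pd(R/I) ≤ 5. -/

import Mathlib

open MvPolynomial Filter CategoryTheory

noncomputable section

/-- The height of an ideal `J`: the infimum of the heights of the prime ideals containing it. -/
def idealHeight {R : Type} [CommRing R] (J : Ideal R) : ℕ∞ :=
  ⨅ p ∈ {p : {q : Ideal R // q.IsPrime} | J ≤ p.1}, Order.height p

/-- `pdQuotLE J n` holds iff `R ⧸ J` admits a projective resolution of length at most `n`,
i.e. the projective dimension of `R ⧸ J` as an `R`-module is at most `n`. -/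
def pdQuotLE {R : Type} [CommRing R] (J : Ideal R) (n : ℕ) : Prop :=
  ∃ P : ProjectiveResolution (ModuleCat.of R (R ⧸ J)),
    ∀ i, n < i → Limits.IsZero (P.complex.X i)

/-- The `p`-primary component of `J` for `p` a minimal prime of `J`:
the saturation of `J` at `p`. -/
def primaryComponent {R : Type} [CommRing R] (J p : Ideal R) : Ideal R :=
  ⨆ (s : R) (_ : s ∉ p), Submodule.colon J (Ideal.span {s})

/-- The unmixed part `J^un` of `J`: the intersection of the primary components of `J`
corresponding to the minimal primes of `J` of minimal height. -/
def unmixedPart {R : Type} [CommRing R] (J : Ideal R) : Ideal R :=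
  ⨅ p ∈ {p : Ideal R | p.IsPrime ∧ J ≤ p ∧ idealHeight p = idealHeight J},
    primaryComponent J p

/-- A linear prime: a prime ideal generated by forms of degree one. -/
def IsLinearPrime {k : Type} [CommSemiring k] {N : ℕ} (p : Ideal (MvPolynomial (Fin N) k)) : Prop :=
  p.IsPrime ∧ ∃ S : Set (MvPolynomial (Fin N) k), (∀ ℓ ∈ S, ℓ.IsHomogeneous 1) ∧ p = Ideal.span S

/-- A homogeneous ideal: an ideal generated by homogeneous elements. -/
def IsHomogeneousIdeal {k : Type} [CommSemiring k] {N : ℕ}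
    (J : Ideal (MvPolynomial (Fin N) k)) : Prop :=
  ∃ S : Set (MvPolynomial (Fin N) k), (∀ g ∈ S, ∃ d, g.IsHomogeneous d) ∧ J = Ideal.span S

/-- `[B]_n`: the ideal generated by all forms of degree `n` belonging to `B`. -/
def degreePart {k : Type} [CommSemiring k] {N : ℕ} (B : Ideal (MvPolynomial (Fin N) k)) (n : ℕ) :
    Ideal (MvPolynomial (Fin N) k) :=
  Ideal.span {f | f ∈ B ∧ f.IsHomogeneous n}

/-- The Hilbert–Samuel function of `R/J` with respect to the irrelevant maximal ideal:
`n ↦ length (R / (J + 𝔪^n)) = dim_k (R / (J + 𝔪^n))`. -/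
def hilbertSamuelFn {k : Type} [Field k] {N : ℕ} (J : Ideal (MvPolynomial (Fin N) k))
    (n : ℕ) : ℕ :=
  Module.finrank k
    (MvPolynomial (Fin N) k ⧸
      (J ⊔ (Ideal.span (Set.range (MvPolynomial.X : Fin N → MvPolynomial (Fin N) k))) ^ n))

/-- `HasMultiplicity J d e`: the quotient `R/J` has Krull dimension `d` and Hilbert–Samuel
multiplicity `e`, expressed through the asymptotics `d! · HS_J(n) / n^d → e` of the
Hilbert–Samuel function. -/
def HasMultiplicity {k : Type} [Field k] {N : ℕ} (J : Ideal (MvPolynomial (Fin N) k))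
    (d e : ℕ) : Prop :=
  Tendsto (fun n : ℕ => (Nat.factorial d : ℝ) * (hilbertSamuelFn J n : ℝ) / (n : ℝ) ^ d)
    atTop (nhds (e : ℝ))

/-- An ideal of `R` is extended from a subalgebra `A` if it is generated by elements of `A`. -/
def extendedFrom {k R : Type} [CommRing k] [CommRing R] [Algebra k R]
    (K : Ideal R) (A : Subalgebra k R) : Prop :=
  ∃ S : Set R, S ⊆ (A : Set R) ∧ K = Ideal.span S

namespace S19

/-- projective dimension at most n -/
def PD (R : Type) [CommRing R] (M : Type) [AddCommGroup M] [Module R M] (n : ℕ) : Prop :=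
  HasProjectiveDimensionLT (ModuleCat.of R M) (n + 1)

section
variable {R : Type} [CommRing R] {M₁ M₂ M₃ : Type} [AddCommGroup M₁] [Module R M₁]
  [AddCommGroup M₂] [Module R M₂] [AddCommGroup M₃] [Module R M₃]

theorem PD.mono {n m : ℕ} (h : PD R M₁ n) (hnm : n ≤ m) : PD R M₁ m := by
  unfold PD at *
  exact hasProjectiveDimensionLT_of_ge _ (n+1) (m+1) (by omega)

theorem PD.of_equiv {n : ℕ} (h : PD R M₁ n) (e : M₁ ≃ₗ[R] M₂) : PD R M₂ n := by
  unfold PD at *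
  exact hasProjectiveDimensionLT_of_iso e.toModuleIso (n+1)

theorem PD_zero_iff : PD R M₁ 0 ↔ Module.Projective R M₁ := by
  unfold PD
  rw [IsProjective.iff_projective]
  exact projective_iff_hasProjectiveDimensionLT_one.symm

theorem PD_of_projective [Module.Projective R M₁] (n : ℕ) : PD R M₁ n :=
  (PD_zero_iff.2 inferInstance).mono (Nat.zero_le _)

theorem shortExact_mk {f : M₁ →ₗ[R] M₂} {g : M₂ →ₗ[R] M₃} (hf : Function.Injective f)
    (hfg : Function.Exact f g) (hg : Function.Surjective g) :
    (ShortComplex.mk (ModuleCat.ofHom f) (ModuleCat.ofHom g)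
      (by ext x; exact hfg.apply_apply_eq_zero x)).ShortExact := by
  refine { exact := ?_, mono_f := ?_, epi_g := ?_ }
  · rw [ShortComplex.ShortExact.moduleCat_exact_iff_function_exact]
    exact hfg
  · exact (ModuleCat.mono_iff_injective _).2 hf
  · exact (ModuleCat.epi_iff_surjective _).2 hg

theorem PD.x1 {n : ℕ} {f : M₁ →ₗ[R] M₂} {g : M₂ →ₗ[R] M₃} (hf : Function.Injective f)
    (hfg : Function.Exact f g) (hg : Function.Surjective g) (h2 : PD R M₂ n)
    (h3 : PD R M₃ (n+1)) : PD R M₁ n :=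
  (shortExact_mk hf hfg hg).hasProjectiveDimensionLT_X₁ (n+1) h2 h3

theorem PD.x2 {n : ℕ} {f : M₁ →ₗ[R] M₂} {g : M₂ →ₗ[R] M₃} (hf : Function.Injective f)
    (hfg : Function.Exact f g) (hg : Function.Surjective g) (h1 : PD R M₁ n)
    (h3 : PD R M₃ n) : PD R M₂ n :=
  (shortExact_mk hf hfg hg).hasProjectiveDimensionLT_X₂ (n+1) h1 h3

theorem PD.x3 {n : ℕ} {f : M₁ →ₗ[R] M₂} {g : M₂ →ₗ[R] M₃} (hf : Function.Injective f)
    (hfg : Function.Exact f g) (hg : Function.Surjective g) (h1 : PD R M₁ n)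
    (h2 : PD R M₂ (n+1)) : PD R M₃ (n+1) :=
  (shortExact_mk hf hfg hg).hasProjectiveDimensionLT_X₃ (n+1) h1 h2

theorem PD.of_semiEquiv {R S : Type} [CommRing R] [CommRing S] {M N : Type} [AddCommGroup M]
    [Module R M] [AddCommGroup N] [Module S N] (e : R ≃+* S) (φ : M ≃+ N)
    (hφ : ∀ (r : R) (m : M), φ (r • m) = e r • φ m) {n : ℕ} (h : PD R M n) : PD S N n := by
  have : HasProjectiveDimensionLE (ModuleCat.of R M) n := h
  letI := RingHomInvPair.of_ringEquiv e
  letI := RingHomInvPair.symm (RingHomClass.toRingHom e) (RingHomClass.toRingHom e.symm)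
  exact ModuleCat.hasProjectiveDimensionLE_of_semiLinearEquiv (M := ModuleCat.of R M)
    (N := ModuleCat.of S N) e { φ with map_smul' := hφ } n

theorem PD.succ_exists {n : ℕ} (h : PD R M₁ (n+1)) :
    PD R (LinearMap.ker (Finsupp.linearCombination R (id : M₁ → M₁))) n := by
  refine PD.x1 (f := Submodule.subtype _) (g := Finsupp.linearCombination R (id : M₁ → M₁))
    Subtype.val_injective ?_ (Finsupp.linearCombination_id_surjective R M₁) (PD_of_projective n) h
  exact LinearMap.exact_subtype_ker_map _

theorem PD.prod {n : ℕ} (h1 : PD R M₁ n) (h2 : PD R M₂ n) : PD R (M₁ × M₂) n := by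
  refine PD.x2 (f := LinearMap.inl R M₁ M₂) (g := LinearMap.snd R M₁ M₂) LinearMap.inl_injective
    ?_ LinearMap.snd_surjective h1 h2
  exact Function.Exact.inl_snd

theorem PD.subsingleton [Subsingleton M₁] (n : ℕ) : PD R M₁ n := PD_of_projective n

end
end S19

namespace S19
open TensorProduct Polynomial

theorem PD.pi {R : Type} [CommRing R] {n : ℕ} : ∀ {m : ℕ} {M : Fin m → Type}
    [∀ i, AddCommGroup (M i)] [∀ i, Module R (M i)], (∀ i, PD R (M i) n) → PD R (∀ i, M i) n
  | 0, _, _, _, _ => PD.subsingleton n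
  | m+1, M, _, _, h =>
    ((h 0).prod (PD.pi (M := fun i : Fin m => M i.succ) fun i => h i.succ)).of_equiv
      (Fin.consLinearEquiv R M)

theorem PD.baseChange {S R : Type} [CommRing S] [CommRing R] [Algebra S R] [Module.Flat S R]
    {n : ℕ} : ∀ {M : Type} [AddCommGroup M] [Module S M], PD S M n → PD R (R ⊗[S] M) n := by
  induction n with
  | zero =>
    intro M _ _ h
    have := PD_zero_iff.1 h
    exact PD_of_projective 0
  | succ n ih =>
    intro M _ _ h
    have h1 := ih h.succ_exists
    refine PD.x3 (f := LinearMap.baseChange R (Submodule.subtype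
      (LinearMap.ker (Finsupp.linearCombination S (id : M → M)))))
      (g := LinearMap.baseChange R (Finsupp.linearCombination S (id : M → M))) ?_ ?_ ?_ h1
      (PD_of_projective _)
    · exact Module.Flat.lTensor_preserves_injective_linearMap _ Subtype.val_injective
    · exact lTensor_exact R (LinearMap.exact_subtype_ker_map _)
        (Finsupp.linearCombination_id_surjective S M)
    · exact LinearMap.lTensor_surjective R (Finsupp.linearCombination_id_surjective S M)

section syz
variable {S : Type} [CommRing S] {M : Type} [AddCommGroup M] [Module S M] [Module S[X] M]
  [IsScalarTower S S[X] M]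

/-- evaluation `S[X] ⊗ M → M`. -/
def syzEv (S M : Type) [CommRing S] [AddCommGroup M] [Module S M] [Module S[X] M]
  [IsScalarTower S S[X] M] : S[X] ⊗[S] M →ₗ[S[X]] M :=
  TensorProduct.AlgebraTensorModule.lift
    { toFun := fun p => { toFun := fun m => p • m, map_add' := smul_add _,
                          map_smul' := fun r x => smul_comm _ _ _ }
      map_add' := fun p q => by ext; simp [add_smul]
      map_smul' := fun r x => by ext; simp [mul_smul] }

@[simp] theorem syzEv_tmul (p : S[X]) (m : M) : syzEv S M (p ⊗ₜ m) = p • m := rfl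

/-- multiplication by X on M, S-linear -/
def mulX (S M : Type) [CommRing S] [AddCommGroup M] [Module S M] [Module S[X] M]
  [IsScalarTower S S[X] M] : M →ₗ[S] M where
  toFun m := (X : S[X]) • m
  map_add' := smul_add _
  map_smul' r x := smul_comm _ _ _

/-- X⊗1 - 1⊗X -/
def syzTheta (S M : Type) [CommRing S] [AddCommGroup M] [Module S M] [Module S[X] M]
  [IsScalarTower S S[X] M] : S[X] ⊗[S] M →ₗ[S[X]] S[X] ⊗[S] M :=
  (X : S[X]) • LinearMap.id - LinearMap.baseChange S[X] (mulX S M)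

@[simp] theorem syzTheta_tmul (p : S[X]) (m : M) :
    syzTheta S M (p ⊗ₜ m) = ((X : S[X]) * p) ⊗ₜ m - p ⊗ₜ ((X : S[X]) • m) := by
  simp [syzTheta, TensorProduct.smul_tmul', mulX]

theorem syz_mod (t : S[X] ⊗[S] M) :
    t - (1 : S[X]) ⊗ₜ syzEv S M t ∈ LinearMap.range (syzTheta S M) := by
  induction t with
  | zero => simp
  | add a b ha hb =>
    rw [map_add, tmul_add]
    convert Submodule.add_mem _ ha hb using 1
    abel
  | tmul p m =>
    induction p using Polynomial.induction_on' with
    | add p q hp hq =>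
      rw [add_tmul, map_add, tmul_add]
      convert Submodule.add_mem _ hp hq using 1
      abel
    | monomial n a =>
      induction n generalizing m with
      | zero =>
        have : (monomial 0 a : S[X]) = a • 1 := by
          rw [Polynomial.monomial_zero_left, Polynomial.smul_eq_C_mul, mul_one]
        rw [this]
        simp [smul_tmul]
      | succ n ih =>
        have h1 : (monomial (n+1) a : S[X]) = (X : S[X]) * monomial n a := by
          rw [Polynomial.X_mul_monomial]
        have h2 := ih ((X : S[X]) • m)
        have h3 : syzTheta S M ((monomial n a : S[X]) ⊗ₜ m) ∈ LinearMap.range (syzTheta S M) :=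
          ⟨_, rfl⟩
        convert Submodule.add_mem _ h3 h2 using 1
        rw [syzTheta_tmul, ← h1, syzEv_tmul, syzEv_tmul, smul_smul, mul_comm, ← h1]
        abel

theorem syz_exact : Function.Exact (syzTheta S M) (syzEv S M) := by
  intro t
  constructor
  · intro h
    have := syz_mod t
    rw [h, tmul_zero, sub_zero] at this
    exact this
  · rintro ⟨t, rfl⟩
    induction t with
    | zero => simp
    | add a b ha hb => rw [map_add, map_add, ha, hb, add_zero]
    | tmul p m => rw [syzTheta_tmul, map_sub, syzEv_tmul, syzEv_tmul, smul_smul, mul_comm, sub_self]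

theorem syzTheta_inj : Function.Injective (syzTheta S M) := by
  rw [injective_iff_map_eq_zero]
  intro t ht
  set e := PolynomialModule.polynomialTensorProductLEquivPolynomialModule S M with he
  have he1 : ∀ (p : S[X]) (m : M) (i : ℕ), (e (p ⊗ₜ m)).coeff i = p.coeff i • m := by
    intro p m i
    have : e (p ⊗ₜ m) = p • PolynomialModule.single S 0 m := by
      simp [e, PolynomialModule.polynomialTensorProductLEquivPolynomialModule]
      rfl
    rw [this, PolynomialModule.smul_single_apply]
    simp
  have key : ∀ (t : S[X] ⊗[S] M) (i : ℕ),
      (e (syzTheta S M t)).coeff (i+1) = (e t).coeff i - (X : S[X]) • (e t).coeff (i+1) := by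
    intro t i
    induction t with
    | zero => simp
    | add a b ha hb =>
      simp only [map_add, PolynomialModule.coeff_add, Finsupp.add_apply, ha, hb, smul_add]; abel
    | tmul p m =>
      have hs : ∀ (u v : PolynomialModule S M) (j : ℕ), (u - v).coeff j = u.coeff j - v.coeff j :=
        fun u v j => rfl
      rw [syzTheta_tmul, map_sub, hs, he1, he1, he1,
        he1, Polynomial.coeff_X_mul, smul_comm]
  have hz : ∀ i, (e t).coeff i = (X : S[X]) • (e t).coeff (i+1) := by
    intro i
    have := key t i
    rw [ht, map_zero] at this
    exact (sub_eq_zero.1 this.symm)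
  have hz2 : ∀ n i, (e t).coeff i = ((X : S[X]) ^ n) • (e t).coeff (i+n) := by
    intro n
    induction n with
    | zero => simp
    | succ n ih =>
      intro i
      rw [ih, hz, smul_smul, ← pow_succ, add_assoc]
  have : e t = 0 := by
    rw [← PolynomialModule.coeff_eq_zero]
    ext i
    obtain ⟨n, hn⟩ : ∃ n, ∀ j, n ≤ j → (e t).coeff j = 0 := by
      refine ⟨(e t).coeff.support.sup id + 1, fun j hj => ?_⟩
      by_contra h
      have := Finset.le_sup (f := id) (Finsupp.mem_support_iff.2 h)
      simp at this
      omega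
    rw [hz2 n i, hn _ (by omega), smul_zero]
    rfl
  simpa using this

theorem syzEv_surj : Function.Surjective (syzEv S M) := fun m => ⟨1 ⊗ₜ m, by simp⟩

end syz

/-- global dimension at most n -/
def GD (S : Type) [CommRing S] (n : ℕ) : Prop :=
  ∀ (M : Type) [AddCommGroup M] [Module S M], PD S M n

theorem GD.polynomial {S : Type} [CommRing S] {n : ℕ} (h : GD S n) : GD S[X] (n+1) := by
  intro M _ _
  letI : Module S M := Module.compHom M (Polynomial.C : S →+* S[X])
  haveI : IsScalarTower S S[X] M := ⟨fun a b m => by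
    change (a • b) • m = (Polynomial.C a) • b • m
    rw [smul_smul, Polynomial.smul_eq_C_mul]⟩
  exact PD.x3 syzTheta_inj syz_exact syzEv_surj (PD.baseChange (h M))
    ((PD.baseChange (h M)).mono (by omega))

theorem GD.of_equiv {S T : Type} [CommRing S] [CommRing T] (e : S ≃+* T) {n : ℕ} (h : GD S n) :
    GD T n := by
  intro M _ _
  letI : Module S M := Module.compHom M (e : S →+* T)
  exact PD.of_semiEquiv e (AddEquiv.refl M) (fun r m => rfl) (h M)

theorem GD_mvPolynomial (k : Type) [Field k] (d : ℕ) : GD (MvPolynomial (Fin d) k) d := by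
  induction d with
  | zero =>
    have h0 : GD k 0 := fun M _ _ => PD_of_projective 0
    exact h0.of_equiv (MvPolynomial.isEmptyAlgEquiv k (Fin 0)).toRingEquiv.symm
  | succ d ih =>
    exact ih.polynomial.of_equiv (MvPolynomial.finSuccEquiv k d).toRingEquiv.symm

end S19

namespace S19
open CategoryTheory.Limits

/-- resolution data -/
def ResData {R : Type} [CommRing R] (M : ModuleCat.{0} R) (n : ℕ) : Prop :=
  ∃ (C : ChainComplex (ModuleCat.{0} R) ℕ) (ε : C.X 0 ⟶ M) (w : C.d 1 0 ≫ ε = 0),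
    (∀ i, Projective (C.X i)) ∧ (∀ i, n < i → IsZero (C.X i)) ∧ Epi ε ∧
    (ShortComplex.mk _ _ w).Exact ∧ 
    ∀ i, (ShortComplex.mk _ _ (C.d_comp_d (i + 2) (i + 1) i)).Exact

theorem resData {R : Type} [CommRing R] (n : ℕ) : ∀ M : ModuleCat.{0} R,
    HasProjectiveDimensionLT M (n+1) → ResData M n := by
  induction n with
  | zero =>
    intro M hM
    have hM := projective_iff_hasProjectiveDimensionLT_one.2 hM
    let P := ProjectiveResolution.self M
    refine ⟨P.complex, P.π.f 0, P.complex_d_comp_π_f_zero, P.projective, ?_, ?_,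
      ?_, fun i => P.exact_succ i⟩
    · intro i hi
      exact HomologicalComplex.isZero_single_obj_X _ _ _ _ (by omega)
    · have : Epi (P.π.f 0) := inferInstance
      exact this
    · exact ShortComplex.exact_of_g_is_cokernel _ P.isColimitCokernelCofork
  | succ n ih =>
    intro M hM
    let S := M.projectiveShortComplex
    have hS := M.shortExact_projectiveShortComplex
    have hp : Projective S.X₂ := by dsimp [S]; infer_instance
    obtain ⟨C, ε, w, hC1, hC2, hε, hC3, hC4⟩ :=
      ih S.X₁ ((hS.hasProjectiveDimensionLT_X₃_iff n hp).1 hM)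
    have hSf : Mono S.f := hS.mono_f
    have hSg : Epi S.g := hS.epi_g
    have w1 : C.d 1 0 ≫ ε ≫ S.f = 0 := by rw [← Category.assoc, w, zero_comp]
    refine ⟨ChainComplex.augment C (ε ≫ S.f) w1, S.g, ?_, ?_, ?_, hSg, ?_, ?_⟩
    · have : (ε ≫ S.f) ≫ S.g = 0 := by rw [Category.assoc, S.zero, comp_zero]
      exact this
    · rintro (_ | i)
      · exact hp
      · exact hC1 i
    · rintro (_ | i) hi
      · omega
      · exact hC2 i (by omega)
    · have := hS.exact
      rw [ShortComplex.moduleCat_exact_iff] at this ⊢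
      intro x hx
      obtain ⟨y, hy⟩ := this x hx
      obtain ⟨z, hz⟩ := (ModuleCat.epi_iff_surjective ε).1 hε y
      refine ⟨z, ?_⟩
      change (ε ≫ S.f).hom z = x
      rw [← hy, ← hz]
      rfl
    · rintro (_ | i)
      · rw [ShortComplex.moduleCat_exact_iff] at hC3 ⊢
        intro x hx
        refine hC3 x ?_
        apply (ModuleCat.mono_iff_injective S.f).1 hSf
        rw [map_zero]
        exact hx
      · exact hC4 i

theorem PD.pdQuotLE {R : Type} [CommRing R] {J : Ideal R} {n : ℕ} (h : PD R (R ⧸ J) n) :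
    pdQuotLE J n := by
  obtain ⟨C, ε, w, hC1, hC2, hε, hC3, hC4⟩ := resData n _ h
  refine ⟨{ complex := C, projective := hC1, 
            π := (ChainComplex.toSingle₀Equiv _ _).symm ⟨ε, w⟩
            quasiIso := ⟨fun n => ?_⟩ }, hC2⟩
  cases n
  · rw [ChainComplex.quasiIsoAt₀_iff, ShortComplex.quasiIso_iff_of_zeros']
    · refine (ShortComplex.exact_and_epi_g_iff_of_iso ?_).2 ⟨hC3, hε⟩
      exact ShortComplex.isoMk (Iso.refl _) (Iso.refl _) (Iso.refl _)
        ((Category.id_comp _).trans (Category.comp_id _).symm)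
        ((Category.id_comp _).trans (Category.comp_id _).symm)
    · exact C.shape _ _ (by simp)
    · rfl
    · rfl
  · rw [quasiIsoAt_iff_exactAt']
    · rw [HomologicalComplex.exactAt_iff' _ (_ + 2) (_ + 1) _ (by simp only [ChainComplex.prev]; rfl) (by simp; rfl)]
      exact hC4 _
    · apply ChainComplex.exactAt_succ_single_obj

end S19

namespace S19

section quot
variable {R : Type} [CommRing R]

theorem PD.quot_eq {J J' : Ideal R} (h : J = J') {n : ℕ} (hp : PD R (R ⧸ J) n) :
    PD R (R ⧸ J') n := h ▸ hp

theorem exact_quot_mul (J : Ideal R) (a : R) :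
    Function.Exact (LinearMap.lsmul R (R ⧸ J) a)
      (Submodule.factor (le_sup_left : J ≤ J ⊔ Ideal.span {a})) := by
  intro x
  obtain ⟨x, rfl⟩ := Submodule.Quotient.mk_surjective _ x
  constructor
  · intro h
    have h : x ∈ J ⊔ Ideal.span {a} := by
      rw [← Submodule.Quotient.mk_eq_zero]; exact h
    rw [Submodule.mem_sup] at h
    obtain ⟨y, hy, z, hz, rfl⟩ := h
    obtain ⟨w, rfl⟩ := Ideal.mem_span_singleton'.1 hz
    refine ⟨Submodule.Quotient.mk w, ?_⟩
    change Submodule.Quotient.mk (a • w) = _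
    rw [Submodule.Quotient.eq, smul_eq_mul]
    have : a * w - (y + w * a) = - y := by ring
    rw [this]
    exact neg_mem hy
  · rintro ⟨y, hy⟩
    obtain ⟨y, rfl⟩ := Submodule.Quotient.mk_surjective _ y
    rw [← hy]
    change (Submodule.Quotient.mk (a • y) : R ⧸ (J ⊔ Ideal.span {a})) = 0
    rw [Submodule.Quotient.mk_eq_zero]
    exact Ideal.mem_sup_right (Ideal.mul_mem_right _ _ (Ideal.mem_span_singleton_self a))

theorem PD.quot_sup {J : Ideal R} {a : R} (h : ∀ z, a * z ∈ J → z ∈ J) {n : ℕ}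
    (hJ : PD R (R ⧸ J) n) : PD R (R ⧸ (J ⊔ Ideal.span {a})) (n+1) := by
  refine PD.x3 (f := LinearMap.lsmul R (R ⧸ J) a) (g := Submodule.factor le_sup_left)
    ?_ (exact_quot_mul J a) (Submodule.factor_surjective le_sup_left) hJ (hJ.mono (by omega))
  rw [injective_iff_map_eq_zero]
  intro x hx
  obtain ⟨x, rfl⟩ := Submodule.Quotient.mk_surjective _ x
  have h1 : (Submodule.Quotient.mk (a • x) : R ⧸ J) = 0 := hx
  rw [Submodule.Quotient.mk_eq_zero] at h1 ⊢
  exact h _ h1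

theorem PD.quot_bot (n : ℕ) : PD R (R ⧸ (⊥ : Ideal R)) n :=
  (PD_of_projective (R := R) (M₁ := R) n).of_equiv
    (Submodule.quotEquivOfEqBot (⊥ : Ideal R) rfl).symm

theorem PD.koszul [IsDomain R] [DecompositionMonoid R] {a b : R} (ha : a ≠ 0)
    (h : IsRelPrime a b) : PD R (R ⧸ Ideal.span {a, b}) 2 := by
  have h1 : PD R (R ⧸ (⊥ ⊔ Ideal.span {a} : Ideal R)) 1 := PD.quot_sup (fun z hz => by
    rw [Ideal.mem_bot] at *
    exact (mul_eq_zero.1 hz).resolve_left ha) (PD.quot_bot 0)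
  have h2 : PD R (R ⧸ (⊥ ⊔ Ideal.span {a} ⊔ Ideal.span {b} : Ideal R)) 2 := PD.quot_sup (fun z hz => by
    rw [bot_sup_eq, Ideal.mem_span_singleton] at *
    exact h.dvd_of_dvd_mul_left hz) h1
  exact h2.quot_eq (by rw [bot_sup_eq, Ideal.span_insert])

/-- elements of R/A killed by J -/
def Tors (J A : Ideal R) : Submodule R (R ⧸ A) where
  carrier := {c | ∀ j ∈ J, j • c = 0}
  add_mem' := fun ha hb j hj => by rw [smul_add, ha j hj, hb j hj, add_zero]
  zero_mem' := fun j _ => smul_zero j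
  smul_mem' := fun r c hc j hj => by rw [smul_comm, hc j hj, smul_zero]

theorem mem_Tors {J A : Ideal R} {c : R ⧸ A} : c ∈ Tors J A ↔ ∀ j ∈ J, j • c = 0 := Iff.rfl

theorem mk_mem_Tors {J A : Ideal R} {x : R} :
    (Submodule.Quotient.mk x : R ⧸ A) ∈ Tors J A ↔ ∀ j ∈ J, j * x ∈ A := by
  rw [mem_Tors]
  refine forall₂_congr fun j hj => ?_
  rw [← Submodule.Quotient.mk_smul, Submodule.Quotient.mk_eq_zero, smul_eq_mul]

theorem Tors_swap (J : Ideal R) (a b : R) :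
    Nonempty (Tors J (Ideal.span {a, b}) ≃ₗ[R] Tors J (Ideal.span {b, a})) := by
  rw [Set.pair_comm]; exact ⟨LinearEquiv.refl _ _⟩

/-- the correspondence -/
def exW (J : Ideal R) (f f2 g2 : R) : Submodule R (R × R) where
  carrier := {p | (f ∣ p.1 * g2 - p.2 * f2) ∧ ∀ j ∈ J, j * p.1 ∈ Ideal.span {f, f2}}
  add_mem' := fun {a b} ha hb => ⟨by
    have := dvd_add ha.1 hb.1
    convert this using 1
    simp; ring, fun j hj => by
      rw [Prod.fst_add, mul_add]; exact add_mem (ha.2 j hj) (hb.2 j hj)⟩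
  zero_mem' := by simp
  smul_mem' := fun r a ha => ⟨by
    have := ha.1.mul_left r
    convert this using 1
    simp; ring, fun j hj => by
      have := Ideal.mul_mem_left _ r (ha.2 j hj)
      convert this using 1
      simp; ring⟩

theorem mem_pair {a b x : R} : x ∈ Ideal.span {a, b} ↔ ∃ c, a ∣ x - c * b := by
  rw [Ideal.mem_span_pair]
  constructor
  · rintro ⟨u, v, rfl⟩; exact ⟨v, u, by ring⟩
  · rintro ⟨c, u, h⟩; exact ⟨u, c, by linear_combination -h⟩

variable [DecompositionMonoid R]

theorem ex_aux {f f2 g2 x y j : R} (h : IsRelPrime f f2) (hxy : f ∣ x * g2 - y * f2)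
    (hx : j * x ∈ Ideal.span {f, f2}) : j * y ∈ Ideal.span {f, g2} := by
  obtain ⟨c, hc⟩ := mem_pair.1 hx
  refine mem_pair.2 ⟨c, ?_⟩
  have : f ∣ f2 * (j * y - c * g2) := by
    have h1 := dvd_sub (hc.mul_right g2) (hxy.mul_left j)
    convert h1 using 1; ring
  exact h.dvd_of_dvd_mul_left this

theorem ex_symm {f f2 g2 x y : R} (hxy : f ∣ x * g2 - y * f2) : f ∣ y * f2 - x * g2 := by
  rw [dvd_sub_comm]; exact hxy

theorem Tors_exchange {J : Ideal R} {f f2 g2 : R} (h2 : IsRelPrime f f2) (h2' : IsRelPrime f g2)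
    (hf2 : f2 ∈ J) (hg2 : g2 ∈ J) :
    Nonempty (Tors J (Ideal.span {f, f2}) ≃ₗ[R] Tors J (Ideal.span {f, g2})) := by
  let π1 : exW J f f2 g2 →ₗ[R] Tors J (Ideal.span {f, f2}) :=
    ((Submodule.mkQ _ ∘ₗ LinearMap.fst R R R) ∘ₗ Submodule.subtype _).codRestrict _
      (fun w => mk_mem_Tors.2 w.2.2)
  let π2 : exW J f f2 g2 →ₗ[R] Tors J (Ideal.span {f, g2}) :=
    ((Submodule.mkQ _ ∘ₗ LinearMap.snd R R R) ∘ₗ Submodule.subtype _).codRestrict _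
      (fun w => mk_mem_Tors.2 fun j hj => ex_aux h2 w.2.1 (w.2.2 j hj))
  have s1 : Function.Surjective π1 := by
    rintro ⟨x, hx⟩
    obtain ⟨x, rfl⟩ := Submodule.Quotient.mk_surjective _ x
    rw [mk_mem_Tors] at hx
    obtain ⟨y, hy⟩ := mem_pair.1 (hx g2 hg2)
    exact ⟨⟨(x, y), by rwa [mul_comm] at hy, hx⟩, rfl⟩
  have s2 : Function.Surjective π2 := by
    rintro ⟨y, hy⟩
    obtain ⟨y, rfl⟩ := Submodule.Quotient.mk_surjective _ y
    rw [mk_mem_Tors] at hy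
    obtain ⟨x, hx⟩ := mem_pair.1 (hy f2 hf2)
    rw [mul_comm f2] at hx
    exact ⟨⟨(x, y), ex_symm hx, fun j hj => ex_aux h2' hx (hy j hj)⟩, rfl⟩
  have hk : LinearMap.ker π1 = LinearMap.ker π2 := by
    ext w
    rw [LinearMap.mem_ker, LinearMap.mem_ker, Subtype.ext_iff, Subtype.ext_iff]
    change (Submodule.Quotient.mk w.1.1 : R ⧸ Ideal.span {f, f2}) = 0 ↔
      (Submodule.Quotient.mk w.1.2 : R ⧸ Ideal.span {f, g2}) = 0
    rw [Submodule.Quotient.mk_eq_zero, Submodule.Quotient.mk_eq_zero, ← one_mul w.1.1,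
      ← one_mul w.1.2]
    exact ⟨ex_aux h2 w.2.1, ex_aux h2' (ex_symm w.2.1)⟩
  exact ⟨(π1.quotKerEquivOfSurjective s1).symm.trans
    ((Submodule.quotEquivOfEq _ _ hk).trans (π2.quotKerEquivOfSurjective s2))⟩

theorem Tors_exchange2 {J : Ideal R} {f1 f2 g1 g2 s : R} (h1 : IsRelPrime f1 f2)
    (h2 : IsRelPrime g1 g2) (h3 : IsRelPrime s f1) (h4 : IsRelPrime s g1)
    (hf1 : f1 ∈ J) (hf2 : f2 ∈ J) (hg1 : g1 ∈ J) (hg2 : g2 ∈ J) (hs : s ∈ J) :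
    Nonempty (Tors J (Ideal.span {f1, f2}) ≃ₗ[R] Tors J (Ideal.span {g1, g2})) := by
  obtain ⟨e1⟩ := Tors_exchange h1 h3.symm hf2 hs
  obtain ⟨e2⟩ := Tors_swap J f1 s
  obtain ⟨e3⟩ := Tors_exchange h3 h4 hf1 hg1
  obtain ⟨e4⟩ := Tors_swap J s g1
  obtain ⟨e5⟩ := Tors_exchange h4.symm h2 hs hg2
  exact ⟨e1.trans (e2.trans (e3.trans (e4.trans e5)))⟩

end quot

end S19

namespace S19
open Polynomial Ideal

section
variable {S : Type} [CommRing S]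

theorem comap_map_C (p : Ideal S) : (p.map (Polynomial.C : S →+* S[X])).comap Polynomial.C = p := by
  ext x
  rw [Ideal.mem_comap, Ideal.mem_map_C_iff]
  constructor
  · intro h; simpa using h 0
  · intro h n; rw [Polynomial.coeff_C]; split_ifs <;> simp [h]

theorem height_mapC [IsNoetherianRing S] (p : Ideal S) [hp : p.IsPrime] :
    (p.map (Polynomial.C : S →+* S[X])).height = p.height := by
  have h1 : (p.map (Polynomial.C : S →+* S[X])).IsPrime := isPrime_map_C_of_isPrime
  have : (p.map (Polynomial.C : S →+* S[X])).LiesOver p := ⟨(comap_map_C p).symm⟩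
  simp [height_eq_height_add_of_liesOver_of_hasGoingDown p]

attribute [local instance] Polynomial.algebra Polynomial.isLocalization in
theorem height_le_comap [IsNoetherianRing S] (P : Ideal S[X]) [hP : P.IsPrime] :
    P.height ≤ (P.comap (Polynomial.C : S →+* S[X])).height + 1 := by
  set p := P.comap (Polynomial.C : S →+* S[X]) with hp
  have : P.LiesOver p := ⟨rfl⟩
  have : p.IsPrime := by rw [P.over_def p]; infer_instance
  let Rₚ := Localization.AtPrime p
  set p' : Ideal Rₚ := p.map (algebraMap S Rₚ) with p'_def
  have : p'.IsMaximal := by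
    rw [p'_def, Localization.AtPrime.map_eq_maximalIdeal]
    exact IsLocalRing.maximalIdeal.isMaximal Rₚ
  let P' : Ideal Rₚ[X] := P.map (algebraMap S[X] Rₚ[X])
  have disj : Disjoint (p.primeCompl.map Polynomial.C : Set S[X]) P := by
    refine Set.disjoint_left.mpr fun a ⟨b, hb⟩ ha ↦ hb.1 ?_
    rwa [SetLike.mem_coe, LiesOver.over (P := P) (p := p), Ideal.mem_comap, Polynomial.algebraMap_eq, hb.2]
  have hP' : P'.IsPrime := IsLocalization.isPrime_of_isPrime_disjoint (p.primeCompl.map Polynomial.C) _ _ hP disj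
  have : P'.LiesOver p'  := IsLocalization.liesOver_of_isPrime_of_disjoint p.primeCompl _ _ disj
  have eq1 : p.height = p'.height := by
    rw [IsLocalization.height_map_of_disjoint p.primeCompl]
    exact Disjoint.symm <| Set.disjoint_left.mpr fun _ a b ↦ b a
  have eq2 : P.height = P'.height := by
    rw [IsLocalization.height_map_of_disjoint (Submonoid.map Polynomial.C <| p.primeCompl) _ disj]
  obtain ⟨M, hM, hle⟩ := exists_le_maximal P' hP'.ne_top
  have : M.LiesOver p' := ⟨by
    refine IsMaximal.eq_of_le inferInstance IsPrime.ne_top' ?_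
    rw [P'.over_def p']
    exact comap_mono hle⟩
  rw [eq1, eq2, ← Polynomial.height_eq_height_add_one p' M]
  exact height_mono hle

theorem exists_assoc [IsNoetherianRing S] (A : Ideal S) (x : S) (hx : x ∉ A) :
    ∃ (q : Ideal S) (y : S), q.IsPrime ∧ y ∉ A ∧ (∀ a ∈ q, a * y ∈ A) ∧ (∀ a, a * x ∈ A → a ∈ q) ∧
      A ≤ q := by
  have hx' : (Submodule.Quotient.mk x : S ⧸ A) ≠ 0 := by
    rwa [Ne, Submodule.Quotient.mk_eq_zero]
  obtain ⟨q, hq, hle⟩ := exists_le_isAssociatedPrime_of_isNoetherianRing S _ hx'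
  rw [isAssociatedPrime_iff] at hq
  obtain ⟨hq1, y, hy⟩ := hq
  obtain ⟨y, rfl⟩ := Submodule.Quotient.mk_surjective _ y
  have key : ∀ (a z : S), a ∈ (⊥ : Submodule S (S ⧸ A)).colon {(Submodule.Quotient.mk z : S ⧸ A)} ↔ a * z ∈ A := by
    intro a z
    rw [Submodule.mem_colon_singleton, ← Submodule.Quotient.mk_smul, Submodule.mem_bot,
      Submodule.Quotient.mk_eq_zero, smul_eq_mul]
  have key2 : ∀ a, a ∈ q ↔ a * y ∈ A := fun a => by rw [hy, key]
  refine ⟨q, y, hq1, fun h => ?_, fun a ha => (key2 a).1 ha, fun a ha => hle ((key a x).2 ha),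
    fun a ha => (key2 a).2 (A.mul_mem_right _ ha)⟩
  exact hq1.ne_top ((eq_top_iff_one _).2 ((key2 1).2 (by simpa using h)))

/-- unmixedness for codimension two complete intersections -/
def Unm (S : Type) [CommRing S] : Prop :=
  ∀ (P : Ideal S), P.IsPrime → ∀ f1 f2 z : S, IsRelPrime f1 f2 → f1 ∈ P → f2 ∈ P →
    z ∉ span {f1, f2} → (∀ a ∈ P, a * z ∈ span {f1, f2}) → P.height ≤ 2

theorem maxex (w : S[X]) (A : Ideal S) (hw : w ∉ A.map (Polynomial.C : S →+* S[X])) :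
        ∃ n, w.coeff n ∉ A ∧ ∀ m, n < m → w.coeff m ∈ A := by
      classical
      have hne : (w.support.filter (fun n => w.coeff n ∉ A)).Nonempty := by
        by_contra h
        rw [Finset.not_nonempty_iff_eq_empty, Finset.filter_eq_empty_iff] at h
        apply hw
        rw [Ideal.mem_map_C_iff]
        intro n
        by_cases hn : n ∈ w.support
        · simpa using h hn
        · rw [Polynomial.notMem_support_iff.1 hn]; exact zero_mem _
      refine ⟨_, (Finset.mem_filter.1 (Finset.max'_mem _ hne)).2, fun m hm => ?_⟩
      by_contra h
      have : m ∈ w.support.filter (fun n => w.coeff n ∉ A) := by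
        rw [Finset.mem_filter]
        refine ⟨Polynomial.mem_support_iff.2 fun h0 => h (h0 ▸ zero_mem _), h⟩
      exact absurd (Finset.le_max' _ _ this) (not_le.2 hm)

theorem Unm.of_equiv {T : Type} [CommRing T] (e : S ≃+* T) (h : Unm S) : Unm T := by
  intro P hP f1 f2 z hrel hf1 hf2 hz hzP
  have hsp : ∀ x, e x ∈ span {f1, f2} ↔ x ∈ span {e.symm f1, e.symm f2} := by
    intro x
    rw [mem_pair, mem_pair]
    constructor
    · rintro ⟨c, d, hd⟩
      refine ⟨e.symm c, e.symm d, ?_⟩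
      rw [← map_mul, ← map_mul, ← hd, map_sub, RingEquiv.symm_apply_apply]
    · rintro ⟨c, d, hd⟩
      refine ⟨e c, e d, ?_⟩
      have := congrArg e hd
      simpa using this
  have h1 : (P.comap e).IsPrime := Ideal.comap_isPrime e P
  have := h (P.comap e) h1 (e.symm f1) (e.symm f2) (e.symm z) ?_ ?_ ?_ ?_ ?_
  · rwa [RingEquiv.height_comap] at this
  · intro d hd1 hd2
    have := hrel (d := e d) (by simpa using map_dvd e hd1) (by simpa using map_dvd e hd2)
    simpa using this
  · rw [Ideal.mem_comap]; simpa using hf1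
  · rw [Ideal.mem_comap]; simpa using hf2
  · rw [← hsp]; simpa using hz
  · intro a ha
    rw [← hsp]
    have := hzP (e a) ha
    simpa using this

variable [IsDomain S] [UniqueFactorizationMonoid S] [IsNoetherianRing S]

theorem avoid_poly (p : Ideal S) [p.IsPrime] (hp : 2 ≤ p.height) (g : S[X]) (hg : g ≠ 0) :
    ∃ t ∈ p, IsRelPrime g (Polynomial.C t) := by
  classical
  by_contra! hcon
  have hsub : (p : Set S) ⊆ ⋃ i ∈ (↑(UniqueFactorizationMonoid.factors g).toFinset : Set S[X]),
      ((span {i}).comap (Polynomial.C : S →+* S[X]) : Set S) := by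
    intro t ht
    have h1 := hcon t ht
    rw [UniqueFactorizationMonoid.isRelPrime_iff_no_prime_factors hg] at h1
    push Not at h1
    obtain ⟨d, hd1, hd2, hd3⟩ := h1
    obtain ⟨i, hi, hdi⟩ := UniqueFactorizationMonoid.exists_mem_factors_of_dvd hg hd3.irreducible hd1
    refine Set.mem_biUnion (x := i) (by simpa using hi) ?_
    change Polynomial.C t ∈ span {i}
    rw [mem_span_singleton]
    exact hdi.symm.dvd.trans hd2
  rw [subset_union_prime 0 0] at hsub
  · obtain ⟨i, hi, hle⟩ := hsub
    have h1 : p.map (Polynomial.C : S →+* S[X]) ≤ span {i} := map_le_iff_le_comap.2 hle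
    have hi' : Prime i := UniqueFactorizationMonoid.prime_of_factor i (by simpa using hi)
    have h2 : (span {i}).height ≤ 1 := height_span_singleton_le_one hi'.not_isUnit
    have h3 := (height_mapC p).symm.le.trans ((height_mono h1).trans h2)
    have := hp.trans h3
    norm_num at this
  · intro i hi _ _
    have hi' : Prime i := UniqueFactorizationMonoid.prime_of_factor i (by simpa using hi)
    have : (span {i}).IsPrime := (span_singleton_prime hi'.ne_zero).2 hi'
    infer_instance


theorem Unm.polynomial (hS : Unm S) : Unm S[X] := by
  classical
  intro P hP f1 f2 z hrel hf1 hf2 hz hzP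
  by_contra! hcon
  set p := P.comap (Polynomial.C : S →+* S[X]) with hp
  have hpp : p.IsPrime := inferInstance
  have h3 : 3 ≤ P.height := by
    have := Order.add_one_le_of_lt hcon
    norm_num at this
    exact this
  have h2p : 2 ≤ p.height := by
    have := h3.trans (height_le_comap P)
    rw [← hp] at this
    have h4 : (2 + 1 : ℕ∞) ≤ p.height + 1 := by norm_num; exact this
    exact (ENat.add_le_add_iff_right ENat.one_ne_top).1 h4
  have hf10 : f1 ≠ 0 := by
    rintro rfl
    exact hP.ne_top (eq_top_of_isUnit_mem _ hf2 (isRelPrime_zero_left.1 hrel))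
  obtain ⟨s, hs, hs1⟩ := avoid_poly p h2p f1 hf10
  have hsP : Polynomial.C s ∈ P := hs
  have hs0 : (Polynomial.C s : S[X]) ≠ 0 := by
    intro h
    rw [h] at hs1
    exact hP.ne_top (eq_top_of_isUnit_mem _ hf1 (isRelPrime_zero_right.1 hs1))
  obtain ⟨t, ht, ht1⟩ := avoid_poly p h2p _ hs0
  have htP : Polynomial.C t ∈ P := ht
  obtain ⟨e⟩ := Tors_exchange2 (J := P) hrel ht1.symm hs1.symm ht1 hf1 hf2 htP hsP hsP
  have hzT : (Submodule.Quotient.mk z : S[X] ⧸ span {f1, f2}) ∈ Tors P (span {f1, f2}) :=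
    mk_mem_Tors.2 hzP
  obtain ⟨z', hz'⟩ := Submodule.Quotient.mk_surjective _ (e ⟨_, hzT⟩).1
  have hz1 : ∀ a ∈ P, a * z' ∈ span {Polynomial.C t, Polynomial.C s} := by
    apply mk_mem_Tors.1
    rw [hz']
    exact (e ⟨_, hzT⟩).2
  have hz2 : z' ∉ span {Polynomial.C t, Polynomial.C s} := by
    intro h
    rw [← Submodule.Quotient.mk_eq_zero, hz'] at h
    have h5 : e ⟨_, hzT⟩ = 0 := Subtype.ext h
    rw [LinearEquiv.map_eq_zero_iff] at h5
    have h6 := congrArg Subtype.val h5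
    exact hz ((Submodule.Quotient.mk_eq_zero _).1 h6)
  have hspan : span {Polynomial.C t, Polynomial.C s} = (span {t, s}).map (Polynomial.C : S →+* S[X]) := by
    rw [map_span, Set.image_pair]
  rw [hspan] at hz1 hz2
  have hts : IsRelPrime t s := by
    intro d hd1 hd2
    exact Polynomial.isUnit_C.1 (ht1 (map_dvd Polynomial.C hd2) (map_dvd Polynomial.C hd1))
  have hpc : ∀ a ∈ p, ∀ n, a * z'.coeff n ∈ span {t, s} := by
    intro a ha n
    have := (Ideal.mem_map_C_iff.1 (hz1 _ ha)) n
    rwa [Polynomial.coeff_C_mul] at this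
  by_cases hPp : P ≤ p.map (Polynomial.C : S →+* S[X])
  · obtain ⟨n, hn⟩ : ∃ n, z'.coeff n ∉ span {t, s} := by
      by_contra! h
      exact hz2 (Ideal.mem_map_C_iff.2 h)
    have h7 := hS p hpp t s _ hts ht hs hn (fun a ha => hpc a ha n)
    have := (h3.trans (height_mono hPp)).trans ((height_mapC p).le.trans h7)
    norm_num at this
  · obtain ⟨h, hhP, hhp⟩ := Set.not_subset.1 hPp
    obtain ⟨m, hm1, hm2⟩ := maxex h p hhp
    obtain ⟨n, hn1, hn2⟩ := maxex z' (span {t, s}) hz2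
    have hmn : h.coeff m * z'.coeff n ∈ span {t, s} := by
      have h8 := (Ideal.mem_map_C_iff.1 (hz1 _ hhP)) (m + n)
      rw [Polynomial.coeff_mul, ← Finset.add_sum_erase _ _
        (Finset.HasAntidiagonal.mem_antidiagonal.2 (rfl : (m, n).1 + (m,n).2 = m + n))] at h8
      refine (Submodule.add_mem_iff_left _ (Submodule.sum_mem _ ?_)).1 h8
      rintro ⟨i, j⟩ hij
      rw [Finset.mem_erase, Finset.HasAntidiagonal.mem_antidiagonal] at hij
      obtain ⟨hne, hsum⟩ := hij
      simp only at hsum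
      rcases lt_trichotomy i m with hlt | rfl | hgt
      · exact mul_mem_left _ _ (hn2 j (by omega))
      · exact absurd (by simp; omega) hne
      · exact hpc _ (hm2 i hgt) j
    obtain ⟨q, y, hq, hy, hqy, hqx, hle⟩ := exists_assoc (span {t, s}) _ hn1
    have h9 := hS q hq t s y hts (hle (subset_span (by simp))) (hle (subset_span (by simp))) hy hqy
    have hlt : p < q := by
      refine lt_of_le_of_ne (fun a ha => hqx a (hpc a ha n)) ?_
      rintro rfl
      exact hm1 (hqx _ hmn)
    have h10 := (add_le_add_left h2p 1).trans ((height_add_one_le_of_lt_of_isPrime hlt).trans h9)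
    norm_num at h10

end

theorem Unm_mvPolynomial (k : Type) [Field k] (d : ℕ) : Unm (MvPolynomial (Fin d) k) := by
  induction d with
  | zero =>
    have h0 : Unm k := by
      intro P hP f1 f2 z _ _ _ _ _
      have : P = ⊥ := (eq_bot_or_top P).resolve_right hP.ne_top
      rw [this]; simp
    exact h0.of_equiv (MvPolynomial.isEmptyAlgEquiv k (Fin 0)).toRingEquiv.symm
  | succ d ih =>
    exact ih.polynomial.of_equiv (MvPolynomial.finSuccEquiv k d).toRingEquiv.symm

end S19

namespace S19

section
variable {R : Type} [CommRing R]

/-- order iso -/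
def specIso (R : Type) [CommRing R] : {q : Ideal R // q.IsPrime} ≃o PrimeSpectrum R where
  toFun p := ⟨p.1, p.2⟩
  invFun p := ⟨p.1, p.2⟩
  left_inv _ := rfl
  right_inv _ := rfl
  map_rel_iff' := Iff.rfl

theorem height_sub (p : {q : Ideal R // q.IsPrime}) : Order.height p = p.1.height := by
  rw [← Order.height_orderIso (specIso R) p]
  exact (PrimeSpectrum.height_eq_orderHeight (specIso R p)).symm

theorem idealHeight_eq (J : Ideal R) : idealHeight J = J.height := by
  unfold idealHeight
  apply le_antisymm
  · rw [Ideal.height_eq_inf_minimalPrimes]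
    refine le_iInf₂ fun p hp => ?_
    refine (iInf₂_le ⟨p, hp.isPrime⟩ hp.le).trans ?_
    rw [height_sub]
  · refine le_iInf₂ fun p hp => ?_
    rw [height_sub]
    exact Ideal.height_mono hp

theorem relPrime_of_height [IsNoetherianRing R] {f1 f2 : R}
    (h : idealHeight (Ideal.span {f1, f2}) = 2) : IsRelPrime f1 f2 := by
  intro d hd1 hd2
  by_contra hd
  have h1 : Ideal.span {f1, f2} ≤ Ideal.span {d} := by
    rw [Ideal.span_le]
    rintro x (rfl | rfl)
    · exact Ideal.mem_span_singleton.2 hd1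
    · exact Ideal.mem_span_singleton.2 hd2
  have h2 := (Ideal.height_mono h1).trans (Ideal.height_span_singleton_le_one hd)
  rw [← idealHeight_eq, h] at h2
  norm_num at h2

theorem mem_primaryComponent {J p : Ideal R} (hp : p.IsPrime) {y : R}
    (hy : y ∈ primaryComponent J p) : ∃ s, s ∉ p ∧ s * y ∈ J := by
  let Q : Ideal R :=
    { carrier := {y | ∃ s, s ∉ p ∧ s * y ∈ J}
      add_mem' := by
        rintro a b ⟨s, hs, hs2⟩ ⟨t, ht, ht2⟩
        refine ⟨s * t, fun h => (hp.mem_or_mem h).elim hs ht, ?_⟩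
        have := add_mem (J.mul_mem_left t hs2) (J.mul_mem_left s ht2)
        convert this using 1; ring
      zero_mem' := ⟨1, fun h => hp.ne_top ((Ideal.eq_top_iff_one _).2 h), by simp⟩
      smul_mem' := by
        rintro r a ⟨s, hs, hs2⟩
        refine ⟨s, hs, ?_⟩
        have := J.mul_mem_left r hs2
        convert this using 1; simp; ring }
  have : primaryComponent J p ≤ Q := by
    refine iSup₂_le fun s hs => ?_
    intro y hy
    refine ⟨s, hs, ?_⟩
    have := Submodule.mem_colon.1 hy s (Ideal.mem_span_singleton_self s)
    rwa [smul_eq_mul, mul_comm] at this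
  exact this hy

theorem le_primaryComponent {J p : Ideal R} (hp : p.IsPrime) : J ≤ primaryComponent J p := by
  have h1 : (1 : R) ∉ p := fun h => hp.ne_top ((Ideal.eq_top_iff_one _).2 h)
  refine le_trans ?_ (le_iSup₂ (f := fun (s : R) (_ : s ∉ p) => Submodule.colon J (Ideal.span {s}))
    1 h1)
  intro x hx
  rw [Submodule.mem_colon]
  intro y _
  exact J.mul_mem_right _ hx

theorem le_unmixedPart (J : Ideal R) : J ≤ unmixedPart J :=
  le_iInf₂ fun _ hp => le_primaryComponent hp.1

theorem mem_colon_span {A : Ideal R} {f x : R} :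
    x ∈ Submodule.colon A (Ideal.span {f} : Ideal R) ↔ x * f ∈ A := by
  rw [Submodule.mem_colon]
  constructor
  · intro h; exact h f (Ideal.mem_span_singleton_self f)
  · intro h y hy
    obtain ⟨c, rfl⟩ := Ideal.mem_span_singleton'.1 hy
    have := A.mul_mem_left c h
    rw [smul_eq_mul]
    convert this using 1; ring

theorem ker_unmixed [IsNoetherianRing R] (hU : Unm R) {f1 f2 f3 : R} (hrel : IsRelPrime f1 f2)
    (hht : idealHeight (Ideal.span {f1, f2, f3}) = 2) (x : R) :
    x * f3 ∈ Ideal.span {f1, f2} ↔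
      ∀ y ∈ unmixedPart (Ideal.span {f1, f2, f3}), y * x ∈ Ideal.span {f1, f2} := by
  constructor
  · intro hx y hy
    by_contra hcon
    obtain ⟨P, w, hP, hw, hPw, hP2, hle⟩ := exists_assoc (Ideal.span {f1, f2}) _ hcon
    have h1 : f1 ∈ P := hle (Ideal.subset_span (by simp))
    have h2 : f2 ∈ P := hle (Ideal.subset_span (by simp))
    have h3 : f3 ∈ P := hP2 _ (by
      have := Ideal.mul_mem_left _ y hx
      convert this using 1; ring)
    have hIP : Ideal.span {f1, f2, f3} ≤ P := by
      rw [Ideal.span_le]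
      rintro z (rfl | rfl | rfl) <;> assumption
    have hh := hU P hP f1 f2 w hrel h1 h2 hw hPw
    have hh2 : idealHeight P = idealHeight (Ideal.span {f1, f2, f3}) := by
      apply le_antisymm
      · rw [hht, idealHeight_eq]; exact hh
      · rw [idealHeight_eq, idealHeight_eq]; exact Ideal.height_mono hIP
    have hy2 : y ∈ primaryComponent (Ideal.span {f1, f2, f3}) P := by
      have h5 : unmixedPart (Ideal.span {f1, f2, f3}) ≤ _ := iInf₂_le P ⟨hP, hIP, hh2⟩
      exact h5 hy
    obtain ⟨s, hs, hsy⟩ := mem_primaryComponent hP hy2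
    apply hs
    apply hP2
    rw [← mul_assoc]
    have h6 : Ideal.span {f1, f2, f3} ≤ (Ideal.span {f1, f2} : Ideal R).colon (Ideal.span {x} : Ideal R) := by
      rw [Ideal.span_le]
      rintro z (rfl | rfl | rfl)
      · exact mem_colon_span.2 (Ideal.mul_mem_right _ _ (Ideal.subset_span (by simp)))
      · exact mem_colon_span.2 (Ideal.mul_mem_right _ _ (Ideal.subset_span (by simp)))
      · exact mem_colon_span.2 (by rwa [mul_comm])
    exact mem_colon_span.1 (h6 hsy)
  · intro h
    rw [mul_comm]
    exact h f3 (le_unmixedPart _ (Ideal.subset_span (by simp)))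

end
end S19

namespace S19

section
variable {k : Type} [Field k] {N : ℕ}

/-- linear form attached to a vector -/
def lin : (Fin N → k) →ₗ[k] MvPolynomial (Fin N) k :=
  Fintype.linearCombination k (fun i : Fin N => (X i : MvPolynomial (Fin N) k))

theorem lin_apply (v : Fin N → k) : lin v = ∑ i, v i • (X i : MvPolynomial (Fin N) k) := by
  simp [lin, Fintype.linearCombination_apply]

theorem lin_single (i : Fin N) : lin (Pi.single i (1 : k)) = X i := by
  simp [lin]

theorem lin_hom (v : Fin N → k) : (lin v).IsHomogeneous 1 := by
  rw [lin_apply]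
  refine IsHomogeneous.sum _ _ _ fun i _ => ?_
  rw [smul_eq_C_mul]
  have := (isHomogeneous_C (Fin N) (v i)).mul (isHomogeneous_X k i)
  simpa using this

theorem coeff_lin (v : Fin N → k) (i : Fin N) : coeff (Finsupp.single i 1) (lin v) = v i := by
  rw [lin_apply, coeff_sum]
  rw [Finset.sum_eq_single i]
  · simp
  · intro j _ hj
    rw [coeff_smul, coeff_X, if_neg]
    · simp
    · intro h
      exact hj (Finsupp.single_left_injective one_ne_zero h)
  · simp

theorem lin_inj {v w : Fin N → k} (h : lin v = lin w) : v = w := by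
  ext i
  rw [← coeff_lin v i, h, coeff_lin]

theorem lin_eq_zero {v : Fin N → k} : lin v = 0 ↔ v = 0 :=
  ⟨fun h => lin_inj (h.trans (map_zero lin).symm), fun h => by rw [h, map_zero]⟩

theorem exists_lin {f : MvPolynomial (Fin N) k} (hf : f.IsHomogeneous 1) : ∃ v, f = lin v := by
  refine ⟨fun i => coeff (Finsupp.single i 1) f, ?_⟩
  ext m
  by_cases hm : m.degree = 1
  · have h0 : m ≠ 0 := by rintro rfl; simp at hm
    obtain ⟨i, hi⟩ := Finsupp.ne_iff.1 h0
    have hle : Finsupp.single i 1 ≤ m := by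
      rw [Finsupp.single_le_iff]
      simp at hi; omega
    obtain ⟨r, hr⟩ := exists_add_of_le hle
    have hr0 : r = 0 := by
      rw [hr, map_add, Finsupp.degree_single] at hm
      exact (Finsupp.degree_eq_zero_iff r).1 (by omega)
    rw [hr0, add_zero] at hr
    rw [hr]
    rw [coeff_lin]
  · rw [hf.coeff_eq_zero hm, (lin_hom _).coeff_eq_zero hm]

/-- extension of a linear map to the polynomial ring -/
def ext {A : Type} [CommRing A] [Algebra k A] (φ : (Fin N → k) →ₗ[k] A) :
    MvPolynomial (Fin N) k →ₐ[k] A :=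
  aeval (fun i => φ (Pi.single i 1))

theorem ext_lin {A : Type} [CommRing A] [Algebra k A] (φ : (Fin N → k) →ₗ[k] A) (v) :
    ext φ (lin v) = φ v := by
  have : (ext φ).toLinearMap ∘ₗ lin = φ := by
    apply LinearMap.pi_ext'
    intro i
    ext
    simp [lin_single, ext]
  exact LinearMap.congr_fun this v

theorem algHom_ext_lin {A : Type} [CommRing A] [Algebra k A]
    {φ ψ : MvPolynomial (Fin N) k →ₐ[k] A} (h : ∀ v, φ (lin v) = ψ (lin v)) : φ = ψ := by
  apply MvPolynomial.algHom_ext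
  intro i
  rw [← lin_single]; exact h _

/-- substitution -/
def sub (T : (Fin N → k) →ₗ[k] (Fin N → k)) :
    MvPolynomial (Fin N) k →ₐ[k] MvPolynomial (Fin N) k := ext (lin ∘ₗ T)

theorem sub_lin (T : (Fin N → k) →ₗ[k] (Fin N → k)) (v) : sub T (lin v) = lin (T v) := by
  simp [sub, ext_lin]

theorem sub_hom (T : (Fin N → k) →ₗ[k] (Fin N → k)) {f : MvPolynomial (Fin N) k} {n : ℕ}
    (hf : f.IsHomogeneous n) : (sub T f).IsHomogeneous n := by
  have := hf.aeval (fun i => lin (T (Pi.single i 1))) (n := 1) (fun i => lin_hom _)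
  simpa [sub, ext] using this

/-- linear ideal -/
def PV (V : Submodule k (Fin N → k)) : Ideal (MvPolynomial (Fin N) k) := Ideal.span (lin '' V)

theorem lin_mem {V : Submodule k (Fin N → k)} {v} (h : v ∈ V) : lin v ∈ PV V :=
  Ideal.subset_span ⟨v, h, rfl⟩

theorem PV_mono {V W : Submodule k (Fin N → k)} (h : V ≤ W) : PV V ≤ PV W :=
  Ideal.span_mono (Set.image_mono h)

theorem exScale {V H : Submodule k (Fin N → k)} (h : IsCompl V H) (ν : k) :
    ∃ T : (Fin N → k) →ₗ[k] (Fin N → k), (∀ v ∈ V, T v = ν • v) ∧ (∀ v ∈ H, T v = v) := by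
  refine ⟨LinearMap.ofIsCompl h (ν • V.subtype) H.subtype, fun v hv => ?_, fun v hv => ?_⟩
  · exact LinearMap.ofIsCompl_apply_left h ⟨v, hv⟩
  · exact LinearMap.ofIsCompl_apply_right h ⟨v, hv⟩

theorem sub_sub_mem {V : Submodule k (Fin N → k)} {T : (Fin N → k) →ₗ[k] (Fin N → k)}
    (hT : ∀ v, v - T v ∈ V) (f) : f - sub T f ∈ PV V := by
  rw [← Ideal.Quotient.mk_eq_mk_iff_sub_mem]
  have : (Ideal.Quotient.mkₐ k (PV V)) = (Ideal.Quotient.mkₐ k (PV V)).comp (sub T) := by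
    apply algHom_ext_lin
    intro v
    rw [AlgHom.comp_apply, sub_lin]
    simp only [Ideal.Quotient.mkₐ_eq_mk]
    rw [Ideal.Quotient.mk_eq_mk_iff_sub_mem, ← map_sub]
    exact lin_mem (hT v)
  exact DFunLike.congr_fun this f

theorem subT_mem {V W : Submodule k (Fin N → k)} {T : (Fin N → k) →ₗ[k] (Fin N → k)}
    (hT : ∀ v ∈ V, T v ∈ W) {f} (hf : f ∈ PV V) : sub T f ∈ PV W := by
  have : PV V ≤ (PV W).comap (sub T) := by
    rw [PV, Ideal.span_le]
    rintro _ ⟨v, hv, rfl⟩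
    change sub T (lin v) ∈ PV W
    rw [sub_lin]; exact lin_mem (hT v hv)
  exact this hf

theorem PV_bot : PV (⊥ : Submodule k (Fin N → k)) = ⊥ := by
  rw [PV, Ideal.span_eq_bot]
  rintro _ ⟨v, hv, rfl⟩
  rw [(Submodule.mem_bot k).1 hv, map_zero]

theorem exProj (V : Submodule k (Fin N → k)) :
    ∃ T : (Fin N → k) →ₗ[k] (Fin N → k), (∀ v ∈ V, T v = 0) ∧ (∀ v, v - T v ∈ V) := by
  obtain ⟨H, h⟩ := V.exists_isCompl
  obtain ⟨T, h1, h2⟩ := exScale h 0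
  refine ⟨T, fun v hv => by simp [h1 v hv], fun v => ?_⟩
  have : v ∈ V ⊔ H := by rw [h.sup_eq_top]; trivial
  obtain ⟨a, ha, b, hb, rfl⟩ := Submodule.mem_sup.1 this
  rw [map_add, h1 a ha, h2 b hb]; simpa using ha

theorem mem_PV_iff {V : Submodule k (Fin N → k)} {T : (Fin N → k) →ₗ[k] (Fin N → k)}
    (h1 : ∀ v ∈ V, T v = 0) (h2 : ∀ v, v - T v ∈ V) {f} : f ∈ PV V ↔ sub T f = 0 := by
  constructor
  · intro h
    have := subT_mem (W := ⊥) (T := T) (fun v hv => by rw [h1 v hv]; exact zero_mem _) h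
    rwa [PV_bot] at this
  · intro h
    have := sub_sub_mem h2 f
    rwa [h, sub_zero] at this

theorem PV_prime (V : Submodule k (Fin N → k)) : (PV V).IsPrime := by
  obtain ⟨T, h1, h2⟩ := exProj V
  have : PV V = RingHom.ker (sub T) := by
    ext f; rw [mem_PV_iff h1 h2, RingHom.mem_ker]
  rw [this]
  exact RingHom.ker_isPrime _

theorem lin_mem_PV {V : Submodule k (Fin N → k)} {v} : lin v ∈ PV V ↔ v ∈ V := by
  refine ⟨fun h => ?_, lin_mem⟩
  obtain ⟨T, h1, h2⟩ := exProj V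
  rw [mem_PV_iff h1 h2, sub_lin, lin_eq_zero] at h
  simpa [h] using h2 v

theorem PV_le {V W : Submodule k (Fin N → k)} : PV V ≤ PV W ↔ V ≤ W :=
  ⟨fun h _ hv => lin_mem_PV.1 (h (lin_mem hv)), PV_mono⟩

theorem PV_inj {V W : Submodule k (Fin N → k)} (h : PV V = PV W) : V = W :=
  le_antisymm (PV_le.1 h.le) (PV_le.1 h.ge)

theorem exSub {V : Submodule k (Fin N → k)} {n : ℕ} (h : n ≤ Module.finrank k V) :
    ∃ W ≤ V, Module.finrank k W = n := by
  obtain ⟨f, hf⟩ := exists_linearIndependent_of_le_finrank h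
  refine ⟨(Submodule.span k (Set.range f)).map V.subtype, Submodule.map_subtype_le _ _, ?_⟩
  rw [Submodule.finrank_map_subtype_eq, finrank_span_eq_card hf, Fintype.card_fin]

theorem le_height_PV (n : ℕ) : ∀ V : Submodule k (Fin N → k), n ≤ Module.finrank k V →
    (n : ℕ∞) ≤ (PV V).height := by
  induction n with
  | zero => intro V _; simp
  | succ n ih =>
    intro V hV
    obtain ⟨W, hWV, hW⟩ := exSub (V := V) (n := n) (by omega)
    have := PV_prime V
    have := PV_prime W
    have hlt : PV W < PV V := by
      refine lt_of_le_of_ne (PV_mono hWV) fun h => ?_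
      rw [PV_inj h] at hW; omega
    have h1 := Ideal.height_add_one_le_of_lt_of_isPrime hlt
    have h2 := ih W hW.ge
    push_cast
    exact (add_le_add_left h2 1).trans h1

theorem height_PV_le (V : Submodule k (Fin N → k)) :
    (PV V).height ≤ Module.finrank k V := by
  let b := Module.finBasis k V
  have : PV V = Ideal.span (Set.range fun i => lin (b i : Fin N → k)) := by
    apply le_antisymm
    · rw [PV, Ideal.span_le]
      rintro _ ⟨v, hv, rfl⟩
      have : v = ∑ i, b.repr ⟨v, hv⟩ i • (b i : Fin N → k) := by
        have := congrArg V.subtype (b.sum_repr ⟨v, hv⟩)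
        rw [map_sum] at this
        exact this.symm
      rw [this, map_sum]
      refine sum_mem fun i _ => ?_
      rw [map_smul, smul_eq_C_mul]
      exact Ideal.mul_mem_left _ _ (Ideal.subset_span ⟨i, rfl⟩)
    · rw [Ideal.span_le]
      rintro _ ⟨i, rfl⟩
      exact lin_mem (b i).2
  rw [this]
  have hne : Ideal.span (Set.range fun i => lin (b i : Fin N → k)) ≠ ⊤ := by
    rw [← this]; exact (PV_prime V).ne_top
  refine (Ideal.height_le_spanFinrank _ hne).trans ?_
  have h1 := Submodule.spanFinrank_span_le_ncard_of_finite
    (Set.finite_range fun i => lin (b i : Fin N → k)) (R := MvPolynomial (Fin N) k)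
  have h2 := Set.ncard_image_le (f := fun i => lin (b i : Fin N → k)) (Set.finite_univ)
  rw [Set.image_univ] at h2
  have := h1.trans h2
  simp at this
  exact_mod_cast this

theorem linearPrime_eq {p : Ideal (MvPolynomial (Fin N) k)} (hp : IsLinearPrime p)
    (h : idealHeight p = 2) : ∃ V : Submodule k (Fin N → k), p = PV V ∧ Module.finrank k V = 2 := by
  obtain ⟨_, S, hS, rfl⟩ := hp
  have : Ideal.span S = PV (Submodule.span k {v | lin v ∈ S}) := by
    apply le_antisymm
    · rw [Ideal.span_le]
      intro s hs
      obtain ⟨v, rfl⟩ := exists_lin (hS s hs)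
      exact lin_mem (Submodule.subset_span hs)
    · rw [PV, Ideal.span_le]
      rintro _ ⟨v, hv, rfl⟩
      have : Submodule.span k {v | lin v ∈ S} ≤
          ((Ideal.span S).restrictScalars k).comap lin := by
        rw [Submodule.span_le]
        intro v hv
        exact Ideal.subset_span hv
      exact this hv
  refine ⟨_, this, ?_⟩
  rw [idealHeight_eq, this] at h
  set V := Submodule.span k {v | lin v ∈ S}
  have h1 := height_PV_le V
  have h2 := le_height_PV _ V le_rfl
  rw [h] at h1 h2
  apply le_antisymm
  · exact_mod_cast h2
  · exact_mod_cast h1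

theorem two_le_height {V : Submodule k (Fin N → k)} (h : Module.finrank k V = 2) :
    (PV V).height = 2 := by
  apply le_antisymm
  · have := height_PV_le V; rw [h] at this; exact_mod_cast this
  · exact_mod_cast le_height_PV 2 V h.ge
end
end S19

namespace S19

section
variable {k : Type} [Field k] {N : ℕ}

/-- subalgebra generated by the linear forms of `U` -/
def SU (U : Submodule k (Fin N → k)) : Subalgebra k (MvPolynomial (Fin N) k) :=
  Algebra.adjoin k (lin '' (U : Set (Fin N → k)))

theorem lin_mem_SU {U : Submodule k (Fin N → k)} {v} (h : v ∈ U) : lin v ∈ SU U :=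
  Algebra.subset_adjoin ⟨v, h, rfl⟩

theorem SU_mono {U W : Submodule k (Fin N → k)} (h : U ≤ W) : SU U ≤ SU W :=
  Algebra.adjoin_mono (Set.image_mono h)

theorem SU_le {U : Submodule k (Fin N → k)} {A : Subalgebra k (MvPolynomial (Fin N) k)}
    (h : ∀ v ∈ U, lin v ∈ A) : SU U ≤ A := by
  apply Algebra.adjoin_le
  rintro _ ⟨v, hv, rfl⟩
  exact h v hv

theorem exCoord {U W : Submodule k (Fin N → k)} (h : IsCompl U W) :
    ∃ Θ : MvPolynomial (Fin (Module.finrank k W)) (MvPolynomial (Fin (Module.finrank k U)) k) ≃ₐ[k]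
        MvPolynomial (Fin N) k,
      (∀ x ∈ SU U, ∃ s, x = Θ (C s)) ∧ (∀ s, Θ (C s) ∈ SU U) ∧
      (∀ x ∈ SU W, ∃ a : MvPolynomial (Fin (Module.finrank k W)) k, x = Θ (map C a)) := by
  let bU := Module.finBasis k U
  let bW := Module.finBasis k W
  let g : MvPolynomial (Fin (Module.finrank k U)) k →ₐ[k] MvPolynomial (Fin N) k :=
    aeval (fun i => lin (bU i : Fin N → k))
  let F : MvPolynomial (Fin (Module.finrank k W)) (MvPolynomial (Fin (Module.finrank k U)) k) →ₐ[k]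
        MvPolynomial (Fin N) k := aevalTower g (fun i => lin (bW i : Fin N → k))
  let φU : U →ₗ[k] MvPolynomial (Fin (Module.finrank k W))
      (MvPolynomial (Fin (Module.finrank k U)) k) := bU.constr k (fun i => C (X i))
  let φW : W →ₗ[k] MvPolynomial (Fin (Module.finrank k W))
      (MvPolynomial (Fin (Module.finrank k U)) k) := bW.constr k (fun i => X i)
  let G := ext (LinearMap.ofIsCompl h φU φW)
  have hFU : ∀ u : U, F (φU u) = lin (u : Fin N → k) := by
    intro u
    have : F.toLinearMap ∘ₗ φU = lin ∘ₗ U.subtype := by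
      apply bU.ext
      intro i
      simp [φU, F, g]
    exact LinearMap.congr_fun this u
  have hFW : ∀ u : W, F (φW u) = lin (u : Fin N → k) := by
    intro u
    have : F.toLinearMap ∘ₗ φW = lin ∘ₗ W.subtype := by
      apply bW.ext
      intro i
      simp [φW, F, g]
    exact LinearMap.congr_fun this u
  have hGU : ∀ u : U, G (lin (u : Fin N → k)) = φU u := by
    intro u
    rw [ext_lin]; exact LinearMap.ofIsCompl_apply_left h u
  have hGW : ∀ u : W, G (lin (u : Fin N → k)) = φW u := by
    intro u
    rw [ext_lin]; exact LinearMap.ofIsCompl_apply_right h u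
  have hFG : F.comp G = AlgHom.id k _ := by
    apply algHom_ext_lin
    intro v
    have : v ∈ U ⊔ W := by rw [h.sup_eq_top]; trivial
    obtain ⟨a, ha, b, hb, rfl⟩ := Submodule.mem_sup.1 this
    have h1 := hGU ⟨a, ha⟩
    have h2 := hGW ⟨b, hb⟩
    have h3 := hFU ⟨a, ha⟩
    have h4 := hFW ⟨b, hb⟩
    simp only at h1 h2 h3 h4
    simp only [AlgHom.comp_apply, map_add, h1, h2, h3, h4, AlgHom.id_apply]
  have hGF : G.comp F = AlgHom.id k _ := by
    apply MvPolynomial.algHom_ext'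
    · apply MvPolynomial.algHom_ext
      intro i
      have := hGU (bU i)
      simp [F, g, this, φU]
    · intro i
      have := hGW (bW i)
      simp [F, g, this, φW]
  refine ⟨AlgEquiv.ofAlgHom F G hFG hGF, ?_, ?_, ?_⟩
  · intro x hx
    have : SU U ≤ (F.comp (IsScalarTower.toAlgHom k (MvPolynomial (Fin (Module.finrank k U)) k)
        (MvPolynomial (Fin (Module.finrank k W)) (MvPolynomial (Fin (Module.finrank k U)) k)))).range := by
      apply SU_le
      intro v hv
      refine ⟨bU.constr k (fun i => X i) ⟨v, hv⟩, ?_⟩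
      have h3 := hFU ⟨v, hv⟩
      simp only at h3
      rw [← h3]
      simp [φU, Module.Basis.constr_apply_fintype, algebraMap_eq, F]
    obtain ⟨s, hs⟩ := this hx
    exact ⟨s, hs.symm⟩
  · intro s
    change F (C s) ∈ _
    simp only [F, aevalTower_C, g]
    have : (aeval (fun i => lin (bU i : Fin N → k)) :
        MvPolynomial (Fin (Module.finrank k U)) k →ₐ[k] MvPolynomial (Fin N) k).range ≤ SU U := by
      rw [← Algebra.adjoin_range_eq_range_aeval]
      apply Algebra.adjoin_le
      rintro _ ⟨i, rfl⟩
      exact lin_mem_SU (bU i).2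
    exact this ⟨s, rfl⟩
  · intro x hx
    have : SU W ≤ (F.comp (mapAlgHom (IsScalarTower.toAlgHom k k
        (MvPolynomial (Fin (Module.finrank k U)) k)))).range := by
      apply SU_le
      intro v hv
      refine ⟨bW.constr k (fun i => X i) ⟨v, hv⟩, ?_⟩
      have h3 := hFW ⟨v, hv⟩
      simp only at h3
      rw [← h3]
      simp [φW, Module.Basis.constr_apply_fintype, F]
    obtain ⟨s, hs⟩ := this hx
    exact ⟨s, hs.symm⟩
end
end S19

namespace S19

section
variable {k : Type} [Field k] {N : ℕ}

/-- ideal generated by elements of `SU U` -/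
def Ext (U : Submodule k (Fin N → k)) (J : Ideal (MvPolynomial (Fin N) k)) : Prop :=
  ∃ T ⊆ (SU U : Set (MvPolynomial (Fin N) k)), J = Ideal.span T

theorem Ext.mono {U W : Submodule k (Fin N → k)} (h : U ≤ W) {J} (hJ : Ext U J) : Ext W J := by
  obtain ⟨T, hT, rfl⟩ := hJ
  exact ⟨T, hT.trans (SU_mono h), rfl⟩

theorem Ext_PV {U V : Submodule k (Fin N → k)} (h : V ≤ U) : Ext U (PV V) := by
  refine ⟨_, ?_, rfl⟩
  rintro _ ⟨v, hv, rfl⟩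
  exact lin_mem_SU (h hv)

theorem Ext.map {U W : Submodule k (Fin N → k)} {ι κ : Type}
    (Θ : MvPolynomial ι (MvPolynomial κ k) ≃ₐ[k] MvPolynomial (Fin N) k)
    (h1 : ∀ x ∈ SU U, ∃ s, x = Θ (C s))
    {J} (hJ : Ext U J) : ∃ J0 : Ideal (MvPolynomial κ k), ∀ z, Θ z ∈ J ↔ ∀ m, coeff m z ∈ J0 := by
  obtain ⟨T, hT, rfl⟩ := hJ
  refine ⟨Ideal.span {s | Θ (C s) ∈ T}, fun z => ?_⟩
  rw [← mem_map_C_iff, Ideal.map_span]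
  have : Ideal.span T = (Ideal.span (C '' {s | Θ (C s) ∈ T})).map Θ.toRingEquiv := by
    rw [Ideal.map_span]
    congr 1
    ext x
    constructor
    · intro hx
      obtain ⟨s, rfl⟩ := h1 x (hT hx)
      exact ⟨C s, ⟨s, hx, rfl⟩, rfl⟩
    · rintro ⟨_, ⟨s, hs, rfl⟩, rfl⟩
      exact hs
  rw [this]
  constructor
  · intro h
    obtain ⟨y, hy, hy2⟩ := (Ideal.mem_map_iff_of_surjective _ Θ.toRingEquiv.surjective).1 h
    have : y = z := Θ.injective hy2
    rwa [← this]
  · intro h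
    exact Ideal.mem_map_of_mem Θ.toRingEquiv h

theorem Ext_of_map {U : Submodule k (Fin N → k)} {ι κ : Type}
    (Θ : MvPolynomial ι (MvPolynomial κ k) ≃ₐ[k] MvPolynomial (Fin N) k)
    (h1 : ∀ s, Θ (C s) ∈ SU U)
    {J} (J0 : Ideal (MvPolynomial κ k)) (hJ : ∀ z, Θ z ∈ J ↔ ∀ m, coeff m z ∈ J0) :
    Ext U J := by
  refine ⟨(fun s => Θ (C s)) '' J0, ?_, ?_⟩
  · rintro _ ⟨s, _, rfl⟩; exact h1 s
  · apply le_antisymm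
    · intro x hx
      obtain ⟨z, rfl⟩ := Θ.surjective x
      rw [hJ, ← mem_map_C_iff] at hx
      have : (J0.map C).map Θ.toRingEquiv ≤ Ideal.span ((fun s => Θ (C s)) '' J0) := by
        rw [Ideal.map_le_iff_le_comap, Ideal.map_le_iff_le_comap]
        intro s hs
        exact Ideal.subset_span ⟨s, hs, rfl⟩
      exact this (Ideal.mem_map_of_mem Θ.toRingEquiv hx)
    · rw [Ideal.span_le]
      rintro _ ⟨s, hs, rfl⟩
      change Θ (C s) ∈ J
      rw [hJ, ← mem_map_C_iff]
      exact Ideal.mem_map_of_mem _ hs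

theorem Ext.iInf {U : Submodule k (Fin N → k)} {ι : Type} {J : ι → Ideal (MvPolynomial (Fin N) k)}
    (h : ∀ i, Ext U (J i)) : Ext U (⨅ i, J i) := by
  obtain ⟨W, hW⟩ := U.exists_isCompl
  obtain ⟨Θ, h1, h2, -⟩ := exCoord hW
  choose J0 hJ0 using fun i => (h i).map (W := W) Θ h1
  refine Ext_of_map Θ h2 (⨅ i, J0 i) fun z => ?_
  simp only [Ideal.mem_iInf, hJ0]
  exact forall_comm

open TensorProduct in
theorem PD_presented' {S R : Type} [CommRing S] [CommRing R] [Algebra S R] [Module.Flat S R]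
    {d m : ℕ} (hS : GD S d) (T0 : Set (Fin m → S)) :
    PD R ((Fin m → R) ⧸ Submodule.span R ((fun t i => algebraMap S R (t i)) '' T0)) d := by
  have h := (hS ((Fin m → S) ⧸ Submodule.span S T0)).baseChange (R := R)
  set P := Submodule.span R ((fun (t : Fin m → S) i => algebraMap S R (t i)) '' T0) with hP
  let a0 : (Fin m → S) →ₗ[S] (Fin m → R) := (Algebra.linearMap S R).compLeft (Fin m)
  have ha0 : ∀ t, a0 t = fun i => algebraMap S R (t i) := fun t => rfl
  let a : ((Fin m → S) ⧸ Submodule.span S T0) →ₗ[S] ((Fin m → R) ⧸ P) :=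
    Submodule.liftQ _ ((P.mkQ.restrictScalars S) ∘ₗ a0) (by
      rw [Submodule.span_le]
      intro t ht
      simp only [SetLike.mem_coe, LinearMap.mem_ker, LinearMap.comp_apply, ha0]
      exact (Submodule.Quotient.mk_eq_zero P).2 (Submodule.subset_span ⟨t, ht, rfl⟩))
  let A : R ⊗[S] ((Fin m → S) ⧸ Submodule.span S T0) →ₗ[R] ((Fin m → R) ⧸ P) :=
    a.liftBaseChange R
  let b : (Fin m → R) →ₗ[R] R ⊗[S] ((Fin m → S) ⧸ Submodule.span S T0) :=
    Fintype.linearCombination R (fun i => 1 ⊗ₜ[S] (Submodule.span S T0).mkQ (Pi.single i 1))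
  have hb : ∀ t, b (a0 t) = 1 ⊗ₜ[S] (Submodule.span S T0).mkQ t := by
    intro t
    have : (b.restrictScalars S) ∘ₗ a0 =
        (TensorProduct.mk S R _ 1) ∘ₗ (Submodule.span S T0).mkQ := by
      apply LinearMap.pi_ext'
      intro i
      ext
      have : a0 (Pi.single i 1) = Pi.single i 1 := by
        rw [ha0]
        ext j
        by_cases hj : j = i
        · subst hj; simp
        · simp [hj]
      simp [this, b]
    exact LinearMap.congr_fun this t
  let B : ((Fin m → R) ⧸ P) →ₗ[R] R ⊗[S] ((Fin m → S) ⧸ Submodule.span S T0) :=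
    Submodule.liftQ _ b (by
      rw [hP, Submodule.span_le]
      rintro _ ⟨t, ht, rfl⟩
      have := hb t
      rw [ha0] at this
      simp only [SetLike.mem_coe, LinearMap.mem_ker]
      rw [this]
      have : (Submodule.span S T0).mkQ t = 0 :=
        (Submodule.Quotient.mk_eq_zero _).2 (Submodule.subset_span ht)
      rw [this, tmul_zero])
  refine h.of_equiv (LinearEquiv.ofLinearMap A B ?_ ?_)
  · apply Submodule.linearMap_qext
    apply LinearMap.pi_ext'
    intro i
    ext
    have : a0 (Pi.single i 1) = Pi.single i 1 := by
      rw [ha0]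
      ext j
      by_cases hj : j = i
      · subst hj; simp
      · simp [hj]
    simp [A, B, b, a, this]
  · apply TensorProduct.AlgebraTensorModule.ext
    intro r x
    obtain ⟨t, rfl⟩ := Submodule.mkQ_surjective _ x
    have h1 : A (r ⊗ₜ[S] (Submodule.span S T0).mkQ t) = r • P.mkQ (a0 t) := by
      simp [A, a]
    have h2 : ∀ x, B (P.mkQ x) = b x := fun x => rfl
    rw [LinearMap.comp_apply, h1, map_smul, h2, hb, TensorProduct.smul_tmul', smul_eq_mul, mul_one]
    rfl

/-- Lemma E -/
theorem PD_presented {U : Submodule k (Fin N → k)} {d m : ℕ} (hd : Module.finrank k U ≤ d)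
    {T : Set (Fin m → MvPolynomial (Fin N) k)} (hT : ∀ t ∈ T, ∀ i, t i ∈ SU U) :
    PD (MvPolynomial (Fin N) k) ((Fin m → MvPolynomial (Fin N) k) ⧸
      Submodule.span (MvPolynomial (Fin N) k) T) d := by
  obtain ⟨W, hW⟩ := U.exists_isCompl
  obtain ⟨Θ, h1, h2, -⟩ := exCoord hW
  letI : Algebra (MvPolynomial (Fin (Module.finrank k U)) k) (MvPolynomial (Fin N) k) :=
    (Θ.toRingEquiv.toRingHom.comp C).toAlgebra
  have hal : ∀ s : MvPolynomial (Fin (Module.finrank k U)) k,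
    algebraMap _ (MvPolynomial (Fin N) k) s = Θ (C s) := fun s => rfl
  let e : MvPolynomial (Fin (Module.finrank k W)) (MvPolynomial (Fin (Module.finrank k U)) k)
      ≃ₗ[MvPolynomial (Fin (Module.finrank k U)) k] MvPolynomial (Fin N) k :=
    { Θ with
      map_smul' := by
        intro s x
        simp only [RingHom.id_apply, Algebra.smul_def, hal]
        exact map_mul Θ _ _ }
  have : Module.Flat (MvPolynomial (Fin (Module.finrank k U)) k) (MvPolynomial (Fin N) k) :=
    Module.Flat.of_linearEquiv e.symm
  have h := PD_presented' (R := MvPolynomial (Fin N) k) (GD_mvPolynomial k (Module.finrank k U))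
    {t : Fin m → _ | (fun i => Θ (C (t i))) ∈ T}
  have hTT : (fun (t : Fin m → MvPolynomial (Fin (Module.finrank k U)) k) i =>
      algebraMap _ (MvPolynomial (Fin N) k) (t i)) ''
      {t : Fin m → _ | (fun i => Θ (C (t i))) ∈ T} = T := by
    ext x
    constructor
    · rintro ⟨t, ht, rfl⟩; exact ht
    · intro hx
      choose t ht using fun i => h1 _ (hT x hx i)
      refine ⟨t, ?_, ?_⟩
      · change (fun i => Θ (C (t i))) ∈ T
        have : (fun i => Θ (C (t i))) = x := by ext1 i; exact (ht i).symm
        rwa [this]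
      · ext1 i; exact (ht i).symm
  rw [hTT] at h
  exact h.mono hd

/-- Lemma FL, coordinates version -/
theorem FL0 {ι S : Type} [CommRing S] [Algebra k S] [FaithfulSMul k S] (J0 : Ideal S)
    {a a' : MvPolynomial ι k}
    (h0 : a ≠ 0) (hrel : IsRelPrime a a') :
    (∀ z, map (algebraMap k S) a * z ∈ J0.map (C : S →+* MvPolynomial ι S) →
      z ∈ J0.map (C : S →+* MvPolynomial ι S)) ∧
    (∀ z, map (algebraMap k S) a' * z ∈
      J0.map (C : S →+* MvPolynomial ι S) ⊔ Ideal.span {map (algebraMap k S) a} →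
      z ∈ J0.map (C : S →+* MvPolynomial ι S) ⊔ Ideal.span {map (algebraMap k S) a}) := by
  classical
  let b := Module.Basis.ofVectorSpace k (S ⧸ J0)
  -- coefficientwise functionals
  let φ : Module.Basis.ofVectorSpaceIndex k (S ⧸ J0) → MvPolynomial ι S → MvPolynomial ι k :=
    fun i z => ∑ m ∈ z.support, monomial m (b.coord i (Ideal.Quotient.mk J0 (coeff m z)))
  have hφc : ∀ i z m, coeff m (φ i z) = b.coord i (Ideal.Quotient.mk J0 (coeff m z)) :=
    by
    intro i z m
    simp only [φ, coeff_sum, coeff_monomial]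
    rw [Finset.sum_ite_eq']
    split_ifs with h
    · rfl
    · rw [notMem_support_iff.1 h]; simp
  have hφadd : ∀ i z w, φ i (z + w) = φ i z + φ i w := by
    intro i z w; ext m; simp [hφc]
  have hφmul : ∀ i (c : MvPolynomial ι k) z, φ i (map (algebraMap k S) c * z) = c * φ i z := by
    intro i c z
    ext m
    rw [hφc, coeff_mul, coeff_mul, map_sum, map_sum]
    refine Finset.sum_congr rfl fun x _ => ?_
    rw [coeff_map, hφc, ← Algebra.smul_def, ← smul_eq_mul, ← map_smul]
    rfl
  have hφJ : ∀ z, z ∈ J0.map (C : S →+* MvPolynomial ι S) ↔ ∀ i, φ i z = 0 := by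
    intro z
    rw [mem_map_C_iff]
    constructor
    · intro h i
      ext m
      rw [hφc, Ideal.Quotient.eq_zero_iff_mem.2 (h m)]; simp
    · intro h m
      rw [← Ideal.Quotient.eq_zero_iff_mem]
      apply b.repr.injective
      ext i
      have := congrArg (coeff m) (h i)
      rw [hφc] at this
      simpa using this
  choose e he using fun i => Ideal.Quotient.mk_surjective (b i)
  have key : ∀ z, ∃ F : Finset (Module.Basis.ofVectorSpaceIndex k (S ⧸ J0)),
      z - ∑ i ∈ F, C (e i) * map (algebraMap k S) (φ i z) ∈ J0.map (C : S →+* MvPolynomial ι S) := by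
    intro z
    refine ⟨z.support.biUnion fun m => (b.repr (Ideal.Quotient.mk J0 (coeff m z))).support, ?_⟩
    rw [mem_map_C_iff]
    intro m
    rw [← Ideal.Quotient.eq_zero_iff_mem, coeff_sub, map_sub, sub_eq_zero, coeff_sum, map_sum]
    simp only [coeff_C_mul, coeff_map, map_mul, he, hφc]
    by_cases hm : m ∈ z.support
    · conv_lhs => rw [← b.linearCombination_repr (Ideal.Quotient.mk J0 (coeff m z))]
      rw [Finsupp.linearCombination_apply, Finsupp.sum_of_support_subset _
        (Finset.subset_biUnion_of_mem
          (fun m => (b.repr (Ideal.Quotient.mk J0 (coeff m z))).support) hm)]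
      · refine Finset.sum_congr rfl fun i _ => ?_
        rw [mul_comm, Algebra.smul_def]
        rfl
      · simp
    · rw [notMem_support_iff.1 hm]
      simp
  constructor
  · intro z hz
    rw [hφJ] at hz ⊢
    intro i
    have := hz i
    rw [hφmul] at this
    exact (mul_eq_zero.1 this).resolve_left h0
  · intro z hz
    obtain ⟨j, hj, w, hw, hjw⟩ := Submodule.mem_sup.1 hz
    obtain ⟨y, rfl⟩ := Ideal.mem_span_singleton'.1 hw
    have hdvd : ∀ i, a ∣ φ i z := by
      intro i
      have h1 := congrArg (φ i) hjw
      rw [hφadd, (hφJ j).1 hj, zero_add, mul_comm y, hφmul, hφmul] at h1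
      exact hrel.dvd_of_dvd_mul_left ⟨_, h1.symm⟩
    obtain ⟨F, hF⟩ := key z
    have : z = (z - ∑ i ∈ F, C (e i) * map (algebraMap k S) (φ i z)) +
      ∑ i ∈ F, C (e i) * map (algebraMap k S) (φ i z) := by ring
    rw [this]
    refine add_mem (Ideal.mem_sup_left hF) (Ideal.mem_sup_right (sum_mem fun i _ => ?_))
    exact Ideal.mul_mem_left _ _ (Ideal.mem_span_singleton.2 (map_dvd _ (hdvd i)))

/-- Lemma FL -/
theorem FL {UA UB : Submodule k (Fin N → k)} (h : Disjoint UA UB)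
    {J} (hJ : Ext UB J) {a a' : MvPolynomial (Fin N) k} (ha : a ∈ SU UA) (ha' : a' ∈ SU UA)
    (h0 : a ≠ 0) (hrel : IsRelPrime a a') :
    (∀ z, a * z ∈ J → z ∈ J) ∧ (∀ z, a' * z ∈ J ⊔ Ideal.span {a} → z ∈ J ⊔ Ideal.span {a}) := by
  obtain ⟨W, hUW, hW⟩ := h.exists_isCompl
  obtain ⟨Θ, h1, h2, h3⟩ := exCoord hW.symm
  obtain ⟨a, rfl⟩ := h3 a (SU_mono hUW ha)
  obtain ⟨a', rfl⟩ := h3 a' (SU_mono hUW ha')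
  obtain ⟨J0, hJ0⟩ := hJ.map (W := W) Θ h1
  have ha0 : a ≠ 0 := by rintro rfl; simp at h0
  have har : IsRelPrime a a' := by
    intro d hd hd'
    have h4 := hrel (map_dvd Θ (map_dvd (MvPolynomial.map C) hd)) (map_dvd Θ (map_dvd (MvPolynomial.map C) hd'))
    have h5 := h4.map Θ.symm
    rw [AlgEquiv.symm_apply_apply] at h5
    have h6 := h5.map (MvPolynomial.map (constantCoeff (R := k) (σ := Fin (Module.finrank k UB))))
    rw [MvPolynomial.map_map] at h6
    have : (constantCoeff (R := k) (σ := Fin (Module.finrank k UB))).comp C = RingHom.id k := by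
      ext; simp
    rw [this, MvPolynomial.map_id] at h6
    exact h6
  obtain ⟨g1, g2⟩ := FL0 (S := MvPolynomial (Fin (Module.finrank k UB)) k) J0 ha0 har
  have hsup : ∀ z, Θ z ∈ J ⊔ Ideal.span {Θ (map C a)} ↔ z ∈ J0.map C ⊔ Ideal.span {map C a} := by
    intro z
    simp only [Submodule.mem_sup]
    constructor
    · rintro ⟨y, hy, w, hw, hyw⟩
      obtain ⟨y, rfl⟩ := Θ.surjective y
      obtain ⟨w, rfl⟩ := Ideal.mem_span_singleton'.1 hw
      obtain ⟨w, rfl⟩ := Θ.surjective w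
      refine ⟨y, mem_map_C_iff.2 ((hJ0 y).1 hy), w * map C a, Ideal.mem_span_singleton'.2 ⟨w, rfl⟩, ?_⟩
      apply Θ.injective
      rw [map_add, map_mul, hyw]
    · rintro ⟨y, hy, w, hw, rfl⟩
      obtain ⟨w, rfl⟩ := Ideal.mem_span_singleton'.1 hw
      refine ⟨Θ y, (hJ0 y).2 (mem_map_C_iff.1 hy), Θ (w * map C a),
        Ideal.mem_span_singleton'.2 ⟨Θ w, ?_⟩, ?_⟩
      · rw [map_mul]
      · rw [map_add]
  constructor
  · intro z hz
    obtain ⟨z, rfl⟩ := Θ.surjective z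
    rw [← map_mul, hJ0, ← mem_map_C_iff] at hz
    rw [hJ0, ← mem_map_C_iff]
    exact g1 z hz
  · intro z hz
    obtain ⟨z, rfl⟩ := Θ.surjective z
    rw [← map_mul, hsup] at hz
    rw [hsup]
    exact g2 z hz
end
end S19

namespace S19

section
variable {k : Type} [Field k] {N : ℕ}

/-- avoidance -/
theorem avoid [Infinite k] {V : Submodule k (Fin N → k)} (hV : 2 ≤ (PV V).height)
    {g : MvPolynomial (Fin N) k} (hg : g ≠ 0) : ∃ w ∈ V, IsRelPrime g (lin w) := by
  classical
  by_contra! hcon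
  let D : MvPolynomial (Fin N) k → Submodule k V := fun i =>
    ((Ideal.span {i}).restrictScalars k).comap (lin ∘ₗ V.subtype)
  have hD : ∀ i (w : V), w ∈ D i ↔ i ∣ lin (w : Fin N → k) := by
    intro i w
    change lin (w : Fin N → k) ∈ Ideal.span {i} ↔ _
    rw [Ideal.mem_span_singleton]
  have hsub : ⋃ i : (UniqueFactorizationMonoid.factors g).toFinset, (D i : Set V) = Set.univ := by
    rw [Set.eq_univ_iff_forall]
    intro t
    have h1 := hcon t t.2
    rw [UniqueFactorizationMonoid.isRelPrime_iff_no_prime_factors hg] at h1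
    push Not at h1
    obtain ⟨d, hd1, hd2, hd3⟩ := h1
    obtain ⟨i, hi, hdi⟩ := UniqueFactorizationMonoid.exists_mem_factors_of_dvd hg hd3.irreducible hd1
    refine Set.mem_iUnion.2 ⟨⟨i, by simpa using hi⟩, ?_⟩
    exact (hD i t).2 (hdi.symm.dvd.trans hd2)
  obtain ⟨⟨i, hi⟩, htop⟩ := Subspace.exists_eq_top_of_iUnion_eq_univ (k := k) hsub
  have hi' : Prime i := UniqueFactorizationMonoid.prime_of_factor i (by simpa using hi)
  have h1 : PV V ≤ Ideal.span {i} := by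
    rw [PV, Ideal.span_le]
    rintro _ ⟨v, hv, rfl⟩
    have : (⟨v, hv⟩ : V) ∈ D i := by rw [htop]; trivial
    exact Ideal.mem_span_singleton.2 ((hD _ _).1 this)
  have h2 : (Ideal.span {i}).height ≤ 1 := Ideal.height_span_singleton_le_one hi'.not_isUnit
  have := hV.trans ((Ideal.height_mono h1).trans h2)
  norm_num at this

theorem avoid_prod [Infinite k] {ι : Type} [Fintype ι] {V : ι → Submodule k (Fin N → k)}
    (hV : ∀ i, Module.finrank k (V i) = 2) {U : Submodule k (Fin N → k)} (hU : ∀ i, V i ≤ U)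
    {g : MvPolynomial (Fin N) k} (hg : g ≠ 0) :
    ∃ s, s ∈ SU U ∧ s ∈ ⨅ i, PV (V i) ∧ IsRelPrime g s ∧ s ≠ 0 := by
  classical
  have h1 : ∀ i, ∃ v ∈ V i, v ≠ 0 := by
    intro i
    apply Submodule.exists_mem_ne_zero_of_ne_bot
    intro h
    have := hV i
    rw [h] at this
    simp at this
  choose v hv hv0 using h1
  choose w hw hr using fun i => avoid (two_le_height (hV i)).ge (g := g * lin (v i))
    (mul_ne_zero hg (by rw [Ne, lin_eq_zero]; exact hv0 i))
  have h0 : ∀ i, w i ≠ 0 := by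
    intro i hi
    have h1 := hr i
    rw [hi, map_zero, isRelPrime_zero_right] at h1
    have h2 := isUnit_of_mul_isUnit_right h1
    exact (PV_prime (V i)).ne_top (Ideal.eq_top_of_isUnit_mem _ (lin_mem (hv i)) h2)
  refine ⟨∏ i, lin (w i), ?_, ?_, ?_, ?_⟩
  · exact Subalgebra.prod_mem _ fun i _ => lin_mem_SU (hU i (hw i))
  · rw [Ideal.mem_iInf]
    intro i
    rw [← Finset.mul_prod_erase _ _ (Finset.mem_univ i)]
    exact Ideal.mul_mem_right _ _ (lin_mem (hw i))
  · exact IsRelPrime.prod_right fun i _ => (hr i).of_mul_left_left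
  · rw [Finset.prod_ne_zero_iff]
    intro i _
    rw [Ne, lin_eq_zero]
    exact h0 i

theorem PD_quot_Ext {U : Submodule k (Fin N → k)} {d : ℕ} (hd : Module.finrank k U ≤ d)
    {J} (hJ : Ext U J) : PD (MvPolynomial (Fin N) k) (MvPolynomial (Fin N) k ⧸ J) d := by
  obtain ⟨T, hT, rfl⟩ := hJ
  have h := PD_presented hd (m := 1) (T := (fun t _ => t) '' T) (by
    rintro _ ⟨t, ht, rfl⟩ i; exact hT ht)
  refine h.of_equiv (Submodule.Quotient.equiv _ _ (LinearEquiv.funUnique (Fin 1) _ _) ?_)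
  rw [Submodule.map_span, Set.image_image]
  simp [Ideal.span]

theorem PD_colon {U : Submodule k (Fin N → k)} {n m : ℕ} (hd : Module.finrank k U ≤ n + 1)
    {u : Fin m → MvPolynomial (Fin N) k} (hu : ∀ i, u i ∈ SU U)
    {A : Fin m → Ideal (MvPolynomial (Fin N) k)} (hA : ∀ i, Ext U (A i))
    (hA2 : ∀ i, PD (MvPolynomial (Fin N) k) (MvPolynomial (Fin N) k ⧸ A i) n)
    {K : Ideal (MvPolynomial (Fin N) k)} (hK : ∀ r, r ∈ K ↔ ∀ i, u i * r ∈ A i) :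
    PD (MvPolynomial (Fin N) k) (MvPolynomial (Fin N) k ⧸ K) n := by
  let R := MvPolynomial (Fin N) k
  choose T hT hAT using hA
  let Q : Submodule R (Fin m → R) := Submodule.pi Set.univ A
  have hQ : ∀ x, x ∈ Q ↔ ∀ i, x i ∈ A i := by intro x; simp [Q, Submodule.mem_pi]
  have h2 : PD R ((Fin m → R) ⧸ Q) n := (PD.pi hA2).of_equiv (Submodule.quotientPi A).symm
  have hspan : Q ⊔ Submodule.span R {u} =
      Submodule.span R ((⋃ i, (fun t => Pi.single i t) '' T i) ∪ {u}) := by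
    rw [Submodule.span_union]
    congr 1
    apply le_antisymm
    · intro x hx
      rw [hQ] at hx
      rw [← Finset.univ_sum_single x]
      refine sum_mem fun i _ => ?_
      have h1 := hx i
      rw [hAT i] at h1
      have : Ideal.span (T i) ≤ (Submodule.span R (⋃ i, (fun t => Pi.single i t) '' T i)).comap
          (LinearMap.single R (fun _ : Fin m => R) i) := by
        rw [Ideal.span, Submodule.span_le]
        intro t ht
        exact Submodule.subset_span (Set.mem_iUnion.2 ⟨i, t, ht, rfl⟩)
      exact this h1
    · rw [Submodule.span_le]
      intro x hx
      obtain ⟨i, t, ht, rfl⟩ := Set.mem_iUnion.1 hx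
      rw [SetLike.mem_coe, hQ]
      intro j
      by_cases hj : j = i
      · subst hj
        simp only [Pi.single_eq_same]
        rw [hAT j]; exact Ideal.subset_span ht
      · simp [hj]
  have h3 : PD R ((Fin m → R) ⧸ (Q ⊔ Submodule.span R {u})) (n+1) := by
    rw [hspan]
    refine PD_presented hd ?_
    rintro x (hx | hx) j
    · obtain ⟨i, t, ht, rfl⟩ := Set.mem_iUnion.1 hx
      by_cases hj : j = i
      · subst hj
        simpa using hT j ht
      · simp [hj]
    · rw [hx]; exact hu j
  let f0 : R →ₗ[R] ((Fin m → R) ⧸ Q) := Q.mkQ ∘ₗ LinearMap.toSpanSingleton R _ u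
  have hf0 : ∀ r, f0 r = Q.mkQ (r • u) := fun r => rfl
  have hker : K = LinearMap.ker f0 := by
    ext r
    rw [LinearMap.mem_ker, hf0, hK, Submodule.mkQ_apply, Submodule.Quotient.mk_eq_zero, hQ]
    simp [mul_comm, R]
  let f : (R ⧸ K) →ₗ[R] ((Fin m → R) ⧸ Q) := Submodule.liftQ K f0 hker.le
  refine PD.x1 (f := f) (g := Submodule.factor (le_sup_left : Q ≤ Q ⊔ Submodule.span R {u}))
    ?_ ?_ (Submodule.factor_surjective _) h2 h3
  · rw [← LinearMap.ker_eq_bot, Submodule.ker_liftQ_eq_bot']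
    exact hker
  · intro x
    obtain ⟨x, rfl⟩ := Submodule.mkQ_surjective _ x
    constructor
    · intro hx
      have : x ∈ Q ⊔ Submodule.span R {u} := by
        rw [← Submodule.Quotient.mk_eq_zero]; exact hx
      obtain ⟨q, hq, y, hy, rfl⟩ := Submodule.mem_sup.1 this
      obtain ⟨r, rfl⟩ := Submodule.mem_span_singleton.1 hy
      refine ⟨K.mkQ r, ?_⟩
      change f0 r = _
      rw [hf0, map_add]
      have : Q.mkQ q = 0 := (Submodule.Quotient.mk_eq_zero _).2 hq
      rw [this, zero_add]
    · rintro ⟨y, hy⟩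
      obtain ⟨r, rfl⟩ := Submodule.mkQ_surjective _ y
      rw [← hy]
      change (Submodule.mkQ (Q ⊔ Submodule.span R {u})) (r • u) = 0
      rw [Submodule.mkQ_apply, Submodule.Quotient.mk_eq_zero]
      exact Submodule.mem_sup_right (Submodule.smul_mem _ _ (Submodule.mem_span_singleton_self u))

/-- Lemma PK -/
theorem PK {U : Submodule k (Fin N → k)} {n m : ℕ} (hd : Module.finrank k U ≤ n + 1) (hn : 2 ≤ n)
    {V : Fin m → Submodule k (Fin N → k)}
    (hV : ∀ i, Module.finrank k (V i) = 2) (hU : ∀ i, V i ≤ U) :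
    PD (MvPolynomial (Fin N) k) (MvPolynomial (Fin N) k ⧸ ⨅ i, PV (V i)) n :=
  PD_colon hd (u := fun _ => 1) (fun _ => one_mem _) (fun i => Ext_PV (hU i))
    (fun i => (PD_quot_Ext (hV i).le (Ext_PV le_rfl)).mono hn) (by simp [Ideal.mem_iInf])

/-- Lemma PM -/
theorem PM0 {U : Submodule k (Fin N → k)} {n : ℕ} (hd : Module.finrank k U ≤ n + 2) (hn : 2 ≤ n)
    {J} (hJ : Ext U J) {g1 g2 : MvPolynomial (Fin N) k} (h1 : g1 ∈ SU U) (h2 : g2 ∈ SU U)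
    (h0 : g1 ≠ 0) (hr : IsRelPrime g1 g2) :
    PD (MvPolynomial (Fin N) k) (Tors J (Ideal.span {g1, g2})) n := by
  obtain ⟨T, hT, rfl⟩ := hJ
  obtain ⟨S, hS, hS2⟩ := (Submodule.fg_span_iff_fg_span_finset_subset T).1
    (IsNoetherian.noetherian (Ideal.span T))
  have hST : Ideal.span T = Ideal.span (S : Set (MvPolynomial (Fin N) k)) := hS2
  let u : Fin S.card → MvPolynomial (Fin N) k := fun i => S.equivFin.symm i
  have hK : Ideal.span {g1, g2} ≤ Submodule.colon (Ideal.span {g1, g2}) (Ideal.span T) := by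
    intro x hx
    rw [Submodule.mem_colon]
    intro y _
    exact Ideal.mul_mem_right _ _ hx
  have hp : PD (MvPolynomial (Fin N) k) (MvPolynomial (Fin N) k ⧸
      (Submodule.colon (Ideal.span {g1, g2}) (Ideal.span T) : Ideal (MvPolynomial (Fin N) k))) (n+1) := by
    refine PD_colon (U := U) (n := n+1) hd (u := u) (A := fun _ => Ideal.span {g1, g2}) ?_ ?_ ?_ ?_
    · intro i
      exact hT (hS (S.equivFin.symm i).2)
    · intro i
      refine ⟨_, ?_, rfl⟩
      rintro x (rfl | rfl)
      · exact h1
      · exact h2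
    · intro i
      exact (PD.koszul h0 hr).mono (by omega)
    · intro r
      rw [hST, Submodule.mem_colon]
      constructor
      · intro h i
        have := h (u i) (Ideal.subset_span (S.equivFin.symm i).2)
        rwa [smul_eq_mul, mul_comm] at this
      · intro h y hy
        have : Ideal.span (S : Set (MvPolynomial (Fin N) k)) ≤
            Submodule.colon (Ideal.span {g1, g2}) (Ideal.span {r}) := by
          rw [Ideal.span_le]
          intro s hs
          rw [SetLike.mem_coe, mem_colon_span]
          have := h (S.equivFin ⟨s, hs⟩)
          simpa [u] using this
        have := this hy
        rw [mem_colon_span] at this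
        rwa [smul_eq_mul, mul_comm]
  refine PD.x1 (f := (Tors (Ideal.span T) (Ideal.span {g1, g2})).subtype)
    (g := Submodule.factor hK) (Submodule.subtype_injective _) ?_
    (Submodule.factor_surjective _) ((PD.koszul h0 hr).mono (by omega)) hp
  intro x
  obtain ⟨x, rfl⟩ := Ideal.Quotient.mk_surjective x
  have h3 : (Submodule.factor hK) (Ideal.Quotient.mk _ x) = 0 ↔
      x ∈ Submodule.colon (Ideal.span {g1, g2}) (Ideal.span T : Ideal (MvPolynomial (Fin N) k)) :=
    Submodule.Quotient.mk_eq_zero _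
  rw [h3, Submodule.mem_colon, Submodule.coe_subtype, Subtype.range_coe, SetLike.mem_coe]
  refine Iff.trans ?_ (mk_mem_Tors (J := Ideal.span T) (A := Ideal.span {g1, g2}) (x := x)).symm
  simp [mul_comm]
theorem PM [Infinite k] {U : Submodule k (Fin N → k)} {ι : Type} [Fintype ι] (hd : Module.finrank k U ≤ 5)
    {V : ι → Submodule k (Fin N → k)}
    (hV : ∀ i, Module.finrank k (V i) = 2) (hU : ∀ i, V i ≤ U)
    {f1 f2 : MvPolynomial (Fin N) k} (h0 : f1 ≠ 0) (hr : IsRelPrime f1 f2)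
    (h1 : f1 ∈ ⨅ i, PV (V i)) (h2 : f2 ∈ ⨅ i, PV (V i)) :
    PD (MvPolynomial (Fin N) k) (Tors (⨅ i, PV (V i)) (Ideal.span {f1, f2})) 3 := by
  obtain ⟨g1, hg1, hg1', -, hg10⟩ := avoid_prod hV hU (g := 1) one_ne_zero
  obtain ⟨g2, hg2, hg2', hg12, -⟩ := avoid_prod hV hU hg10
  obtain ⟨s, hs, hs', hsr, hs0⟩ := avoid_prod hV hU (mul_ne_zero h0 hg10)
  obtain ⟨e⟩ := Tors_exchange2 (J := ⨅ i, PV (V i)) (s := s) hg12 hr hsr.of_mul_left_right.symm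
    hsr.of_mul_left_left.symm hg1' hg2' h1 h2 hs'
  exact (PM0 hd (by norm_num) (Ext.iInf fun i => Ext_PV (hU i)) hg1 hg2 hg10 hg12).of_equiv e
end
end S19

namespace S19

section
variable {R : Type} [CommRing R]

/-- grade-two type condition -/
def EP (Q : Ideal R) (M : Type) [AddCommGroup M] [Module R M] : Prop :=
  (∀ n : M, (∀ q ∈ Q, q • n = 0) → n = 0) ∧
    ∀ φ : Q →ₗ[R] M, ∃ n : M, ∀ q : Q, φ q = (q : R) • n

theorem EP.extension {Q : Ideal R} {M₁ M₂ M₃ : Type} [AddCommGroup M₁] [Module R M₁]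
    [AddCommGroup M₂] [Module R M₂] [AddCommGroup M₃] [Module R M₃]
    {f : M₁ →ₗ[R] M₂} {g : M₂ →ₗ[R] M₃} (hf : Function.Injective f) (hfg : Function.Exact f g)
    (hg : Function.Surjective g) (h1 : EP Q M₁) (h3 : EP Q M₃) : EP Q M₂ := by
  constructor
  · intro n hn
    have : g n = 0 := h3.1 _ fun q hq => by rw [← map_smul, hn q hq, map_zero]
    obtain ⟨m, rfl⟩ := (hfg n).1 this
    rw [h1.1 m, map_zero]
    intro q hq
    apply hf
    rw [map_smul, hn q hq, map_zero]
  · intro φ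
    obtain ⟨n3, hn3⟩ := h3.2 (g ∘ₗ φ)
    obtain ⟨n2, rfl⟩ := hg n3
    have hr : ∀ q : Q, φ q - (q : R) • n2 ∈ LinearMap.range f := by
      intro q
      refine (hfg _).1 ?_
      rw [map_sub, map_smul, ← hn3 q]; simp
    let φ' : Q →ₗ[R] LinearMap.range f :=
      (φ - (LinearMap.toSpanSingleton R M₂ n2) ∘ₗ Q.subtype).codRestrict _ hr
    obtain ⟨n1, hn1⟩ := h1.2 ((LinearEquiv.ofInjective f hf).symm.toLinearMap ∘ₗ φ')
    refine ⟨f n1 + n2, fun q => ?_⟩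
    have h4 := congrArg (fun z => (LinearEquiv.ofInjective f hf z : M₂)) (hn1 q)
    simp only [LinearMap.comp_apply, LinearEquiv.coe_coe, LinearEquiv.apply_symm_apply,
      LinearEquiv.ofInjective_apply, map_smul] at h4
    have h5 : (φ' q : M₂) = φ q - (q : R) • n2 := rfl
    rw [h5] at h4
    rw [smul_add, ← sub_eq_iff_eq_add, h4]; rfl

theorem EP.of_regular {Q A : Ideal R} {u v : R} (hu : u ∈ Q) (hv : v ∈ Q)
    (h1 : ∀ z, u * z ∈ A → z ∈ A)
    (h2 : ∀ z, v * z ∈ A ⊔ Ideal.span {u} → z ∈ A ⊔ Ideal.span {u}) : EP Q (R ⧸ A) := by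
  have h1' : ∀ n : R ⧸ A, u • n = 0 → n = 0 := by
    intro n hn
    obtain ⟨z, rfl⟩ := Ideal.Quotient.mk_surjective n
    rw [Ideal.Quotient.eq_zero_iff_mem]
    apply h1
    rw [← Ideal.Quotient.eq_zero_iff_mem]
    exact hn
  refine ⟨fun n hn => h1' n (hn u hu), fun φ => ?_⟩
  obtain ⟨a, ha⟩ := Ideal.Quotient.mk_surjective (φ ⟨u, hu⟩)
  obtain ⟨b, hb⟩ := Ideal.Quotient.mk_surjective (φ ⟨v, hv⟩)
  have hab : v • φ ⟨u, hu⟩ = u • φ ⟨v, hv⟩ := by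
    rw [← map_smul, ← map_smul]
    congr 1
    ext; simp [mul_comm]
  have h3 : v * a - u * b ∈ A := by
    rw [← Ideal.Quotient.eq_zero_iff_mem, map_sub, sub_eq_zero]
    rw [← ha, ← hb] at hab
    exact hab
  have h4 : a ∈ A ⊔ Ideal.span {u} := by
    apply h2
    have : v * a = (v * a - u * b) + b * u := by ring
    rw [this]
    exact add_mem (Ideal.mem_sup_left h3)
      (Ideal.mem_sup_right (Ideal.mem_span_singleton'.2 ⟨b, rfl⟩))
  obtain ⟨y, hy, w, hw, hyw⟩ := Submodule.mem_sup.1 h4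
  obtain ⟨n, rfl⟩ := Ideal.mem_span_singleton'.1 hw
  have h5 : φ ⟨u, hu⟩ = u • Ideal.Quotient.mk A n := by
    rw [← ha, ← hyw, map_add, Ideal.Quotient.eq_zero_iff_mem.2 hy, zero_add, mul_comm]
    rfl
  refine ⟨Ideal.Quotient.mk A n, fun q => ?_⟩
  rw [← sub_eq_zero]
  apply h1'
  rw [smul_sub, sub_eq_zero, smul_comm, ← h5, ← map_smul, ← map_smul]
  congr 1
  ext; simp [mul_comm]

theorem EP.quot_mul [IsDomain R] [DecompositionMonoid R] {Q : Ideal R} {p q r : R} (hp : p ≠ 0)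
    (hpr : IsRelPrime p r)
    (h1 : EP Q (R ⧸ Ideal.span {q, r})) (h2 : EP Q (R ⧸ Ideal.span {p, r})) :
    EP Q (R ⧸ Ideal.span {p * q, r}) := by
  have hle : Ideal.span {p * q, r} ≤ Ideal.span {p, r} := by
    rw [Ideal.span_le]
    rintro x (rfl | rfl)
    · exact Ideal.mul_mem_right _ _ (Ideal.subset_span (by simp))
    · exact Ideal.subset_span (by simp)
  have hle2 : Ideal.span {q, r} ≤ Submodule.comap (LinearMap.lsmul R R p) (Ideal.span {p * q, r}) := by
    rw [Ideal.span, Submodule.span_le]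
    rintro x (rfl | rfl)
    · exact Ideal.subset_span (by simp)
    · exact Ideal.mul_mem_left _ _ (Ideal.subset_span (by simp))
  refine EP.extension (f := Submodule.mapQ _ _ (LinearMap.lsmul R R p) hle2)
    (g := Submodule.factor hle) ?_ ?_ (Submodule.factor_surjective _) h1 h2
  · rw [injective_iff_map_eq_zero]
    intro x hx
    obtain ⟨x, rfl⟩ := Submodule.Quotient.mk_surjective _ x
    have hx' : p * x ∈ Ideal.span {p * q, r} := (Submodule.Quotient.mk_eq_zero _).1 hx
    rw [Submodule.Quotient.mk_eq_zero]
    obtain ⟨y, z, hyz⟩ := Ideal.mem_span_pair.1 hx'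
    have : p ∣ z * r := ⟨x - y * q, by linear_combination hyz⟩
    obtain ⟨z', rfl⟩ := hpr.dvd_of_dvd_mul_right this
    rw [Ideal.mem_span_pair]
    refine ⟨y, z', ?_⟩
    apply mul_left_cancel₀ hp
    linear_combination hyz
  · intro x
    obtain ⟨x, rfl⟩ := Submodule.Quotient.mk_surjective _ x
    constructor
    · intro hx
      have hx' : x ∈ Ideal.span {p, r} := (Submodule.Quotient.mk_eq_zero _).1 hx
      obtain ⟨y, z, rfl⟩ := Ideal.mem_span_pair.1 hx'
      refine ⟨Submodule.Quotient.mk y, ?_⟩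
      change Submodule.Quotient.mk (p * y) = _
      rw [Submodule.Quotient.eq, Ideal.mem_span_pair]
      exact ⟨0, -z, by ring⟩
    · rintro ⟨y, hy⟩
      obtain ⟨y, rfl⟩ := Submodule.Quotient.mk_surjective _ y
      rw [← hy]
      change Submodule.Quotient.mk (p * y) = _
      rw [Submodule.Quotient.mk_eq_zero]
      exact Ideal.mul_mem_right _ _ (Ideal.subset_span (by simp))

theorem Tors_mono {J J' A : Ideal R} (h : J ≤ J') : Tors J' A ≤ Tors J A := by
  intro x hx
  rw [mem_Tors] at *
  exact fun j hj => hx j (h hj)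

theorem PD_Tors_split {J1 J2 A : Ideal R} (hE : EP (J1 ⊔ J2) (R ⧸ A)) {n : ℕ}
    (h1 : PD R (Tors J1 A) n) (h2 : PD R (Tors J2 A) n) : PD R (Tors (J1 ⊓ J2) A) n := by
  let f : (Tors J1 A × Tors J2 A) →ₗ[R] Tors (J1 ⊓ J2) A :=
    (Submodule.inclusion (Tors_mono inf_le_left)).coprod (Submodule.inclusion (Tors_mono inf_le_right))
  have hf : ∀ x, (f x : R ⧸ A) = x.1 + x.2 := fun x => rfl
  refine (h1.prod h2).of_equiv (LinearEquiv.ofBijective f ⟨?_, ?_⟩)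
  · rw [injective_iff_map_eq_zero]
    rintro ⟨⟨x, hx⟩, ⟨y, hy⟩⟩ hxy
    have hxy' : x + y = 0 := by rw [← Submodule.coe_eq_zero, hf] at hxy; exact hxy
    have hxy2 : x = - y := eq_neg_of_add_eq_zero_left hxy'
    have hx0 : x = 0 := by
      apply hE.1
      intro q hq
      obtain ⟨a, ha, b, hb, rfl⟩ := Submodule.mem_sup.1 hq
      rw [mem_Tors] at hx hy
      rw [add_smul, hx a ha, hxy2, smul_neg, hy b hb]; simp
    subst hx0
    have : y = 0 := by simpa using hxy'
    subst this
    rfl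
  · rintro ⟨x, hx⟩
    rw [mem_Tors] at hx
    have hex : ∀ q : (J1 ⊔ J2 : Ideal R), ∃ a ∈ J1, (q : R) - a ∈ J2 := by
      rintro ⟨q, hq⟩
      obtain ⟨a, ha, b, hb, rfl⟩ := Submodule.mem_sup.1 hq
      exact ⟨a, ha, by simpa using hb⟩
    choose a ha1 ha2 using hex
    have hwd : ∀ q : (J1 ⊔ J2 : Ideal R), ∀ a' ∈ J1, (q : R) - a' ∈ J2 → a q • x = a' • x := by
      intro q a' h1 h2
      rw [← sub_eq_zero, ← sub_smul]
      refine hx _ ⟨sub_mem (ha1 q) h1, ?_⟩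
      have := sub_mem h2 (ha2 q)
      simpa using this
    let φ : (J1 ⊔ J2 : Ideal R) →ₗ[R] R ⧸ A :=
      { toFun := fun q => a q • x
        map_add' := by
          intro q q'
          rw [← add_smul]
          apply hwd
          · exact add_mem (ha1 q) (ha1 q')
          · have := add_mem (ha2 q) (ha2 q')
            convert this using 1
            simp; ring
        map_smul' := by
          intro r q
          rw [RingHom.id_apply, ← mul_smul]
          apply hwd
          · exact Ideal.mul_mem_left _ _ (ha1 q)
          · have := Ideal.mul_mem_left _ r (ha2 q)
            convert this using 1
            simp; ring }
    have hφ : ∀ q, φ q = a q • x := fun q => rfl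
    obtain ⟨c, hc⟩ := hE.2 φ
    have hc2 : c ∈ Tors J2 A := by
      rw [mem_Tors]
      intro j hj
      have := hc ⟨j, Ideal.mem_sup_right hj⟩
      rw [hφ, hwd _ 0 (zero_mem _) (by simpa using hj), zero_smul] at this
      exact this.symm
    have hc1 : x - c ∈ Tors J1 A := by
      rw [mem_Tors]
      intro j hj
      have := hc ⟨j, Ideal.mem_sup_left hj⟩
      rw [hφ, hwd _ j hj (by simp)] at this
      rw [smul_sub, this]; simp
    refine ⟨⟨⟨x - c, hc1⟩, ⟨c, hc2⟩⟩, ?_⟩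
    ext
    rw [hf]; simp

theorem PD_quot_inf {J1 J2 : Ideal R} {n : ℕ} (h1 : PD R (R ⧸ J1) n) (h2 : PD R (R ⧸ J2) n)
    (h3 : PD R (R ⧸ (J1 ⊔ J2)) (n+1)) : PD R (R ⧸ (J1 ⊓ J2)) n := by
  let f : (R ⧸ (J1 ⊓ J2)) →ₗ[R] (R ⧸ J1) × (R ⧸ J2) :=
    (Submodule.factor inf_le_left).prod (Submodule.factor inf_le_right)
  let g : ((R ⧸ J1) × (R ⧸ J2)) →ₗ[R] R ⧸ (J1 ⊔ J2) :=
    (Submodule.factor le_sup_left).coprod (-(Submodule.factor le_sup_right))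
  have hf : ∀ r : R, f (Submodule.Quotient.mk r) =
    (Submodule.Quotient.mk r, Submodule.Quotient.mk r) := fun r => rfl
  have hg : ∀ r s : R, g (Submodule.Quotient.mk r, Submodule.Quotient.mk s) =
    Submodule.Quotient.mk (r - s) := fun r s => by
      rw [sub_eq_add_neg]; rfl
  refine PD.x1 (f := f) (g := g) ?_ ?_ ?_ (h1.prod h2) h3
  · rw [injective_iff_map_eq_zero]
    intro x hx
    obtain ⟨x, rfl⟩ := Submodule.Quotient.mk_surjective _ x
    rw [hf, Prod.mk_eq_zero, Submodule.Quotient.mk_eq_zero, Submodule.Quotient.mk_eq_zero] at hx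
    rw [Submodule.Quotient.mk_eq_zero]
    exact hx
  · rintro ⟨x, y⟩
    obtain ⟨x, rfl⟩ := Submodule.Quotient.mk_surjective _ x
    obtain ⟨y, rfl⟩ := Submodule.Quotient.mk_surjective _ y
    rw [hg, Submodule.Quotient.mk_eq_zero]
    constructor
    · intro h
      obtain ⟨a, ha, b, hb, hab⟩ := Submodule.mem_sup.1 h
      refine ⟨Submodule.Quotient.mk (x - a), ?_⟩
      rw [hf, Prod.mk.injEq, Submodule.Quotient.eq, Submodule.Quotient.eq]
      constructor
      · simpa using ha
      · have : x - a - y = b := by linear_combination -hab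
        rwa [this]
    · rintro ⟨z, hz⟩
      obtain ⟨z, rfl⟩ := Submodule.Quotient.mk_surjective _ z
      rw [hf, Prod.mk.injEq, Submodule.Quotient.eq, Submodule.Quotient.eq] at hz
      have : x - y = -(z - x) + (z - y) := by ring
      rw [this]
      exact add_mem (Ideal.mem_sup_left (neg_mem hz.1)) (Ideal.mem_sup_right hz.2)
  · intro x
    obtain ⟨x, rfl⟩ := Submodule.Quotient.mk_surjective _ x
    refine ⟨(Submodule.Quotient.mk x, Submodule.Quotient.mk 0), ?_⟩
    rw [hg, sub_zero]

/-- the final short exact sequence -/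
theorem PD_final [IsDomain R] [DecompositionMonoid R] {f1 f2 f3 : R} (h0 : f1 ≠ 0)
    (h : IsRelPrime f1 f2) {Z : Ideal R} (hZ : ∀ x, x ∈ Z ↔ x * f3 ∈ Ideal.span {f1, f2})
    (hp : PD R (R ⧸ Z) 4) : PD R (R ⧸ Ideal.span {f1, f2, f3}) 5 := by
  have hle : Ideal.span {f1, f2} ≤ Ideal.span {f1, f2, f3} := by
    apply Ideal.span_mono
    intro x hx
    simp only [Set.mem_insert_iff, Set.mem_singleton_iff] at *
    tauto
  have hle2 : Z ≤ Submodule.comap (LinearMap.lsmul R R f3) (Ideal.span {f1, f2}) := by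
    intro x hx
    have := (hZ x).1 hx
    rw [mul_comm] at this
    exact this
  refine PD.x3 (f := Submodule.mapQ _ _ (LinearMap.lsmul R R f3) hle2)
    (g := Submodule.factor hle) ?_ ?_ (Submodule.factor_surjective _) hp
    ((PD.koszul h0 h).mono (by omega))
  · rw [injective_iff_map_eq_zero]
    intro x hx
    obtain ⟨x, rfl⟩ := Submodule.Quotient.mk_surjective _ x
    have hx' : f3 * x ∈ Ideal.span {f1, f2} := (Submodule.Quotient.mk_eq_zero _).1 hx
    rw [Submodule.Quotient.mk_eq_zero, hZ, mul_comm]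
    exact hx'
  · intro x
    obtain ⟨x, rfl⟩ := Submodule.Quotient.mk_surjective _ x
    constructor
    · intro hx
      have hx' : x ∈ Ideal.span {f1, f2, f3} := (Submodule.Quotient.mk_eq_zero _).1 hx
      have : ({f1, f2, f3} : Set R) = {f1, f2} ∪ {f3} := by
        ext y; simp; tauto
      rw [this, Ideal.span_union] at hx'
      obtain ⟨a, ha, b, hb, rfl⟩ := Submodule.mem_sup.1 hx'
      obtain ⟨y, rfl⟩ := Ideal.mem_span_singleton'.1 hb
      refine ⟨Submodule.Quotient.mk y, ?_⟩
      change Submodule.Quotient.mk (f3 * y) = _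
      rw [Submodule.Quotient.eq]
      have : f3 * y - (a + y * f3) = - a := by ring
      rw [this]
      exact neg_mem ha
    · rintro ⟨y, hy⟩
      obtain ⟨y, rfl⟩ := Submodule.Quotient.mk_surjective _ y
      rw [← hy]
      change Submodule.Quotient.mk (f3 * y) = _
      rw [Submodule.Quotient.mk_eq_zero]
      exact Ideal.mul_mem_right _ _ (Ideal.subset_span (by simp))

theorem PD_of_Tors [IsDomain R] [DecompositionMonoid R] {f1 f2 f3 : R} (h0 : f1 ≠ 0)
    (h : IsRelPrime f1 f2) {Z K : Ideal R} (hZ : ∀ x, x ∈ Z ↔ x * f3 ∈ Ideal.span {f1, f2})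
    (hK : ∀ x, x ∈ Z ↔ ∀ y ∈ K, y * x ∈ Ideal.span {f1, f2})
    (hp : PD R (Tors K (Ideal.span {f1, f2})) 3) : PD R (R ⧸ Z) 4 := by
  have hle : Ideal.span {f1, f2} ≤ Z := by
    intro x hx
    rw [hZ]; exact Ideal.mul_mem_right _ _ hx
  refine PD.x3 (f := (Tors K (Ideal.span {f1, f2})).subtype)
    (g := Submodule.factor hle) (Submodule.subtype_injective _) ?_
    (Submodule.factor_surjective _) hp ((PD.koszul h0 h).mono (by omega))
  intro x
  obtain ⟨x, rfl⟩ := Ideal.Quotient.mk_surjective x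
  have h3 : (Submodule.factor hle) (Ideal.Quotient.mk _ x) = 0 ↔ x ∈ Z :=
    Submodule.Quotient.mk_eq_zero _
  rw [h3, Submodule.coe_subtype, Subtype.range_coe, SetLike.mem_coe, hK]
  exact (mk_mem_Tors (J := K) (A := Ideal.span {f1, f2}) (x := x)).symm
end
end S19

namespace S19

section
variable {k : Type} [Field k] {N : ℕ}

/-- the split situation -/
structure Split (K : Ideal (MvPolynomial (Fin N) k)) : Prop where
  out : ∃ (UA UB : Submodule k (Fin N → k)) (m n : ℕ)
    (VA : Fin m → Submodule k (Fin N → k)) (VB : Fin n → Submodule k (Fin N → k))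
    (α β : MvPolynomial (Fin N) k), Disjoint UA UB ∧ Module.finrank k UA ≤ 5 ∧
    Module.finrank k UB ≤ 4 ∧ (∀ i, Module.finrank k (VA i) = 2) ∧
    (∀ i, Module.finrank k (VB i) = 2) ∧ (∀ i, VA i ≤ UA) ∧ (∀ i, VB i ≤ UB) ∧
    α ∈ SU UA ∧ β ∈ SU UA ∧ α ≠ 0 ∧ β ≠ 0 ∧ IsRelPrime α β ∧
    ⨅ i, PV (VA i) = Ideal.span {α, β} ∧ K = (⨅ i, PV (VA i)) ⊓ (⨅ i, PV (VB i))

theorem span_pair_eq {R : Type} [CommRing R] (a b : R) :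
    Ideal.span {a, b} = Ideal.span {a} ⊔ Ideal.span {b} := by
  rw [← Ideal.span_union]; rfl

theorem Ext_singleton {U : Submodule k (Fin N → k)} {a} (h : a ∈ SU U) : Ext U (Ideal.span {a}) := by
  refine ⟨_, ?_, rfl⟩
  rintro x rfl; exact h

theorem Ext_pair {U : Submodule k (Fin N → k)} {a b} (h : a ∈ SU U) (h' : b ∈ SU U) :
    Ext U (Ideal.span {a, b}) := by
  refine ⟨_, ?_, rfl⟩
  rintro x (rfl | rfl)
  · exact h
  · exact h'

theorem relPrime_disjoint {UA UB : Submodule k (Fin N → k)} (h : Disjoint UA UB)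
    {a b : MvPolynomial (Fin N) k} (ha : a ∈ SU UA) (hb : b ∈ SU UB) (ha0 : a ≠ 0) (hb0 : b ≠ 0) :
    IsRelPrime a b := by
  intro d hda hdb
  have h1 := (FL h (Ext_singleton hb) ha (one_mem _) ha0 isRelPrime_one_right).1
  obtain ⟨c, rfl⟩ := hda
  obtain ⟨e, rfl⟩ := hdb
  have h2 := h1 e (Ideal.mem_span_singleton.2 ⟨c, by ring⟩)
  obtain ⟨x, hx⟩ := Ideal.mem_span_singleton.1 h2
  have he : e ≠ 0 := right_ne_zero_of_mul hb0
  refine IsUnit.of_mul_eq_one x ?_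
  apply mul_left_cancel₀ he
  linear_combination -hx

theorem Split.pdK {K : Ideal (MvPolynomial (Fin N) k)} (h : Split K) :
    PD (MvPolynomial (Fin N) k) (MvPolynomial (Fin N) k ⧸ K) 4 := by
  obtain ⟨UA, UB, m, n, VA, VB, α, β, hdis, hA5, hB4, hVA, hVB, hVAU, hVBU, hα, hβ, hα0, hβ0, hr,
    hJ1, rfl⟩ := h.out
  have hJ2 : Ext UB (⨅ i, PV (VB i)) := Ext.iInf fun i => Ext_PV (hVBU i)
  have h2 : PD (MvPolynomial (Fin N) k) (MvPolynomial (Fin N) k ⧸ ⨅ i, PV (VB i)) 3 :=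
    PK hB4 (by norm_num) hVB hVBU
  obtain ⟨r1, r2⟩ := FL hdis hJ2 hα hβ hα0 hr
  apply PD_quot_inf
  · rw [hJ1]
    exact (PD.koszul hα0 hr).mono (by norm_num)
  · exact h2.mono (by norm_num)
  · have := PD.quot_sup r2 (PD.quot_sup r1 h2)
    refine PD.quot_eq ?_ this
    rw [hJ1, span_pair_eq, sup_assoc, sup_comm]

theorem Split.pdTors [Infinite k] {K : Ideal (MvPolynomial (Fin N) k)} (h : Split K)
    {f1 f2 : MvPolynomial (Fin N) k} (h0 : f1 ≠ 0) (hr : IsRelPrime f1 f2)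
    (h1 : f1 ∈ K) (h2 : f2 ∈ K) :
    PD (MvPolynomial (Fin N) k) (Tors K (Ideal.span {f1, f2})) 3 := by
  obtain ⟨UA, UB, m, n, VA, VB, α, β, hdis, hA5, hB4, hVA, hVB, hVAU, hVBU, hα, hβ, hα0, hβ0, hαβ,
    hJ1, rfl⟩ := h.out
  obtain ⟨b1, hb1, hb1', -, hb10⟩ := avoid_prod hVB hVBU (g := 1) one_ne_zero
  obtain ⟨b2, hb2, hb2', hb12, hb20⟩ := avoid_prod hVB hVBU hb10
  have hαJ : α ∈ ⨅ i, PV (VA i) := by rw [hJ1]; exact Ideal.subset_span (by simp)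
  have hβJ : β ∈ ⨅ i, PV (VA i) := by rw [hJ1]; exact Ideal.subset_span (by simp)
  have hg10 : α * b1 ≠ 0 := mul_ne_zero hα0 hb10
  obtain ⟨sA, -, hsA, hsAr, -⟩ := avoid_prod hVA hVAU (mul_ne_zero h0 hg10)
  obtain ⟨sB, -, hsB, hsBr, -⟩ := avoid_prod hVB hVBU (mul_ne_zero h0 hg10)
  have hs : IsRelPrime (f1 * (α * b1)) (sA * sB) := hsAr.mul_right hsBr
  have e1 : IsRelPrime α b1 := relPrime_disjoint hdis hα hb1 hα0 hb10
  have e2 : IsRelPrime α b2 := relPrime_disjoint hdis hα hb2 hα0 hb20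
  have e3 : IsRelPrime β b1 := relPrime_disjoint hdis hβ hb1 hβ0 hb10
  have e4 : IsRelPrime β b2 := relPrime_disjoint hdis hβ hb2 hβ0 hb20
  have hg : IsRelPrime (α * b1) (β * b2) :=
    (hαβ.mul_right e2).mul_left (e3.symm.mul_right hb12)
  have hg1A : α * b1 ∈ ⨅ i, PV (VA i) := Ideal.mul_mem_right _ _ hαJ
  have hg1B : α * b1 ∈ ⨅ i, PV (VB i) := Ideal.mul_mem_left _ _ hb1'
  have hg2A : β * b2 ∈ ⨅ i, PV (VA i) := Ideal.mul_mem_right _ _ hβJ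
  have hg2B : β * b2 ∈ ⨅ i, PV (VB i) := Ideal.mul_mem_left _ _ hb2'
  obtain ⟨e⟩ := Tors_exchange2 (J := (⨅ i, PV (VA i)) ⊓ ⨅ i, PV (VB i)) (s := sA * sB) hg hr
    hs.of_mul_left_right.symm hs.of_mul_left_left.symm ⟨hg1A, hg1B⟩ ⟨hg2A, hg2B⟩ h1 h2
    ⟨Ideal.mul_mem_right _ _ hsA, Ideal.mul_mem_left _ _ hsB⟩
  refine PD.of_equiv ?_ e
  refine PD_Tors_split ?_ (PM hA5 hVA hVAU hg10 hg hg1A hg2A)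
    (PM (hB4.trans (by norm_num)) hVB hVBU hg10 hg hg1B hg2B)
  have mA : ∀ x ∈ ⨅ i, PV (VA i), x ∈ (⨅ i, PV (VA i)) ⊔ ⨅ i, PV (VB i) :=
    fun x hx => Ideal.mem_sup_left hx
  have mB : ∀ x ∈ ⨅ i, PV (VB i), x ∈ (⨅ i, PV (VA i)) ⊔ ⨅ i, PV (VB i) :=
    fun x hx => Ideal.mem_sup_right hx
  set Q := (⨅ i, PV (VA i)) ⊔ ⨅ i, PV (VB i)
  -- the four pieces
  have p1 : EP Q (MvPolynomial (Fin N) k ⧸ Ideal.span {α, β}) := by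
    obtain ⟨r1, r2⟩ := FL hdis.symm (Ext_pair hα hβ) hb1 hb2 hb10 hb12
    exact EP.of_regular (mB _ hb1') (mB _ hb2') r1 r2
  have p2 : EP Q (MvPolynomial (Fin N) k ⧸ Ideal.span {b1, b2}) := by
    obtain ⟨r1, r2⟩ := FL hdis (Ext_pair hb1 hb2) hα hβ hα0 hαβ
    exact EP.of_regular (mA _ hαJ) (mA _ hβJ) r1 r2
  have p3 : EP Q (MvPolynomial (Fin N) k ⧸ Ideal.span {α, b2}) := by
    obtain ⟨-, r1⟩ := FL hdis (Ext_singleton hb2) hα hβ hα0 hαβ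
    obtain ⟨-, r2⟩ := FL hdis.symm (Ext_pair hα hβ) hb2 hb1 hb20 hb12.symm
    have x1 : Ideal.span {α, b2} = Ideal.span {b2} ⊔ Ideal.span {α} := by
      rw [span_pair_eq, sup_comm]
    have x2 : Ideal.span {α, b2} ⊔ Ideal.span {β} = Ideal.span {α, β} ⊔ Ideal.span {b2} := by
      rw [span_pair_eq, span_pair_eq, sup_right_comm]
    refine EP.of_regular (mA _ hβJ) (mB _ hb1') ?_ ?_
    · rw [x1]; exact r1
    · rw [x2]; exact r2
  have p4 : EP Q (MvPolynomial (Fin N) k ⧸ Ideal.span {β, b1}) := by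
    obtain ⟨-, r1⟩ := FL hdis (Ext_singleton hb1) hβ hα hβ0 hαβ.symm
    obtain ⟨-, r2⟩ := FL hdis.symm (Ext_pair hα hβ) hb1 hb2 hb10 hb12
    have x1 : Ideal.span {β, b1} = Ideal.span {b1} ⊔ Ideal.span {β} := by
      rw [span_pair_eq, sup_comm]
    have x2 : Ideal.span {β, b1} ⊔ Ideal.span {α} = Ideal.span {α, β} ⊔ Ideal.span {b1} := by
      rw [span_pair_eq, span_pair_eq, sup_right_comm, sup_comm (Ideal.span {β})]
    refine EP.of_regular (mA _ hαJ) (mB _ hb2') ?_ ?_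
    · rw [x1]; exact r1
    · rw [x2]; exact r2
  refine EP.quot_mul hα0 (hαβ.mul_right e2) ?_ ?_
  · rw [Set.pair_comm]
    refine EP.quot_mul hβ0 e3 ?_ p4
    rw [Set.pair_comm]; exact p2
  · rw [Set.pair_comm]
    refine EP.quot_mul hβ0 hαβ.symm ?_ ?_
    · rw [Set.pair_comm]; exact p3
    · rw [Set.pair_comm]; exact p1
end
end S19

namespace S19

section
variable {k : Type} [Field k] {N : ℕ}

theorem hom_factor {a h : MvPolynomial (Fin N) k} {e : ℕ} (ha : a.IsHomogeneous 1) (ha0 : a ≠ 0)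
    (hh : (a * h).IsHomogeneous (e + 1)) : h.IsHomogeneous e := by
  have key : ∀ n, homogeneousComponent (n + 1) (a * h) = a * homogeneousComponent n h := by
    intro n
    conv_lhs => rw [← sum_homogeneousComponent h, Finset.mul_sum, map_sum]
    have h1 : ∀ i, homogeneousComponent (n + 1) (a * homogeneousComponent i h)
        = if n = i then a * homogeneousComponent i h else 0 := by
      intro i
      have h2 : (a * homogeneousComponent i h).IsHomogeneous (i + 1) := by
        have := ha.mul (homogeneousComponent_isHomogeneous i h)
        rwa [add_comm] at this
      rw [homogeneousComponent_of_mem ((mem_homogeneousSubmodule _ _).2 h2)]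
      simp [eq_comm]
    simp only [h1]
    rw [Finset.sum_ite_eq]
    split_ifs with h3
    · rfl
    · rw [homogeneousComponent_eq_zero, mul_zero]
      simp at h3; omega
  have hz : ∀ n, n ≠ e → homogeneousComponent n h = 0 := by
    intro n hn
    have h1 := key n
    rw [homogeneousComponent_of_mem ((mem_homogeneousSubmodule _ _).2 hh), if_neg (by omega)] at h1
    exact (mul_eq_zero.1 h1.symm).resolve_left ha0
  have : h = homogeneousComponent e h := by
    conv_lhs => rw [← sum_homogeneousComponent h]
    rw [Finset.sum_eq_single e]
    · intro i _ hi; exact hz i hi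
    · intro he
      rw [homogeneousComponent_eq_zero]
      simp at he; omega
  rw [this]
  exact homogeneousComponent_isHomogeneous e h

theorem exCompl {C U : Submodule k (Fin N → k)} (h : Disjoint C U) :
    ∃ H, U ≤ H ∧ IsCompl C H := by
  obtain ⟨Q, hQ⟩ := (C ⊔ U).exists_isCompl
  refine ⟨U ⊔ Q, le_sup_left, ?_, ?_⟩
  · exact h.disjoint_sup_right_of_disjoint_sup_left hQ.disjoint
  · rw [codisjoint_iff, ← sup_assoc]; exact hQ.sup_eq_top

theorem disj_span {c : Fin N → k} {U : Submodule k (Fin N → k)} (h : c ∉ U) :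
    Disjoint (Submodule.span k {c}) U := by
  rw [disjoint_comm]
  exact (Submodule.disjoint_span_singleton' (by rintro rfl; exact h (zero_mem _))).2 h

theorem PV_span_singleton (c : Fin N → k) :
    PV (Submodule.span k {c}) = Ideal.span {lin c} := by
  apply le_antisymm
  · rw [PV, Ideal.span_le]
    rintro _ ⟨v, hv, rfl⟩
    obtain ⟨r, rfl⟩ := Submodule.mem_span_singleton.1 hv
    rw [map_smul, smul_eq_C_mul]
    exact Ideal.mul_mem_left _ _ (Ideal.mem_span_singleton_self _)
  · rw [Ideal.span_singleton_le_iff_mem]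
    exact lin_mem (Submodule.mem_span_singleton_self c)

theorem PV_span_pair (c d : Fin N → k) :
    PV (Submodule.span k {c, d}) = Ideal.span {lin c, lin d} := by
  apply le_antisymm
  · rw [PV, Ideal.span_le]
    rintro _ ⟨v, hv, rfl⟩
    obtain ⟨r, s, rfl⟩ := Submodule.mem_span_pair.1 hv
    rw [map_add, map_smul, map_smul, smul_eq_C_mul, smul_eq_C_mul]
    exact Ideal.mem_span_pair.2 ⟨_, _, rfl⟩
  · rw [Ideal.span_le]
    rintro _ (rfl | rfl)
    · exact lin_mem (Submodule.subset_span (by simp))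
    · exact lin_mem (Submodule.subset_span (by simp))

/-- division -/
theorem divis {ι : Type} {W : ι → Submodule k (Fin N → k)} {U H : Submodule k (Fin N → k)}
    {c : Fin N → k} {T : (Fin N → k) →ₗ[k] (Fin N → k)} (hW : ∀ i, W i ≤ U) (hUH : U ≤ H)
    (hc : IsCompl (Submodule.span k {c}) H) (hc0 : c ≠ 0) (hT1 : T c = 0) (hT2 : ∀ v ∈ H, T v = v)
    {g : MvPolynomial (Fin N) k} {e : ℕ} (hg : g.IsHomogeneous (e + 1)) (hgW : ∀ i, g ∈ PV (W i)) :
    (∀ i, sub T g ∈ PV (W i)) ∧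
    ∃ h : MvPolynomial (Fin N) k, h.IsHomogeneous e ∧ (∀ i, h ∈ PV (W i)) ∧
      g - sub T g = lin c * h := by
  have h0 : ∀ i, sub T g ∈ PV (W i) := fun i =>
    subT_mem (fun v hv => by rw [hT2 v (hUH (hW i hv))]; exact hv) (hgW i)
  refine ⟨h0, ?_⟩
  have h1 : g - sub T g ∈ PV (Submodule.span k {c}) := by
    apply sub_sub_mem
    intro v
    have : v ∈ Submodule.span k {c} ⊔ H := by rw [hc.sup_eq_top]; trivial
    obtain ⟨a, ha, b, hb, rfl⟩ := Submodule.mem_sup.1 this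
    obtain ⟨r, rfl⟩ := Submodule.mem_span_singleton.1 ha
    rw [map_add, map_smul, hT1, hT2 b hb]
    simpa using ha
  rw [PV_span_singleton, Ideal.mem_span_singleton] at h1
  obtain ⟨h, hh⟩ := h1
  have hl0 : lin c ≠ 0 := fun h => hc0 (lin_eq_zero.1 h)
  refine ⟨h, ?_, ?_, hh⟩
  · apply hom_factor (lin_hom c) hl0
    rw [← hh]
    exact (hg.sub (sub_hom T hg))
  · intro i
    have h2 : lin c * h ∈ PV (W i) := by rw [← hh]; exact sub_mem (hgW i) (h0 i)
    refine ((PV_prime (W i)).mem_or_mem h2).resolve_left fun h3 => hc0 ?_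
    have h4 : c ∈ H := hUH (hW i (lin_mem_PV.1 h3))
    have h5 := hc.disjoint.le_bot (x := c) ⟨Submodule.mem_span_singleton_self c, h4⟩
    simpa using h5

theorem span_pair_of {V : Submodule k (Fin N → k)} (hV : Module.finrank k V = 2) {c l : Fin N → k}
    (hc : c ∈ V) (hl : l ∈ V) (hc0 : c ≠ 0) (hlc : l ∉ Submodule.span k {c}) :
    V = Submodule.span k {c, l} := by
  symm
  apply Submodule.eq_of_le_of_finrank_eq
  · rw [Submodule.span_le]
    rintro _ (rfl | rfl)
    · exact hc
    · exact hl
  · rw [hV]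
    have : LinearIndependent k ![c, l] := by
      rw [LinearIndependent.pair_iff' hc0]
      intro a ha
      exact hlc (Submodule.mem_span_singleton.2 ⟨a, ha⟩)
    have h := finrank_span_eq_card this
    rw [Matrix.range_cons_cons_empty] at h
    simpa using h

theorem ex_not_span {V : Submodule k (Fin N → k)} (hV : Module.finrank k V = 2) (c : Fin N → k) :
    ∃ l ∈ V, l ∉ Submodule.span k {c} := by
  by_contra hcon
  push Not at hcon
  have h1 : V ≤ Submodule.span k {c} := hcon
  have h2 := Submodule.finrank_mono h1
  have h3 := finrank_span_le_card (R := k) ({c} : Set (Fin N → k))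
  simp at h3
  omega

/-- Lemma 0 -/
theorem lemma0 {ι : Type} {W : ι → Submodule k (Fin N → k)} {U V : Submodule k (Fin N → k)}
    (hW : ∀ i, W i ≤ U) (hV : Module.finrank k V = 2) (hVU : ¬ V ≤ U) (e : ℕ)
    (hno : ∀ h : MvPolynomial (Fin N) k, h.IsHomogeneous e → (∀ i, h ∈ PV (W i)) → h = 0) :
    ∃ l ∈ V, l ≠ 0 ∧ ∀ g : MvPolynomial (Fin N) k, g.IsHomogeneous (e + 1) →
      (∀ i, g ∈ PV (W i)) → g ∈ PV V → lin l ∣ g := by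
  obtain ⟨c, hcV, hcU⟩ := Set.not_subset.1 hVU
  have hc0 : c ≠ 0 := by rintro rfl; exact hcU (zero_mem _)
  obtain ⟨H, hUH, hH⟩ := exCompl (disj_span hcU)
  obtain ⟨x, hxV, hx⟩ := ex_not_span hV c
  have hxx : x ∈ Submodule.span k {c} ⊔ H := by rw [hH.sup_eq_top]; trivial
  obtain ⟨a, ha, l, hlH, rfl⟩ := Submodule.mem_sup.1 hxx
  have hlV : l ∈ V := by
    obtain ⟨r, rfl⟩ := Submodule.mem_span_singleton.1 ha
    exact (Submodule.add_mem_iff_right _ (V.smul_mem r hcV)).1 hxV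
  have hl : l ∉ Submodule.span k {c} := fun h => hx (add_mem ha h)
  obtain ⟨T, hT1, hT2⟩ := exScale hH 0
  have hTc : T c = 0 := by simpa using hT1 c (Submodule.mem_span_singleton_self c)
  refine ⟨l, hlV, by rintro rfl; exact hl (zero_mem _), fun g hg hgW hgV => ?_⟩
  obtain ⟨-, h, hh, hhW, heq⟩ := divis hW hUH hH hc0 hTc hT2 hg hgW
  rw [hno h hh hhW, mul_zero, sub_eq_zero] at heq
  rw [heq, ← Ideal.mem_span_singleton, ← PV_span_singleton]
  apply subT_mem _ hgV
  intro v hv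
  rw [span_pair_of hV hcV hlV hc0 hl] at hv
  obtain ⟨r, s, rfl⟩ := Submodule.mem_span_pair.1 hv
  rw [map_add, map_smul, map_smul, hTc, hT2 l hlH]
  simpa using Submodule.smul_mem _ _ (Submodule.mem_span_singleton_self l)

/-- decomposition -/
theorem lemmaD {ι : Type} {W : ι → Submodule k (Fin N → k)} {U V : Submodule k (Fin N → k)}
    (hW : ∀ i, W i ≤ U) (hV : Module.finrank k V = 2) (hVU : Disjoint V U) {e : ℕ}
    {g : MvPolynomial (Fin N) k} (hg : g.IsHomogeneous (e + 1))
    (hgW : ∀ i, g ∈ PV (W i)) (hgV : g ∈ PV V) :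
    ∃ c ∈ V, ∃ l ∈ V, ∃ h h' : MvPolynomial (Fin N) k, h.IsHomogeneous e ∧ h'.IsHomogeneous e ∧
      (∀ i, h ∈ PV (W i)) ∧ (∀ i, h' ∈ PV (W i)) ∧ g = lin c * h + lin l * h' := by
  obtain ⟨c, hcV, hcc⟩ := ex_not_span hV 0
  have hc0 : c ≠ 0 := by rintro rfl; exact hcc (zero_mem _)
  obtain ⟨l, hlV, hl⟩ := ex_not_span hV c
  have hl0 : l ≠ 0 := by rintro rfl; exact hl (zero_mem _)
  have hVe := span_pair_of hV hcV hlV hc0 hl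
  have hcU : c ∉ U ⊔ Submodule.span k {l} := by
    intro h
    obtain ⟨u, hu, y, hy, hc⟩ := Submodule.mem_sup.1 h
    obtain ⟨r, rfl⟩ := Submodule.mem_span_singleton.1 hy
    have hu2 : u ∈ V := (Submodule.add_mem_iff_left _ (V.smul_mem r hlV)).1 (hc ▸ hcV)
    have hu0 : u = 0 := by simpa using hVU.le_bot (x := u) ⟨hu2, hu⟩
    rw [hu0, zero_add] at hc
    have hr : r ≠ 0 := by rintro rfl; exact hc0 (by simp [← hc])
    apply hl
    refine Submodule.mem_span_singleton.2 ⟨r⁻¹, ?_⟩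
    rw [← hc, smul_smul, inv_mul_cancel₀ hr, one_smul]
  obtain ⟨H, hUH, hH⟩ := exCompl (disj_span hcU)
  obtain ⟨T, hT1, hT2⟩ := exScale hH 0
  have hTc : T c = 0 := by simpa using hT1 c (Submodule.mem_span_singleton_self c)
  obtain ⟨hs, h, hh, hhW, heq⟩ := divis hW (le_sup_left.trans hUH) hH hc0 hTc hT2 hg hgW
  have hlH : l ∈ H := hUH (Submodule.mem_sup_right (Submodule.mem_span_singleton_self l))
  have hs2 : sub T g ∈ PV (Submodule.span k {l}) := by
    apply subT_mem _ hgV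
    intro v hv
    rw [hVe] at hv
    obtain ⟨r, s, rfl⟩ := Submodule.mem_span_pair.1 hv
    rw [map_add, map_smul, map_smul, hTc, hT2 l hlH]
    simpa using Submodule.smul_mem _ _ (Submodule.mem_span_singleton_self l)
  rw [PV_span_singleton, Ideal.mem_span_singleton] at hs2
  obtain ⟨h', hh'⟩ := hs2
  refine ⟨c, hcV, l, hlV, h, h', hh, ?_, hhW, ?_, ?_⟩
  · apply hom_factor (lin_hom l) (fun h => hl0 (lin_eq_zero.1 h))
    rw [← hh']
    exact sub_hom T hg
  · intro i
    have h2 := hs i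
    rw [hh'] at h2
    refine ((PV_prime (W i)).mem_or_mem h2).resolve_left fun h3 => hl0 ?_
    simpa using hVU.le_bot (x := l) ⟨hlV, hW i (lin_mem_PV.1 h3)⟩
  · rw [← heq, ← hh']; ring

/-- multilinearity of cubics -/
theorem cubic_scale {V1 V2 V3 : Submodule k (Fin N → k)} (h1 : Module.finrank k V1 = 2)
    (h2 : Module.finrank k V2 = 2) (hd1 : Disjoint V1 (V2 ⊔ V3)) (hd2 : Disjoint V2 V3)
    {f : MvPolynomial (Fin N) k} (hf : f.IsHomogeneous 3) (hf1 : f ∈ PV V1) (hf2 : f ∈ PV V2)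
    (hf3 : f ∈ PV V3) {T : (Fin N → k) →ₗ[k] (Fin N → k)} {ν : k}
    (hT1 : ∀ v ∈ V1, T v = ν • v) (hT2 : ∀ v ∈ V2 ⊔ V3, T v = v) : sub T f = ν • f := by
  have lin3 : ∀ m : MvPolynomial (Fin N) k, m.IsHomogeneous 1 → m ∈ PV V3 → sub T m = m := by
    intro m hm hm3
    obtain ⟨v, rfl⟩ := exists_lin hm
    rw [sub_lin, hT2 v (Submodule.mem_sup_right (lin_mem_PV.1 hm3))]
  have quad : ∀ q : MvPolynomial (Fin N) k, q.IsHomogeneous 2 → q ∈ PV V2 → q ∈ PV V3 →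
      sub T q = q := by
    intro q hq hq2 hq3
    obtain ⟨c, hc, l, hl, m, m', hm, hm', hmW, hmW', rfl⟩ := lemmaD (ι := Unit) (W := fun _ => V3)
      (U := V3) (fun _ => le_rfl) h2 hd2 hq (fun _ => hq3) hq2
    rw [map_add, map_mul, map_mul, sub_lin, sub_lin, lin3 m hm (hmW ()), lin3 m' hm' (hmW' ()),
      hT2 c (Submodule.mem_sup_left hc), hT2 l (Submodule.mem_sup_left hl)]
  obtain ⟨c, hc, l, hl, m, m', hm, hm', hmW, hmW', rfl⟩ := lemmaD (ι := Bool)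
    (W := fun b => if b then V2 else V3) (U := V2 ⊔ V3)
    (by intro b; cases b <;> simp) h1 hd1 hf (by intro b; cases b <;> simp [hf2, hf3]) hf1
  rw [map_add, map_mul, map_mul, sub_lin, sub_lin, hT1 c hc, hT1 l hl,
    quad m hm (by simpa using hmW true) (by simpa using hmW false),
    quad m' hm' (by simpa using hmW' true) (by simpa using hmW' false), map_smul, map_smul,
    smul_add, smul_mul_assoc, smul_mul_assoc]

theorem lin_not_unit {l : Fin N → k} (hl : l ≠ 0) : ¬ IsUnit (lin l) := by
  intro h
  have := (PV_prime (Submodule.span k {l})).ne_top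
  exact this (Ideal.eq_top_of_isUnit_mem _ (lin_mem (Submodule.mem_span_singleton_self l)) h)

/-- Lemma 1 -/
theorem lemma1 {V1 V2 V3 V4 : Submodule k (Fin N → k)} (h4 : Module.finrank k V4 = 2)
    {f1 f2 : MvPolynomial (Fin N) k} (hf1 : f1.IsHomogeneous 3) (hf2 : f2.IsHomogeneous 3)
    (hr : IsRelPrime f1 f2)
    (hfV : ∀ f, f = f1 ∨ f = f2 → f ∈ PV V1 ∧ f ∈ PV V2 ∧ f ∈ PV V3 ∧ f ∈ PV V4)
    (hn : ¬ V4 ≤ V1 ⊔ V2 ⊔ V3) :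
    ∃ q : MvPolynomial (Fin N) k, q.IsHomogeneous 2 ∧ q ≠ 0 ∧ q ∈ PV V1 ∧ q ∈ PV V2 ∧ q ∈ PV V3 := by
  by_contra hcon
  obtain ⟨l, hl, hl0, hdiv⟩ := lemma0 (ι := Fin 3) (W := ![V1, V2, V3]) (U := V1 ⊔ V2 ⊔ V3)
    (by
      intro i; fin_cases i
      · exact le_sup_left.trans le_sup_left
      · exact le_sup_right.trans le_sup_left
      · exact le_sup_right) h4 hn 2 (by
    intro h hh hW
    by_contra h0
    exact hcon ⟨h, hh, h0, hW 0, hW 1, hW 2⟩)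
  have key : ∀ f, f = f1 ∨ f = f2 → f.IsHomogeneous 3 → lin l ∣ f := by
    intro f hf hh
    obtain ⟨a, b, c, d⟩ := hfV f hf
    refine hdiv f hh (fun i => ?_) d
    fin_cases i
    · exact a
    · exact b
    · exact c
  exact lin_not_unit hl0 (hr (key f1 (Or.inl rfl) hf1) (key f2 (Or.inr rfl) hf2))

/-- Lemma 2 -/
theorem lemma2 {V1 V2 V3 : Submodule k (Fin N → k)} (h3 : Module.finrank k V3 = 2)
    (h12 : Disjoint V1 V2) (h13 : Disjoint V1 V3) (h23 : Disjoint V2 V3)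
    (hq : ∃ q : MvPolynomial (Fin N) k, q.IsHomogeneous 2 ∧ q ≠ 0 ∧ q ∈ PV V1 ∧ q ∈ PV V2 ∧ q ∈ PV V3) :
    V3 ≤ V1 ⊔ V2 := by
  obtain ⟨q, hq, hq0, hq1, hq2, hq3⟩ := hq
  by_contra hn
  obtain ⟨l, hl, hl0, hdiv⟩ := lemma0 (ι := Bool) (W := fun b => if b then V1 else V2)
    (U := V1 ⊔ V2) (by intro b; cases b <;> simp) h3 hn 1 (by
      intro h hh hW
      obtain ⟨v, rfl⟩ := exists_lin hh
      have a1 : v ∈ V1 := lin_mem_PV.1 (by simpa using hW true)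
      have a2 : v ∈ V2 := lin_mem_PV.1 (by simpa using hW false)
      have : v = 0 := by simpa using h12.le_bot (x := v) ⟨a1, a2⟩
      rw [this, map_zero])
  obtain ⟨m, rfl⟩ := hdiv q hq (by intro b; cases b <;> simp [hq1, hq2]) hq3
  have hm := hom_factor (lin_hom l) (fun h => hl0 (lin_eq_zero.1 h)) hq
  obtain ⟨v, rfl⟩ := exists_lin hm
  have a1 : v ∈ V1 := by
    refine lin_mem_PV.1 (((PV_prime V1).mem_or_mem hq1).resolve_left fun h => hl0 ?_)
    simpa using h13.le_bot (x := l) ⟨lin_mem_PV.1 h, hl⟩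
  have a2 : v ∈ V2 := by
    refine lin_mem_PV.1 (((PV_prime V2).mem_or_mem hq2).resolve_left fun h => hl0 ?_)
    simpa using h23.le_bot (x := l) ⟨lin_mem_PV.1 h, hl⟩
  have : v = 0 := by simpa using h12.le_bot (x := v) ⟨a1, a2⟩
  rw [this, map_zero, mul_zero] at hq0
  exact hq0 rfl

end
end S19

namespace S19

section
variable {k : Type} [Field k] {N : ℕ}

theorem torus [Infinite k] {V1 V2 V3 V4 : Submodule k (Fin N → k)} (h1 : Module.finrank k V1 = 2)
    (h2 : Module.finrank k V2 = 2) (h4 : Module.finrank k V4 = 2)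
    (hd1 : Disjoint V1 (V2 ⊔ V3)) (hd2 : Disjoint V2 V3)
    {f1 f2 : MvPolynomial (Fin N) k} (hf1 : f1.IsHomogeneous 3) (hf2 : f2.IsHomogeneous 3)
    (hht : (Ideal.span {f1, f2}).height = 2)
    (hfV : ∀ f, f = f1 ∨ f = f2 → f ∈ PV V1 ∧ f ∈ PV V2 ∧ f ∈ PV V3 ∧ f ∈ PV V4)
    {a b : Fin N → k} (ha : a ∈ V1) (hb : b ∈ V2 ⊔ V3) (hab : a + b ∈ V4) : a ∈ V4 := by
  obtain ⟨H, hUH, hH⟩ := exCompl hd1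
  choose T hT1 hT2 using fun ν : k => exScale hH ν
  have hmin : ∀ ν : {x : k // x ≠ 0}, PV (V4.map (T ν)) ∈ (Ideal.span {f1, f2}).minimalPrimes := by
    rintro ⟨ν, hν⟩
    have := PV_prime (V4.map (T ν))
    apply Ideal.mem_minimalPrimes_of_height_le
    · have key : ∀ f, f = f1 ∨ f = f2 → f.IsHomogeneous 3 → f ∈ PV (V4.map (T ν)) := by
        intro f hf hh
        obtain ⟨q1, q2, q3, q4⟩ := hfV f hf
        have e1 := cubic_scale h1 h2 hd1 hd2 hh q1 q2 q3 (hT1 ν) (fun v hv => hT2 ν v (hUH hv))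
        have e2 : sub (T ν) f ∈ PV (V4.map (T ν)) :=
          subT_mem (fun v hv => Submodule.mem_map_of_mem hv) q4
        rw [e1, smul_eq_C_mul] at e2
        have e3 := Ideal.mul_mem_left _ (C ν⁻¹) e2
        rwa [← mul_assoc, ← C_mul, inv_mul_cancel₀ hν, C_1, one_mul] at e3
      rw [Ideal.span_le]
      rintro x (rfl | rfl)
      · exact key _ (Or.inl rfl) hf1
      · exact key _ (Or.inr rfl) hf2
    · refine (height_PV_le _).trans ?_
      rw [hht]
      have := Submodule.finrank_map_le (T ν) V4
      rw [h4] at this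
      exact_mod_cast this
  have hfin := Ideal.finite_minimalPrimes_of_isNoetherianRing _ (Ideal.span {f1, f2})
  have : Infinite {x : k // x ≠ 0} := by
    have := (Set.finite_singleton (0 : k)).infinite_compl
    exact this.to_subtype
  have : Finite ((Ideal.span {f1, f2}).minimalPrimes) := hfin
  obtain ⟨⟨ν, hν⟩, ⟨μ, hμ⟩, hne, heq⟩ := Finite.exists_ne_map_eq_of_infinite
    (fun ν : {x : k // x ≠ 0} =>
      (⟨_, hmin ν⟩ : ((Ideal.span {f1, f2}).minimalPrimes : Set _)))
  have heq2 : V4.map (T ν) = V4.map (T μ) := PV_inj (Subtype.ext_iff.1 heq)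
  have hne2 : ν ≠ μ := fun h => hne (Subtype.ext h)
  have m1 : T ν (a + b) ∈ V4.map (T μ) := heq2 ▸ Submodule.mem_map_of_mem hab
  obtain ⟨w, hw, hwe⟩ := m1
  have hwt : w ∈ V1 ⊔ H := by rw [hH.sup_eq_top]; trivial
  obtain ⟨a', ha', b', hb', rfl⟩ := Submodule.mem_sup.1 hwt
  rw [map_add, map_add, hT1 ν a ha, hT2 ν b (hUH hb), hT1 μ a' ha', hT2 μ b' hb'] at hwe
  have hz : μ • a' - ν • a = b - b' := by rw [sub_eq_sub_iff_add_eq_add, hwe, add_comm]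
  have hz1 : μ • a' - ν • a = 0 := by
    have := hH.disjoint.le_bot (x := μ • a' - ν • a)
      ⟨sub_mem (V1.smul_mem _ ha') (V1.smul_mem _ ha), by
        rw [hz]; exact sub_mem (hUH hb) hb'⟩
    simpa using this
  have hz2 : b = b' := by rw [hz1] at hz; exact (sub_eq_zero.1 hz.symm)
  subst hz2
  have e1 : a' - a ∈ V4 := by simpa using sub_mem hw hab
  have e2 : μ • (a' - a) = (ν - μ) • a := by
    rw [smul_sub, sub_smul, sub_eq_zero.1 hz1]
  have e3 : (ν - μ) • a ∈ V4 := e2 ▸ V4.smul_mem _ e1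
  exact (Submodule.smul_mem_iff _ (sub_ne_zero.2 hne2)).1 e3

theorem ex_basis {V : Submodule k (Fin N → k)} (hV : Module.finrank k V = 2) :
    ∃ c l, c ≠ 0 ∧ l ∉ Submodule.span k {c} ∧ V = Submodule.span k {c, l} := by
  obtain ⟨c, hcV, hcc⟩ := ex_not_span hV 0
  have hc0 : c ≠ 0 := by rintro rfl; exact hcc (zero_mem _)
  obtain ⟨l, hlV, hl⟩ := ex_not_span hV c
  exact ⟨c, l, hc0, hl, span_pair_of hV hcV hlV hc0 hl⟩

theorem relPrime_lin {c l : Fin N → k} (hc0 : c ≠ 0) (hl : l ∉ Submodule.span k {c}) :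
    IsRelPrime (lin c) (lin l) := by
  have hl0 : l ≠ 0 := by rintro rfl; exact hl (zero_mem _)
  exact relPrime_disjoint (disj_span hl).symm (lin_mem_SU (Submodule.mem_span_singleton_self c))
    (lin_mem_SU (Submodule.mem_span_singleton_self l)) (fun h => hc0 (lin_eq_zero.1 h))
    (fun h => hl0 (lin_eq_zero.1 h))

theorem split1 {V1 V2 V3 V4 : Submodule k (Fin N → k)} (h1 : Module.finrank k V1 = 2)
    (h2 : Module.finrank k V2 = 2) (h3 : Module.finrank k V3 = 2) (h4 : Module.finrank k V4 = 2)
    (hd : Disjoint V1 (V2 ⊔ V3 ⊔ V4)) (h : Module.finrank k ↥(V2 ⊔ V3 ⊔ V4) ≤ 4) :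
    Split (PV V1 ⊓ PV V2 ⊓ PV V3 ⊓ PV V4) := by
  obtain ⟨c, l, hc0, hl, hV⟩ := ex_basis h1
  have hl0 : l ≠ 0 := by rintro rfl; exact hl (zero_mem _)
  refine ⟨V1, V2 ⊔ V3 ⊔ V4, 1, 3, ![V1], ![V2, V3, V4], lin c, lin l, hd, by omega, h,
    ?_, ?_, ?_, ?_, ?_, ?_, fun h => hc0 (lin_eq_zero.1 h), fun h => hl0 (lin_eq_zero.1 h),
    relPrime_lin hc0 hl, ?_, ?_⟩
  · intro i; fin_cases i; exact h1
  · intro i; fin_cases i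
    · exact h2
    · exact h3
    · exact h4
  · intro i; fin_cases i; exact le_rfl
  · intro i; fin_cases i
    · exact le_sup_left.trans le_sup_left
    · exact le_sup_right.trans le_sup_left
    · exact le_sup_right
  · exact lin_mem_SU (hV ▸ Submodule.subset_span (by simp))
  · exact lin_mem_SU (hV ▸ Submodule.subset_span (by simp))
  · rw [← PV_span_pair, ← hV]
    simp
  · ext x
    simp [Submodule.mem_iInf, Fin.forall_fin_succ, and_assoc]

theorem split2 {V1 V2 V3 V4 : Submodule k (Fin N → k)} (h1 : Module.finrank k V1 = 2)
    (h2 : Module.finrank k V2 = 2) (h3 : Module.finrank k V3 = 2) (h4 : Module.finrank k V4 = 2)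
    (hne : V1 ≠ V2) (hnd : ¬ Disjoint V1 V2)
    (hd : Disjoint (V1 ⊔ V2) (V3 ⊔ V4)) :
    Split (PV V1 ⊓ PV V2 ⊓ PV V3 ⊓ PV V4) := by
  have hx : ∃ x ∈ V1 ⊓ V2, x ≠ 0 := by
    rw [disjoint_iff] at hnd
    exact Submodule.exists_mem_ne_zero_of_ne_bot hnd
  obtain ⟨x, ⟨hx1, hx2⟩, hx0⟩ := hx
  obtain ⟨a, haV, ha⟩ := ex_not_span h1 x
  obtain ⟨b, hbV, hb⟩ := ex_not_span h2 x
  have ha0 : a ≠ 0 := by rintro rfl; exact ha (zero_mem _)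
  have hb0 : b ≠ 0 := by rintro rfl; exact hb (zero_mem _)
  have hV1 := span_pair_of h1 hx1 haV hx0 ha
  have hV2 := span_pair_of h2 hx2 hbV hx0 hb
  have haV2 : a ∉ V2 := by
    intro h
    exact hne (hV1.trans (span_pair_of h2 hx2 h hx0 ha).symm)
  have hlx : lin x ≠ 0 := fun h => hx0 (lin_eq_zero.1 h)
  have hla : lin a ≠ 0 := fun h => ha0 (lin_eq_zero.1 h)
  have hlb : lin b ≠ 0 := fun h => hb0 (lin_eq_zero.1 h)
  have e12 : Module.finrank k ↥(V1 ⊔ V2) ≤ 4 := by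
    have := Submodule.finrank_add_le_finrank_add_finrank V1 V2; omega
  have e34 : Module.finrank k ↥(V3 ⊔ V4) ≤ 4 := by
    have := Submodule.finrank_add_le_finrank_add_finrank V3 V4; omega
  refine ⟨V1 ⊔ V2, V3 ⊔ V4, 2, 2, ![V1, V2], ![V3, V4], lin x, lin a * lin b, hd,
    by omega, e34, ?_, ?_, ?_, ?_, ?_, ?_, hlx, mul_ne_zero hla hlb,
    (relPrime_lin hx0 ha).mul_right (relPrime_lin hx0 hb), ?_, ?_⟩
  · intro i; fin_cases i
    · exact h1
    · exact h2
  · intro i; fin_cases i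
    · exact h3
    · exact h4
  · intro i; fin_cases i
    · exact le_sup_left
    · exact le_sup_right
  · intro i; fin_cases i
    · exact le_sup_left
    · exact le_sup_right
  · exact lin_mem_SU (Submodule.mem_sup_left hx1)
  · exact mul_mem (lin_mem_SU (Submodule.mem_sup_left haV)) (lin_mem_SU (Submodule.mem_sup_right hbV))
  · have : ⨅ i, PV ((![V1, V2] : Fin 2 → _) i) = PV V1 ⊓ PV V2 := by
      ext x
      simp [Submodule.mem_iInf, Fin.forall_fin_succ]
    rw [this]
    apply le_antisymm
    · rintro f ⟨hf1, hf2⟩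
      have hf1' := hf1
      simp only [SetLike.mem_coe] at hf1' hf2
      rw [hV1, PV_span_pair] at hf1'
      obtain ⟨u, w, rfl⟩ := Ideal.mem_span_pair.1 hf1'
      have m1 : w * lin a ∈ PV V2 :=
        (Submodule.add_mem_iff_right _ (Ideal.mul_mem_left _ u (lin_mem hx2))).1 hf2
      have m2 := ((PV_prime V2).mem_or_mem m1).resolve_right fun h => haV2 (lin_mem_PV.1 h)
      rw [hV2, PV_span_pair] at m2
      obtain ⟨p, q, rfl⟩ := Ideal.mem_span_pair.1 m2
      exact Ideal.mem_span_pair.2 ⟨u + p * lin a, q, by ring⟩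
    · rw [Ideal.span_le]
      rintro f (rfl | rfl)
      · exact ⟨lin_mem hx1, lin_mem hx2⟩
      · exact ⟨Ideal.mul_mem_right _ _ (lin_mem haV), Ideal.mul_mem_left _ _ (lin_mem hbV)⟩
  · ext x
    simp [Submodule.mem_iInf, Fin.forall_fin_succ, and_assoc]

theorem fr_disj {A B : Submodule k (Fin N → k)}
    (h : Module.finrank k A + Module.finrank k B ≤ Module.finrank k ↥(A ⊔ B)) : Disjoint A B := by
  have := Submodule.finrank_sup_add_finrank_inf_eq A B
  rw [disjoint_iff, ← Submodule.finrank_eq_zero (R := k)]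
  omega

theorem fr_sup {A B : Submodule k (Fin N → k)} (h : Disjoint A B) :
    Module.finrank k ↥(A ⊔ B) = Module.finrank k A + Module.finrank k B := by
  have := Submodule.finrank_sup_add_finrank_inf_eq A B
  rw [disjoint_iff.1 h, finrank_bot] at this
  omega

theorem fr_pos {A B : Submodule k (Fin N → k)} (h : ¬ Disjoint A B) :
    1 ≤ Module.finrank k ↥(A ⊓ B) := by
  rw [disjoint_iff, ← Submodule.finrank_eq_zero (R := k)] at h
  omega

theorem fr_sup_le (A B : Submodule k (Fin N → k)) :
    Module.finrank k ↥(A ⊔ B) ≤ Module.finrank k A + Module.finrank k B :=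
  Submodule.finrank_add_le_finrank_add_finrank A B

theorem stable_le {V1 V23 V4 : Submodule k (Fin N → k)} (hle : V4 ≤ V1 ⊔ V23)
    (hs : ∀ a ∈ V1, ∀ b ∈ V23, a + b ∈ V4 → a ∈ V4) (hd : Disjoint V1 V4) : V4 ≤ V23 := by
  intro v hv
  obtain ⟨a, ha, b, hb, rfl⟩ := Submodule.mem_sup.1 (hle hv)
  have h1 := hs a ha b hb hv
  have : a = 0 := by simpa using hd.le_bot (x := a) ⟨ha, h1⟩
  rw [this, zero_add]; exact hb

theorem caseA [Infinite k] {V1 V2 V3 V4 : Submodule k (Fin N → k)} (h1 : Module.finrank k V1 = 2)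
    (h2 : Module.finrank k V2 = 2) (h3 : Module.finrank k V3 = 2) (h4 : Module.finrank k V4 = 2)
    {f1 f2 : MvPolynomial (Fin N) k} (hf1 : f1.IsHomogeneous 3) (hf2 : f2.IsHomogeneous 3)
    (hht : (Ideal.span {f1, f2}).height = 2) (hr : IsRelPrime f1 f2)
    (hfV : ∀ f, f = f1 ∨ f = f2 → f ∈ PV V1 ∧ f ∈ PV V2 ∧ f ∈ PV V3 ∧ f ∈ PV V4)
    (h6 : 6 ≤ Module.finrank k ↥(V1 ⊔ V2 ⊔ V3)) :
    Split (PV V1 ⊓ PV V2 ⊓ PV V3 ⊓ PV V4) := by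
  have e12 := fr_sup_le V1 V2
  have e13 := fr_sup_le V1 V3
  have e23 := fr_sup_le V2 V3
  have eq1 : V1 ⊔ V2 ⊔ V3 = V1 ⊔ (V2 ⊔ V3) := sup_assoc _ _ _
  have eq2 : V1 ⊔ V2 ⊔ V3 = V2 ⊔ (V1 ⊔ V3) := by rw [sup_comm V1 V2, sup_assoc]
  have eq3 : V1 ⊔ V2 ⊔ V3 = V3 ⊔ (V1 ⊔ V2) := sup_comm _ _
  have s1 := fr_sup_le V1 (V2 ⊔ V3)
  have s2 := fr_sup_le V2 (V1 ⊔ V3)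
  have s3 := fr_sup_le V3 (V1 ⊔ V2)
  rw [← eq1] at s1
  rw [← eq2] at s2
  rw [← eq3] at s3
  have d12 : Disjoint V1 V2 := fr_disj (by omega)
  have d13 : Disjoint V1 V3 := fr_disj (by omega)
  have d23 : Disjoint V2 V3 := fr_disj (by omega)
  have d1 : Disjoint V1 (V2 ⊔ V3) := fr_disj (by rw [← eq1]; omega)
  have d2 : Disjoint V2 (V1 ⊔ V3) := fr_disj (by rw [← eq2]; omega)
  have d3 : Disjoint V3 (V1 ⊔ V2) := fr_disj (by rw [← eq3]; omega)
  have hle : V4 ≤ V1 ⊔ V2 ⊔ V3 := by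
    by_contra hn
    have := lemma2 h3 d12 d13 d23 (lemma1 h4 hf1 hf2 hr hfV hn)
    rw [sup_eq_left.2 this] at h6
    omega
  have st1 : ∀ a ∈ V1, ∀ b ∈ V2 ⊔ V3, a + b ∈ V4 → a ∈ V4 := fun a ha b hb hab =>
    torus h1 h2 h4 d1 d23 hf1 hf2 hht hfV ha hb hab
  have st2 : ∀ a ∈ V2, ∀ b ∈ V1 ⊔ V3, a + b ∈ V4 → a ∈ V4 := fun a ha b hb hab =>
    torus h2 h1 h4 d2 d13 hf1 hf2 hht (fun f hf => by
      obtain ⟨q1, q2, q3, q4⟩ := hfV f hf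
      exact ⟨q2, q1, q3, q4⟩) ha hb hab
  have st3 : ∀ a ∈ V3, ∀ b ∈ V1 ⊔ V2, a + b ∈ V4 → a ∈ V4 := fun a ha b hb hab =>
    torus h3 h1 h4 d3 d12 hf1 hf2 hht (fun f hf => by
      obtain ⟨q1, q2, q3, q4⟩ := hfV f hf
      exact ⟨q3, q1, q2, q4⟩) ha hb hab
  by_cases c1 : Disjoint V1 V4
  · have hl := stable_le (eq1 ▸ hle) st1 c1
    have : V2 ⊔ V3 ⊔ V4 = V2 ⊔ V3 := sup_eq_left.2 hl
    exact split1 h1 h2 h3 h4 (by rw [this]; exact d1) (by rw [this]; omega)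
  by_cases c2 : Disjoint V2 V4
  · have hl := stable_le (eq2 ▸ hle) st2 c2
    have : V1 ⊔ V3 ⊔ V4 = V1 ⊔ V3 := sup_eq_left.2 hl
    have := split1 h2 h1 h3 h4 (by rw [this]; exact d2) (by rw [this]; omega)
    rwa [inf_comm (PV V2) (PV V1)] at this
  by_cases c3 : Disjoint V3 V4
  · have hl := stable_le (eq3 ▸ hle) st3 c3
    have : V1 ⊔ V2 ⊔ V4 = V1 ⊔ V2 := sup_eq_left.2 hl
    have := split1 h3 h1 h2 h4 (by rw [this]; exact d3) (by rw [this]; omega)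
    rwa [inf_assoc (PV V3), inf_comm (PV V3)] at this
  exfalso
  have p1 := fr_pos c1
  have p2 := fr_pos c2
  have p3 := fr_pos c3
  have x23 := fr_sup (A := V2 ⊓ V4) (B := V3 ⊓ V4) (d23.mono inf_le_left inf_le_left)
  have x1 := fr_sup (A := V1 ⊓ V4) (B := V2 ⊓ V4 ⊔ V3 ⊓ V4)
    (d1.mono inf_le_left (sup_le_sup inf_le_left inf_le_left))
  have := Submodule.finrank_mono (R := k)
    (show V1 ⊓ V4 ⊔ (V2 ⊓ V4 ⊔ V3 ⊓ V4) ≤ V4 from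
      sup_le inf_le_right (sup_le inf_le_right inf_le_right))
  omega

end
end S19

namespace S19

section
variable {k : Type} [Field k] {N : ℕ}

theorem meeting {A B C : Submodule k (Fin N → k)} (hA : Module.finrank k A = 2)
    (hB : Module.finrank k B = 2) (hC : Module.finrank k C = 2)
    (h5 : ¬ Module.finrank k ↥(A ⊔ B ⊔ C) ≤ 4)
    (hq : ∃ q : MvPolynomial (Fin N) k, q.IsHomogeneous 2 ∧ q ≠ 0 ∧ q ∈ PV A ∧ q ∈ PV B ∧ q ∈ PV C) :
    ¬ Disjoint A B ∨ ¬ Disjoint A C ∨ ¬ Disjoint B C := by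
  by_contra hcon
  push Not at hcon
  obtain ⟨a, b, c⟩ := hcon
  have := lemma2 hC a b c hq
  rw [sup_eq_left.2 this] at h5
  have := fr_sup_le A B
  omega

theorem fr3 {A B : Submodule k (Fin N → k)} (hA : Module.finrank k A = 2)
    (hB : Module.finrank k B = 2) (h : ¬ Disjoint A B) : Module.finrank k ↥(A ⊔ B) ≤ 3 := by
  have := fr_pos h
  have := Submodule.finrank_sup_add_finrank_inf_eq A B
  omega

theorem twoEdges {A B C : Submodule k (Fin N → k)} (hA : Module.finrank k A = 2)
    (hB : Module.finrank k B = 2) (hC : Module.finrank k C = 2)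
    (h1 : ¬ Disjoint A B) (h2 : ¬ Disjoint A C) : Module.finrank k ↥(A ⊔ B ⊔ C) ≤ 4 := by
  have := fr3 hA hB h1
  have := fr_pos (A := A ⊔ B) (B := C) (fun h => h2 (h.mono_left le_sup_left))
  have := Submodule.finrank_sup_add_finrank_inf_eq (A ⊔ B) C
  omega

theorem edges {A B C : Submodule k (Fin N → k)} (hA : Module.finrank k A = 2)
    (hB : Module.finrank k B = 2) (hC : Module.finrank k C = 2)
    (h5 : ¬ Module.finrank k ↥(A ⊔ B ⊔ C) ≤ 4) :
    ¬ (¬ Disjoint A B ∧ ¬ Disjoint A C) ∧ ¬ (¬ Disjoint A B ∧ ¬ Disjoint B C) ∧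
    ¬ (¬ Disjoint A C ∧ ¬ Disjoint B C) := by
  refine ⟨fun h => h5 (twoEdges hA hB hC h.1 h.2), fun h => h5 ?_, fun h => h5 ?_⟩
  · rw [sup_comm A B]
    exact twoEdges hB hA hC (fun x => h.1 x.symm) h.2
  · rw [sup_comm (A ⊔ B) C, ← sup_assoc]
    exact twoEdges hC hA hB (fun x => h.1 x.symm) (fun x => h.2 x.symm)

theorem matching {a12 a13 a14 a23 a24 a34 : Prop}
    (m1 : ¬ a23 ∨ ¬ a24 ∨ ¬ a34) (m2 : ¬ a13 ∨ ¬ a14 ∨ ¬ a34)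
    (m3 : ¬ a12 ∨ ¬ a14 ∨ ¬ a24) (m4 : ¬ a12 ∨ ¬ a13 ∨ ¬ a23)
    (x1 : ¬ (¬ a23 ∧ ¬ a24) ∧ ¬ (¬ a23 ∧ ¬ a34) ∧ ¬ (¬ a24 ∧ ¬ a34))
    (x2 : ¬ (¬ a13 ∧ ¬ a14) ∧ ¬ (¬ a13 ∧ ¬ a34) ∧ ¬ (¬ a14 ∧ ¬ a34))
    (x3 : ¬ (¬ a12 ∧ ¬ a14) ∧ ¬ (¬ a12 ∧ ¬ a24) ∧ ¬ (¬ a14 ∧ ¬ a24))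
    (x4 : ¬ (¬ a12 ∧ ¬ a13) ∧ ¬ (¬ a12 ∧ ¬ a23) ∧ ¬ (¬ a13 ∧ ¬ a23)) :
    (¬ a12 ∧ ¬ a34) ∨ (¬ a13 ∧ ¬ a24) ∨ (¬ a14 ∧ ¬ a23) := by
  grind

theorem classify [Infinite k] {V1 V2 V3 V4 : Submodule k (Fin N → k)} (h1 : Module.finrank k V1 = 2)
    (h2 : Module.finrank k V2 = 2) (h3 : Module.finrank k V3 = 2) (h4 : Module.finrank k V4 = 2)
    (n12 : V1 ≠ V2) (n13 : V1 ≠ V3) (n14 : V1 ≠ V4)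
    {f1 f2 : MvPolynomial (Fin N) k} (hf1 : f1.IsHomogeneous 3) (hf2 : f2.IsHomogeneous 3)
    (hht : (Ideal.span {f1, f2}).height = 2) (hr : IsRelPrime f1 f2)
    (hfV : ∀ f, f = f1 ∨ f = f2 → f ∈ PV V1 ∧ f ∈ PV V2 ∧ f ∈ PV V3 ∧ f ∈ PV V4) :
    Module.finrank k ↥(V1 ⊔ V2 ⊔ V3 ⊔ V4) ≤ 5 ∨ Split (PV V1 ⊓ PV V2 ⊓ PV V3 ⊓ PV V4) := by
  by_cases h6 : Module.finrank k ↥(V1 ⊔ V2 ⊔ V3 ⊔ V4) ≤ 5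
  · exact Or.inl h6
  right
  -- permuted data
  have P1 : ∀ f, f = f1 ∨ f = f2 → f ∈ PV V2 ∧ f ∈ PV V3 ∧ f ∈ PV V4 ∧ f ∈ PV V1 := fun f hf => by
    obtain ⟨a, b, c, d⟩ := hfV f hf; exact ⟨b, c, d, a⟩
  have P2 : ∀ f, f = f1 ∨ f = f2 → f ∈ PV V1 ∧ f ∈ PV V3 ∧ f ∈ PV V4 ∧ f ∈ PV V2 := fun f hf => by
    obtain ⟨a, b, c, d⟩ := hfV f hf; exact ⟨a, c, d, b⟩
  have P3 : ∀ f, f = f1 ∨ f = f2 → f ∈ PV V1 ∧ f ∈ PV V2 ∧ f ∈ PV V4 ∧ f ∈ PV V3 := fun f hf => by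
    obtain ⟨a, b, c, d⟩ := hfV f hf; exact ⟨a, b, d, c⟩
  have K1 : PV V2 ⊓ PV V3 ⊓ PV V4 ⊓ PV V1 = PV V1 ⊓ PV V2 ⊓ PV V3 ⊓ PV V4 := by ac_rfl
  have K2 : PV V1 ⊓ PV V3 ⊓ PV V4 ⊓ PV V2 = PV V1 ⊓ PV V2 ⊓ PV V3 ⊓ PV V4 := by ac_rfl
  have K3 : PV V1 ⊓ PV V2 ⊓ PV V4 ⊓ PV V3 = PV V1 ⊓ PV V2 ⊓ PV V3 ⊓ PV V4 := by ac_rfl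
  have E1 : V1 ⊔ V2 ⊔ V3 ⊔ V4 = V1 ⊔ (V2 ⊔ V3 ⊔ V4) := by ac_rfl
  have E2 : V1 ⊔ V2 ⊔ V3 ⊔ V4 = V2 ⊔ (V1 ⊔ V3 ⊔ V4) := by ac_rfl
  have E3 : V1 ⊔ V2 ⊔ V3 ⊔ V4 = V3 ⊔ (V1 ⊔ V2 ⊔ V4) := by ac_rfl
  have E4 : V1 ⊔ V2 ⊔ V3 ⊔ V4 = V4 ⊔ (V1 ⊔ V2 ⊔ V3) := by ac_rfl
  by_cases c4 : 6 ≤ Module.finrank k ↥(V1 ⊔ V2 ⊔ V3)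
  · exact caseA h1 h2 h3 h4 hf1 hf2 hht hr hfV c4
  by_cases c1 : 6 ≤ Module.finrank k ↥(V2 ⊔ V3 ⊔ V4)
  · exact K1 ▸ caseA h2 h3 h4 h1 hf1 hf2 hht hr P1 c1
  by_cases c2 : 6 ≤ Module.finrank k ↥(V1 ⊔ V3 ⊔ V4)
  · exact K2 ▸ caseA h1 h3 h4 h2 hf1 hf2 hht hr P2 c2
  by_cases c3 : 6 ≤ Module.finrank k ↥(V1 ⊔ V2 ⊔ V4)
  · exact K3 ▸ caseA h1 h2 h4 h3 hf1 hf2 hht hr P3 c3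
  have q1 := lemma1 h1 hf1 hf2 hr P1 (fun h => by rw [E1, sup_eq_right.2 h] at h6; omega)
  have q2 := lemma1 h2 hf1 hf2 hr P2 (fun h => by rw [E2, sup_eq_right.2 h] at h6; omega)
  have q3 := lemma1 h3 hf1 hf2 hr P3 (fun h => by rw [E3, sup_eq_right.2 h] at h6; omega)
  have q4 := lemma1 h4 hf1 hf2 hr hfV (fun h => by rw [E4, sup_eq_right.2 h] at h6; omega)
  by_cases b1 : Module.finrank k ↥(V2 ⊔ V3 ⊔ V4) ≤ 4
  · exact split1 h1 h2 h3 h4 (fr_disj (by rw [← E1]; omega)) b1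
  by_cases b2 : Module.finrank k ↥(V1 ⊔ V3 ⊔ V4) ≤ 4
  · have := split1 h2 h1 h3 h4 (fr_disj (by rw [← E2]; omega)) b2
    rwa [show PV V2 ⊓ PV V1 ⊓ PV V3 ⊓ PV V4 = PV V1 ⊓ PV V2 ⊓ PV V3 ⊓ PV V4 by ac_rfl] at this
  by_cases b3 : Module.finrank k ↥(V1 ⊔ V2 ⊔ V4) ≤ 4
  · have := split1 h3 h1 h2 h4 (fr_disj (by rw [← E3]; omega)) b3
    rwa [show PV V3 ⊓ PV V1 ⊓ PV V2 ⊓ PV V4 = PV V1 ⊓ PV V2 ⊓ PV V3 ⊓ PV V4 by ac_rfl] at this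
  by_cases b4 : Module.finrank k ↥(V1 ⊔ V2 ⊔ V3) ≤ 4
  · have := split1 h4 h1 h2 h3 (fr_disj (by rw [← E4]; omega)) b4
    rwa [show PV V4 ⊓ PV V1 ⊓ PV V2 ⊓ PV V3 = PV V1 ⊓ PV V2 ⊓ PV V3 ⊓ PV V4 by ac_rfl] at this
  have m1 := meeting h2 h3 h4 b1 q1
  have m2 := meeting h1 h3 h4 b2 q2
  have m3 := meeting h1 h2 h4 b3 q3
  have m4 := meeting h1 h2 h3 b4 q4
  have x1 := edges h2 h3 h4 b1
  have x2 := edges h1 h3 h4 b2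
  have x3 := edges h1 h2 h4 b3
  have x4 := edges h1 h2 h3 b4
  have key : (¬ Disjoint V1 V2 ∧ ¬ Disjoint V3 V4) ∨ (¬ Disjoint V1 V3 ∧ ¬ Disjoint V2 V4) ∨
      (¬ Disjoint V1 V4 ∧ ¬ Disjoint V2 V3) :=
    matching m1 m2 m3 m4 x1 x2 x3 x4
  rcases key with ⟨a, b⟩ | ⟨a, b⟩ | ⟨a, b⟩
  · refine split2 h1 h2 h3 h4 n12 a (fr_disj ?_)
    have := fr3 h1 h2 a
    have := fr3 h3 h4 b
    rw [show V1 ⊔ V2 ⊔ (V3 ⊔ V4) = V1 ⊔ V2 ⊔ V3 ⊔ V4 by ac_rfl]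
    omega
  · have := split2 h1 h3 h2 h4 n13 a (fr_disj (by
      have := fr3 h1 h3 a
      have := fr3 h2 h4 b
      rw [show V1 ⊔ V3 ⊔ (V2 ⊔ V4) = V1 ⊔ V2 ⊔ V3 ⊔ V4 by ac_rfl]
      omega))
    rwa [show PV V1 ⊓ PV V3 ⊓ PV V2 ⊓ PV V4 = PV V1 ⊓ PV V2 ⊓ PV V3 ⊓ PV V4 by ac_rfl] at this
  · have := split2 h1 h4 h2 h3 n14 a (fr_disj (by
      have := fr3 h1 h4 a
      have := fr3 h2 h3 b
      rw [show V1 ⊔ V4 ⊔ (V2 ⊔ V3) = V1 ⊔ V2 ⊔ V3 ⊔ V4 by ac_rfl]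
      omega))
    rwa [show PV V1 ⊓ PV V4 ⊓ PV V2 ⊓ PV V3 = PV V1 ⊓ PV V2 ⊓ PV V3 ⊓ PV V4 by ac_rfl] at this

theorem main [Infinite k] {f₁ f₂ f₃ : MvPolynomial (Fin N) k}
    (hf₁ : f₁.IsHomogeneous 3) (hf₂ : f₂.IsHomogeneous 3)
    (hIht : idealHeight (Ideal.span {f₁, f₂, f₃}) = 2)
    (hht₁₂ : idealHeight (Ideal.span {f₁, f₂}) = 2)
    {V1 V2 V3 V4 : Submodule k (Fin N → k)} (h1 : Module.finrank k V1 = 2)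
    (h2 : Module.finrank k V2 = 2) (h3 : Module.finrank k V3 = 2) (h4 : Module.finrank k V4 = 2)
    (n12 : V1 ≠ V2) (n13 : V1 ≠ V3) (n14 : V1 ≠ V4)
    (hK : PV V1 ⊓ PV V2 ⊓ PV V3 ⊓ PV V4 = unmixedPart (Ideal.span {f₁, f₂, f₃}) ∨
          PV V1 ⊓ PV V2 ⊓ PV V3 ⊓ PV V4 =
            Submodule.colon (Ideal.span {f₁, f₂}) (Ideal.span {f₃})) :
    PD (MvPolynomial (Fin N) k) (MvPolynomial (Fin N) k ⧸ Ideal.span {f₁, f₂, f₃}) 5 := by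
  have hr : IsRelPrime f₁ f₂ := relPrime_of_height hht₁₂
  have hfK : ∀ f, f = f₁ ∨ f = f₂ → f ∈ PV V1 ⊓ PV V2 ⊓ PV V3 ⊓ PV V4 := by
    intro f hf
    rcases hK with hK | hK
    · rw [hK]
      apply le_unmixedPart
      apply Ideal.subset_span
      rcases hf with rfl | rfl <;> simp
    · rw [hK, mem_colon_span]
      apply Ideal.mul_mem_right
      apply Ideal.subset_span
      rcases hf with rfl | rfl <;> simp
  have hfV : ∀ f, f = f₁ ∨ f = f₂ → f ∈ PV V1 ∧ f ∈ PV V2 ∧ f ∈ PV V3 ∧ f ∈ PV V4 := by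
    intro f hf
    obtain ⟨⟨⟨a, b⟩, c⟩, d⟩ := hfK f hf
    exact ⟨a, b, c, d⟩
  have h0 : f₁ ≠ 0 := by
    rintro rfl
    have hu : IsUnit f₂ := hr (dvd_zero _) dvd_rfl
    exact (PV_prime V1).ne_top (Ideal.eq_top_of_isUnit_mem _ (hfV f₂ (Or.inr rfl)).1 hu)
  have hcl := classify h1 h2 h3 h4 n12 n13 n14 hf₁ hf₂ (by rw [← idealHeight_eq]; exact hht₁₂) hr hfV
  have hKi : PV V1 ⊓ PV V2 ⊓ PV V3 ⊓ PV V4 = ⨅ i, PV ((![V1, V2, V3, V4] : Fin 4 → _) i) := by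
    ext x
    simp [Submodule.mem_iInf, Fin.forall_fin_succ, and_assoc]
  have hVi : ∀ i, Module.finrank k ↥((![V1, V2, V3, V4] : Fin 4 → _) i) = 2 := by
    intro i; fin_cases i
    · exact h1
    · exact h2
    · exact h3
    · exact h4
  have hUi : ∀ i, (![V1, V2, V3, V4] : Fin 4 → _) i ≤ V1 ⊔ V2 ⊔ V3 ⊔ V4 := by
    intro i; fin_cases i
    · exact le_sup_left.trans (le_sup_left.trans le_sup_left)
    · exact le_sup_right.trans (le_sup_left.trans le_sup_left)
    · exact le_sup_right.trans le_sup_left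
    · exact le_sup_right
  have hZ : ∀ x, x ∈ Submodule.colon (Ideal.span {f₁, f₂}) (Ideal.span {f₃}) ↔
      x * f₃ ∈ Ideal.span {f₁, f₂} := fun x => mem_colon_span
  refine PD_final h0 hr hZ ?_
  rcases hK with hK | hK
  · refine PD_of_Tors h0 hr hZ (K := PV V1 ⊓ PV V2 ⊓ PV V3 ⊓ PV V4) ?_ ?_
    · intro x
      rw [hZ, hK]
      exact ker_unmixed (Unm_mvPolynomial k N) hr hIht x
    · rcases hcl with hcl | hcl
      · rw [hKi]
        exact PM hcl hVi hUi h0 hr (hKi ▸ hfK f₁ (Or.inl rfl)) (hKi ▸ hfK f₂ (Or.inr rfl))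
      · exact hcl.pdTors h0 hr (hfK f₁ (Or.inl rfl)) (hfK f₂ (Or.inr rfl))
  · rw [← hK]
    rcases hcl with hcl | hcl
    · rw [hKi]
      exact PK hcl (by norm_num) hVi hUi
    · exact hcl.pdK

end
end S19

theorem statement_19
    {k : Type} [Field k] [IsAlgClosed k] {N : ℕ}
    (f₁ f₂ f₃ : MvPolynomial (Fin N) k)
    (hf₁ : f₁.IsHomogeneous 3) (hf₂ : f₂.IsHomogeneous 3) (hf₃ : f₃.IsHomogeneous 3)
    (hIht : idealHeight (Ideal.span {f₁, f₂, f₃}) = 2)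
    (hht₁₂ : idealHeight (Ideal.span {f₁, f₂}) = 2)
    (hht₁₃ : idealHeight (Ideal.span {f₁, f₃}) = 2)
    (hht₂₃ : idealHeight (Ideal.span {f₂, f₃}) = 2)
    (p₁ p₂ p₃ p₄ : Ideal (MvPolynomial (Fin N) k))
    (hp₁ : IsLinearPrime p₁) (hp₂ : IsLinearPrime p₂)
    (hp₃ : IsLinearPrime p₃) (hp₄ : IsLinearPrime p₄)
    (hpht₁ : idealHeight p₁ = 2) (hpht₂ : idealHeight p₂ = 2)
    (hpht₃ : idealHeight p₃ = 2) (hpht₄ : idealHeight p₄ = 2)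
    (hne₁₂ : p₁ ≠ p₂) (hne₁₃ : p₁ ≠ p₃) (hne₁₄ : p₁ ≠ p₄)
    (hne₂₃ : p₂ ≠ p₃) (hne₂₄ : p₂ ≠ p₄) (hne₃₄ : p₃ ≠ p₄)
    (hK : p₁ ⊓ p₂ ⊓ p₃ ⊓ p₄ = unmixedPart (Ideal.span {f₁, f₂, f₃}) ∨
          p₁ ⊓ p₂ ⊓ p₃ ⊓ p₄ = Submodule.colon (Ideal.span {f₁, f₂}) (Ideal.span {f₃})) :
    pdQuotLE (Ideal.span {f₁, f₂, f₃}) 5 := by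
  have : Infinite k := IsAlgClosed.instInfinite
  obtain ⟨V1, rfl, h1⟩ := S19.linearPrime_eq hp₁ hpht₁
  obtain ⟨V2, rfl, h2⟩ := S19.linearPrime_eq hp₂ hpht₂
  obtain ⟨V3, rfl, h3⟩ := S19.linearPrime_eq hp₃ hpht₃
  obtain ⟨V4, rfl, h4⟩ := S19.linearPrime_eq hp₄ hpht₄
  exact S19.PD.pdQuotLE (S19.main hf₁ hf₂ hIht hht₁₂ h1 h2 h3 h4
    (fun h => hne₁₂ (h ▸ rfl)) (fun h => hne₁₃ (h ▸ rfl)) (fun h => hne₁₄ (h ▸ rfl)) hK)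

end
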